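/- Comparison principle for the stationary generalized Dirichlet problem: let h ∈ C(Ω̄) and k ∈ C(∂Ω). Assume either (m > 0 and λ > 0) or (m > 1, λ = 0, and S(Ω,h,k,0) admits a bounded strict subsolution). Let u be a bounded upper semicontinuous viscosity subsolution and v a bounded lower semicontinuous viscosity supersolution of S(Ω,h,k,λ). Then u ≤ v in Ω. Moreover, the function ũ defined by ũ(z) = u(z) for z ∈ Ω and ũ(z) = limsup of u(y) as y → z with y ∈ Ω, for z ∈ ∂Ω, is still a bounded viscosity subsolution of S(Ω,h,k,λ) and ũ ≤ v in Ω̄. -/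

import Mathlib

open Set Filter Topology Metric MeasureTheory

noncomputable section

/-- Euclidean space `ℝ^N`. -/
abbrev Euc (N : ℕ) : Type := EuclideanSpace ℝ (Fin N)

/-- The Laplacian of `φ` at `x`, computed as the trace of the second derivative
in the standard orthonormal basis of `ℝ^N`. -/
noncomputable def lapl {N : ℕ} (φ : Euc N → ℝ) (x : Euc N) : ℝ :=
  ∑ i : Fin N,
    iteratedFDeriv ℝ 2 φ x ![EuclideanSpace.single i 1, EuclideanSpace.single i 1]

/-- `Ω` is a domain with `C²` boundary: it is the sublevel set of a `C²`
defining function whose gradient does not vanish on the boundary. -/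
def HasC2Boundary {N : ℕ} (Ω : Set (Euc N)) : Prop :=
  ∃ ρ : Euc N → ℝ, ContDiff ℝ 2 ρ ∧ Ω = {x | ρ x < 0} ∧
    frontier Ω = {x | ρ x = 0} ∧ ∀ x ∈ frontier Ω, gradient ρ x ≠ 0

/-- The stationary operator `−Δφ(x) + |Dφ(x)|^m + λ r − h(x)` evaluated with the
value `r` of the (sub/super)solution at `x`. -/
noncomputable def statOp {N : ℕ} (h : Euc N → ℝ) (lam m : ℝ)
    (φ : Euc N → ℝ) (r : ℝ) (x : Euc N) : ℝ :=
  -lapl φ x + ‖gradient φ x‖ ^ m + lam * r - h x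

/-- Viscosity subsolution of the generalized Dirichlet problem
`S(Ω,h,k,λ)`: `−Δw + |Dw|^m + λ w = h` in `Ω`, `w = k` on `∂Ω`. -/
def IsStatSub {N : ℕ} (Ω : Set (Euc N)) (h k : Euc N → ℝ) (lam m : ℝ)
    (u : Euc N → ℝ) : Prop :=
  UpperSemicontinuousOn u (closure Ω) ∧
  ∀ φ : Euc N → ℝ, ContDiff ℝ 2 φ → ∀ x₀ ∈ closure Ω,
    IsLocalMaxOn (u - φ) (closure Ω) x₀ →
      (x₀ ∈ Ω → statOp h lam m φ (u x₀) x₀ ≤ 0) ∧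
      (x₀ ∈ frontier Ω → min (statOp h lam m φ (u x₀) x₀) (u x₀ - k x₀) ≤ 0)

/-- Viscosity supersolution of the generalized Dirichlet problem `S(Ω,h,k,λ)`. -/
def IsStatSuper {N : ℕ} (Ω : Set (Euc N)) (h k : Euc N → ℝ) (lam m : ℝ)
    (v : Euc N → ℝ) : Prop :=
  LowerSemicontinuousOn v (closure Ω) ∧
  ∀ φ : Euc N → ℝ, ContDiff ℝ 2 φ → ∀ x₀ ∈ closure Ω,
    IsLocalMinOn (v - φ) (closure Ω) x₀ →
      (x₀ ∈ Ω → 0 ≤ statOp h lam m φ (v x₀) x₀) ∧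
      (x₀ ∈ frontier Ω → 0 ≤ max (statOp h lam m φ (v x₀) x₀) (v x₀ - k x₀))

/-- The parabolic operator
`φ_t(x,t) − Δφ(·,t)(x) + |Dφ(·,t)(x)|^m + λ r − f(x)`. -/
noncomputable def parOp {N : ℕ} (f : Euc N → ℝ) (lam m : ℝ)
    (φ : Euc N × ℝ → ℝ) (r : ℝ) (x : Euc N) (t : ℝ) : ℝ :=
  deriv (fun s => φ (x, s)) t - lapl (fun y => φ (y, t)) x
    + ‖gradient (fun y => φ (y, t)) x‖ ^ m + lam * r - f x

/-- Viscosity subsolution of the generalized initial-boundary value problem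
`E(Ω,f,g,u₀,λ)` on the time interval `[0,T]`:
`u_t − Δu + |Du|^m + λ u = f` in `Ω × (0,T]`, `u = g` on `∂Ω × (0,T]`,
`u(·,0) = u₀` on `closure Ω`. -/
def IsParSub {N : ℕ} (Ω : Set (Euc N)) (f g u₀ : Euc N → ℝ) (lam m T : ℝ)
    (u : Euc N → ℝ → ℝ) : Prop :=
  UpperSemicontinuousOn (fun p : Euc N × ℝ => u p.1 p.2) (closure Ω ×ˢ Ico 0 T) ∧
  (∀ x ∈ closure Ω, u x 0 ≤ u₀ x) ∧
  ∀ φ : Euc N × ℝ → ℝ, ContDiff ℝ 2 φ → ∀ x₀ : Euc N, ∀ t₀ : ℝ,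
    (x₀, t₀) ∈ closure Ω ×ˢ Ioc 0 T →
    IsLocalMaxOn (fun p : Euc N × ℝ => u p.1 p.2 - φ p) (closure Ω ×ˢ Ioc 0 T) (x₀, t₀) →
      (x₀ ∈ Ω → parOp f lam m φ (u x₀ t₀) x₀ t₀ ≤ 0) ∧
      (x₀ ∈ frontier Ω →
        min (parOp f lam m φ (u x₀ t₀) x₀ t₀) (u x₀ t₀ - g x₀) ≤ 0)

/-- Viscosity supersolution of `E(Ω,f,g,u₀,λ)` on the time interval `[0,T]`. -/
def IsParSuper {N : ℕ} (Ω : Set (Euc N)) (f g u₀ : Euc N → ℝ) (lam m T : ℝ)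
    (v : Euc N → ℝ → ℝ) : Prop :=
  LowerSemicontinuousOn (fun p : Euc N × ℝ => v p.1 p.2) (closure Ω ×ˢ Icc 0 T) ∧
  (∀ x ∈ closure Ω, u₀ x ≤ v x 0) ∧
  ∀ φ : Euc N × ℝ → ℝ, ContDiff ℝ 2 φ → ∀ x₀ : Euc N, ∀ t₀ : ℝ,
    (x₀, t₀) ∈ closure Ω ×ˢ Ioc 0 T →
    IsLocalMinOn (fun p : Euc N × ℝ => v p.1 p.2 - φ p) (closure Ω ×ˢ Ioc 0 T) (x₀, t₀) →
      (x₀ ∈ Ω → 0 ≤ parOp f lam m φ (v x₀ t₀) x₀ t₀) ∧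
      (x₀ ∈ frontier Ω →
        0 ≤ max (parOp f lam m φ (v x₀ t₀) x₀ t₀) (v x₀ t₀ - g x₀))

/-- A continuous viscosity solution, global in time, of `E(Ω,f,g,u₀,λ)`. -/
def IsGlobalParSol {N : ℕ} (Ω : Set (Euc N)) (f g u₀ : Euc N → ℝ) (lam m : ℝ)
    (u : Euc N → ℝ → ℝ) : Prop :=
  ContinuousOn (fun p : Euc N × ℝ => u p.1 p.2) (closure Ω ×ˢ Ici 0) ∧
  ∀ T > (0 : ℝ), IsParSub Ω f g u₀ lam m T u ∧ IsParSuper Ω f g u₀ lam m T u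

open scoped Classical in
/-- Redefinition of a parabolic subsolution on the lateral boundary by its
`limsup` from inside `Ω × (0,T]`. -/
noncomputable def uscExtPar {N : ℕ} (Ω : Set (Euc N)) (T : ℝ)
    (u : Euc N → ℝ → ℝ) : Euc N → ℝ → ℝ :=
  fun z t => if z ∈ Ω then u z t
    else limsup (fun p : Euc N × ℝ => u p.1 p.2) (𝓝[Ω ×ˢ Ioc 0 T] (z, t))

open scoped Classical in
/-- Redefinition of a stationary subsolution on the boundary by its `limsup`
from inside `Ω`. -/
noncomputable def uscExtStat {N : ℕ} (Ω : Set (Euc N))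
    (u : Euc N → ℝ) : Euc N → ℝ :=
  fun z => if z ∈ Ω then u z else limsup u (𝓝[Ω] z)

/-- Continuous viscosity solution of the state constraint problem
`−Δw + |Dw|^m + λ w = h` in `Ω`, `−Δw + |Dw|^m + λ w ≥ h` on `∂Ω`. -/
def IsSCSolution {N : ℕ} (Ω : Set (Euc N)) (h : Euc N → ℝ) (lam m : ℝ)
    (w : Euc N → ℝ) : Prop :=
  ContinuousOn w (closure Ω) ∧
  (∀ φ : Euc N → ℝ, ContDiff ℝ 2 φ → ∀ x₀ ∈ Ω, IsLocalMaxOn (w - φ) Ω x₀ →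
      statOp h lam m φ (w x₀) x₀ ≤ 0) ∧
  (∀ φ : Euc N → ℝ, ContDiff ℝ 2 φ → ∀ x₀ ∈ closure Ω,
      IsLocalMinOn (w - φ) (closure Ω) x₀ → 0 ≤ statOp h lam m φ (w x₀) x₀)

/-- Continuous viscosity subsolution of `−Δu + |Du|^m ≤ h` in `Ω`
(no boundary condition). -/
def IsIntSub {N : ℕ} (Ω : Set (Euc N)) (h : Euc N → ℝ) (m : ℝ)
    (u : Euc N → ℝ) : Prop :=
  ∀ φ : Euc N → ℝ, ContDiff ℝ 2 φ → ∀ x₀ ∈ Ω, IsLocalMaxOn (u - φ) Ω x₀ →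
    statOp h 0 m φ (u x₀) x₀ ≤ 0

/-- Hölder continuity with exponent `α` on a set. -/
def HolderOnCl {N : ℕ} (α : ℝ) (s : Set (Euc N)) (w : Euc N → ℝ) : Prop :=
  ∃ C > (0 : ℝ), ∀ x ∈ s, ∀ y ∈ s, |w x - w y| ≤ C * ‖x - y‖ ^ α

/-- Local Lipschitz continuity inside `Ω`. -/
def LocLipIn {N : ℕ} (Ω : Set (Euc N)) (w : Euc N → ℝ) : Prop :=
  ∀ x ∈ Ω, ∃ ε > (0 : ℝ), ∃ K : ℝ, 0 ≤ K ∧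
    ∀ y ∈ ball x ε ∩ Ω, ∀ z ∈ ball x ε ∩ Ω, |w y - w z| ≤ K * ‖y - z‖

/-- A piecewise `C¹` path parametrized on `[0,1]`. -/
def IsPWC1Path {N : ℕ} (γ : ℝ → Euc N) : Prop :=
  ContinuousOn γ (Icc 0 1) ∧
  ∃ n : ℕ, ∃ τ : Fin (n + 1) → ℝ, StrictMono τ ∧ τ 0 = 0 ∧ τ (Fin.last n) = 1 ∧
    ∀ i : Fin n, ContDiffOn ℝ 1 γ (Icc (τ i.castSucc) (τ i.succ))

/-- The length of a path on `[0,1]`. -/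
noncomputable def pathLen {N : ℕ} (γ : ℝ → Euc N) : ℝ :=
  ∫ t in (0 : ℝ)..1, ‖derivWithin γ (Icc (0 : ℝ) 1) t‖

/-- The geodesic-type distance inside `closure S` via piecewise `C¹` paths. -/
noncomputable def dTilde {N : ℕ} (S : Set (Euc N)) (x y : Euc N) : ℝ :=
  sInf {L : ℝ | ∃ γ : ℝ → Euc N, IsPWC1Path γ ∧ γ 0 = x ∧ γ 1 = y ∧
    MapsTo γ (Icc 0 1) (closure S) ∧ L = pathLen γ}

/-- The inner parallel set `Ω_δ = {x ∈ Ω : dist(x,∂Ω) > δ}`. -/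
def innerSet {N : ℕ} (Ω : Set (Euc N)) (δ : ℝ) : Set (Euc N) :=
  {x ∈ Ω | δ < infDist x (frontier Ω)}

end

section Calculus

variable {N : ℕ}

open InnerProductSpace Laplacian in
theorem lapl_eq_laplacian (φ : Euc N → ℝ) (x : Euc N) : lapl φ x = Δ φ x := by
  rw [laplacian_eq_iteratedFDeriv_orthonormalBasis φ (EuclideanSpace.basisFun (Fin N) ℝ)]
  simp [lapl]

theorem lapl_eq_sum_fderiv (φ : Euc N → ℝ) (x : Euc N) :
    lapl φ x = ∑ i : Fin N, fderiv ℝ (fderiv ℝ φ) x (EuclideanSpace.single i 1)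
      (EuclideanSpace.single i 1) := by
  simp [lapl, iteratedFDeriv_two_apply]

theorem lapl_congr {φ ψ : Euc N → ℝ} {x : Euc N} (h : φ =ᶠ[𝓝 x] ψ) : lapl φ x = lapl ψ x := by
  simp only [lapl_eq_laplacian]
  exact (InnerProductSpace.laplacian_congr_nhds h).eq_of_nhds

theorem gradient_congr {φ ψ : Euc N → ℝ} {x : Euc N} (h : φ =ᶠ[𝓝 x] ψ) :
    gradient φ x = gradient ψ x := by
  simp only [gradient, h.fderiv_eq]

theorem lapl_add {φ ψ : Euc N → ℝ} {x : Euc N} (h₁ : ContDiffAt ℝ 2 φ x)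
    (h₂ : ContDiffAt ℝ 2 ψ x) : lapl (fun y => φ y + ψ y) x = lapl φ x + lapl ψ x := by
  simp only [lapl_eq_laplacian]
  exact h₁.laplacian_add h₂

theorem lapl_sub {φ ψ : Euc N → ℝ} {x : Euc N} (h₁ : ContDiffAt ℝ 2 φ x)
    (h₂ : ContDiffAt ℝ 2 ψ x) : lapl (fun y => φ y - ψ y) x = lapl φ x - lapl ψ x := by
  simp only [lapl_eq_laplacian]
  exact h₁.laplacian_sub h₂

theorem lapl_neg (φ : Euc N → ℝ) (x : Euc N) : lapl (fun y => - φ y) x = - lapl φ x := by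
  simp only [lapl_eq_laplacian]
  exact congrFun (InnerProductSpace.laplacian_neg (f := φ)) x

theorem lapl_const_mul {φ : Euc N → ℝ} {x : Euc N} (c : ℝ) (h : ContDiffAt ℝ 2 φ x) :
    lapl (fun y => c * φ y) x = c * lapl φ x := by
  simp only [lapl_eq_laplacian]
  exact InnerProductSpace.laplacian_smul c h

theorem lapl_const (c : ℝ) (x : Euc N) : lapl (fun _ => c) x = 0 := by
  simp [lapl_eq_sum_fderiv]

theorem lapl_sum {ι : Type*} (s : Finset ι) {φ : ι → Euc N → ℝ} {x : Euc N}
    (h : ∀ i ∈ s, ContDiffAt ℝ 2 (φ i) x) :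
    lapl (fun y => ∑ i ∈ s, φ i y) x = ∑ i ∈ s, lapl (φ i) x := by
  classical
  induction s using Finset.induction_on with
  | empty => simp [lapl_const]
  | insert a s ha ih =>
    simp only [Finset.sum_insert ha]
    rw [lapl_add (h a (Finset.mem_insert_self a s))
      (ContDiffAt.sum fun i hi => h i (Finset.mem_insert_of_mem hi)),
      ih fun i hi => h i (Finset.mem_insert_of_mem hi)]

theorem lapl_comp_add_right (φ : Euc N → ℝ) (a x : Euc N) :
    lapl (fun y => φ (y + a)) x = lapl φ (x + a) := by
  simp only [lapl]
  simp [iteratedFDeriv_comp_add_right]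

theorem gradient_comp_add_right (φ : Euc N → ℝ) (a x : Euc N) :
    gradient (fun y => φ (y + a)) x = gradient φ (x + a) := by
  simp only [gradient]
  rw [fderiv_comp_add_right]

theorem HasGradientAt.add' {φ ψ : Euc N → ℝ} {x p q : Euc N} (h₁ : HasGradientAt φ p x)
    (h₂ : HasGradientAt ψ q x) : HasGradientAt (fun y => φ y + ψ y) (p + q) x := by
  rw [hasGradientAt_iff_hasFDerivAt] at *
  rw [map_add]
  exact h₁.add h₂

theorem HasGradientAt.neg' {φ : Euc N → ℝ} {x p : Euc N} (h₁ : HasGradientAt φ p x) :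
    HasGradientAt (fun y => - φ y) (-p) x := by
  rw [hasGradientAt_iff_hasFDerivAt] at *
  rw [map_neg]
  exact h₁.neg

theorem HasGradientAt.sub' {φ ψ : Euc N → ℝ} {x p q : Euc N} (h₁ : HasGradientAt φ p x)
    (h₂ : HasGradientAt ψ q x) : HasGradientAt (fun y => φ y - ψ y) (p - q) x := by
  simpa [sub_eq_add_neg] using h₁.add' h₂.neg'

theorem HasGradientAt.const_mul' {φ : Euc N → ℝ} {x p : Euc N} (c : ℝ)
    (h₁ : HasGradientAt φ p x) : HasGradientAt (fun y => c * φ y) (c • p) x := by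
  rw [hasGradientAt_iff_hasFDerivAt] at *
  rw [map_smul]
  exact h₁.const_mul c

theorem HasGradientAt.sum' {ι : Type*} (s : Finset ι) {φ : ι → Euc N → ℝ} {p : ι → Euc N}
    {x : Euc N} (h : ∀ i ∈ s, HasGradientAt (φ i) (p i) x) :
    HasGradientAt (fun y => ∑ i ∈ s, φ i y) (∑ i ∈ s, p i) x := by
  rw [hasGradientAt_iff_hasFDerivAt, map_sum]
  exact HasFDerivAt.fun_sum fun i hi => (hasGradientAt_iff_hasFDerivAt.1 (h i hi))

theorem ContDiffAt.hasGradientAt' {φ : Euc N → ℝ} {x : Euc N} (h : ContDiffAt ℝ 2 φ x) :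
    HasGradientAt φ (gradient φ x) x :=
  (h.differentiableAt (by norm_num)).hasGradientAt

theorem IsLocalMax.hasGradientAt_eq_zero {φ : Euc N → ℝ} {x p : Euc N} (h : IsLocalMax φ x)
    (hp : HasGradientAt φ p x) : p = 0 := by
  have := h.hasFDerivAt_eq_zero (hasGradientAt_iff_hasFDerivAt.1 hp)
  simpa using this

theorem hasGradientAt_norm_sub_sq (a x : Euc N) :
    HasGradientAt (fun y => ‖y - a‖ ^ 2) ((2 : ℝ) • (x - a)) x := by
  rw [hasGradientAt_iff_hasFDerivAt]
  have h := ((hasFDerivAt_id x).sub_const a).norm_sq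
  refine h.congr_fderiv ?_
  ext y
  simp

theorem contDiff_norm_sub_sq (a : Euc N) : ContDiff ℝ 2 (fun y : Euc N => ‖y - a‖ ^ 2) :=
  (contDiff_id.sub contDiff_const).norm_sq ℝ

theorem lapl_norm_sub_sq (a x : Euc N) : lapl (fun y => ‖y - a‖ ^ 2) x = 2 * N := by
  rw [lapl_eq_sum_fderiv]
  have h : fderiv ℝ (fun y : Euc N => ‖y - a‖ ^ 2) = fun y => (2 : ℝ) • innerSL ℝ (y - a) := by
    ext1 y
    have h := ((hasFDerivAt_id y).sub_const a).norm_sq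
    refine h.fderiv.trans ?_
    ext z
    simp
  have h2 : ∀ y, fderiv ℝ (fun y : Euc N => (2 : ℝ) • innerSL ℝ (y - a)) y
      = (2 : ℝ) • (innerSL ℝ : Euc N →L[ℝ] _) := by
    intro y
    exact (((innerSL ℝ : Euc N →L[ℝ] _).hasFDerivAt.comp y
      ((hasFDerivAt_id y).sub_const a)).const_smul (2 : ℝ)).fderiv.trans (by ext; simp)
  have h3 : ∀ i : Fin N, innerSL ℝ (EuclideanSpace.single i (1 : ℝ) : Euc N)
      (EuclideanSpace.single i 1) = 1 := fun i => by
    rw [innerSL_apply_apply]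
    simp
  simp only [h, h2, smul_apply, h3]
  simp [mul_comm]

/-- Gradient of a composition with a function of one real variable. -/
theorem HasGradientAt.comp_real {F : ℝ → ℝ} {F' : ℝ} {q : Euc N → ℝ} {x p : Euc N}
    (hF : HasDerivAt F F' (q x)) (hq : HasGradientAt q p x) :
    HasGradientAt (fun y => F (q y)) (F' • p) x := by
  rw [hasGradientAt_iff_hasFDerivAt] at *
  rw [map_smul]
  exact hF.comp_hasFDerivAt x hq

/-- Laplacian of a composition with a function of one real variable. -/
theorem lapl_comp_real {F F' : ℝ → ℝ} {F'' : ℝ} {q : Euc N → ℝ} {x : Euc N}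
    (hF : ∀ᶠ t in 𝓝 (q x), HasDerivAt F (F' t) t) (hF' : HasDerivAt F' F'' (q x))
    (hq : ContDiffAt ℝ 2 q x) :
    lapl (fun y => F (q y)) x = F'' * ‖gradient q x‖ ^ 2 + F' (q x) * lapl q x := by
  have hq1 : ∀ᶠ y in 𝓝 x, DifferentiableAt ℝ q y :=
    (hq.eventually (by simp)).mono fun y hy => hy.differentiableAt (by norm_num)
  have hev : fderiv ℝ (fun y => F (q y)) =ᶠ[𝓝 x] fun y => F' (q y) • fderiv ℝ q y := by
    filter_upwards [hq1, hq.continuousAt.eventually hF] with y hy hFy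
    exact (hFy.comp_hasFDerivAt y hy.hasFDerivAt).fderiv
  have hd : HasFDerivAt (fderiv ℝ q) (fderiv ℝ (fderiv ℝ q) x) x :=
    ((hq.fderiv_right (m := 1) (by norm_num)).differentiableAt (by norm_num)).hasFDerivAt
  have hq' := (hq.differentiableAt (by norm_num)).hasFDerivAt
  have hmain : HasFDerivAt (fun y => F' (q y) • fderiv ℝ q y) _ x :=
    (hF'.comp_hasFDerivAt x hq').smul hd
  have hcoord : ∀ i, fderiv ℝ q x (EuclideanSpace.single i 1) = gradient q x i := by
    intro i
    have := inner_gradient_left (𝕜 := ℝ) (f := q) (x := x) (y := EuclideanSpace.single i 1)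
    rw [← this, EuclideanSpace.inner_single_right]
    simp
  rw [lapl_eq_sum_fderiv, lapl_eq_sum_fderiv, hev.fderiv_eq, hmain.fderiv]
  simp only [hcoord, EuclideanSpace.norm_sq_eq, Finset.mul_sum, ← Finset.sum_add_distrib,
    add_apply, ContinuousLinearMap.smulRight_apply,
    smul_apply, smul_eq_mul, Real.norm_eq_abs, sq_abs, Function.comp]
  refine Finset.sum_congr rfl fun i _ => ?_
  ring

/-- At a local maximum the Laplacian is nonpositive. -/
theorem IsLocalMax.lapl_nonpos {φ : Euc N → ℝ} {x : Euc N} (h : IsLocalMax φ x)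
    (hφ : ContDiffAt ℝ 2 φ x) : lapl φ x ≤ 0 := by
  rw [lapl_eq_sum_fderiv]
  refine Finset.sum_nonpos fun i _ => ?_
  by_contra! hpos
  set e : Euc N := EuclideanSpace.single i 1
  have hl : ∀ t : ℝ, HasDerivAt (fun t : ℝ => x + t • e) e t := fun t => by
    simpa using ((hasDerivAt_id t).smul_const e).const_add x
  have hl0 : x + (0 : ℝ) • e = x := by simp
  have hcont : Tendsto (fun t : ℝ => x + t • e) (𝓝 0) (𝓝 x) := by
    have := (hl 0).continuousAt.tendsto
    rwa [hl0] at this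
  have hd1 : ∀ᶠ y in 𝓝 x, DifferentiableAt ℝ φ y :=
    (hφ.eventually (by simp)).mono fun y hy => hy.differentiableAt (by norm_num)
  have hg1 : deriv (fun t : ℝ => φ (x + t • e)) =ᶠ[𝓝 0] fun t => fderiv ℝ φ (x + t • e) e := by
    filter_upwards [hcont.eventually hd1] with t ht
    exact (ht.hasFDerivAt.comp_hasDerivAt t (hl t)).deriv
  have hd : HasFDerivAt (fderiv ℝ φ) (fderiv ℝ (fderiv ℝ φ) x) (x + (0 : ℝ) • e) := by
    rw [hl0]
    exact ((hφ.fderiv_right (m := 1) (by norm_num)).differentiableAt (by norm_num)).hasFDerivAt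
  have hg2 : deriv (deriv (fun t : ℝ => φ (x + t • e))) 0 = fderiv ℝ (fderiv ℝ φ) x e e := by
    rw [hg1.deriv_eq]
    have h1 := ((ContinuousLinearMap.apply ℝ ℝ e).hasFDerivAt.comp _ hd).comp_hasDerivAt
      (0 : ℝ) (hl 0)
    exact h1.deriv
  have hmax : IsLocalMax (fun t : ℝ => φ (x + t • e)) 0 := by
    have := hcont.eventually h
    filter_upwards [this] with t ht
    simpa using ht
  have hmin : IsLocalMin (fun t : ℝ => φ (x + t • e)) 0 := by
    refine isLocalMin_of_deriv_deriv_pos (hg2 ▸ hpos) hmax.deriv_eq_zero ?_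
    refine ContinuousAt.comp (g := φ) (f := fun t : ℝ => x + t • e) ?_ (hl 0).continuousAt
    rw [hl0]; exact hφ.continuousAt
  have hconst : (fun t : ℝ => φ (x + t • e)) =ᶠ[𝓝 0] fun _ => φ (x + (0 : ℝ) • e) := by
    filter_upwards [hmax, hmin] with t h1 h2 using le_antisymm h1 h2
  have : deriv (deriv (fun t : ℝ => φ (x + t • e))) 0 = 0 := by
    rw [hconst.deriv.deriv_eq]; simp
  rw [hg2] at this
  exact hpos.ne' this

/-- A function that is `C²` near a point agrees near that point with a globally `C²` function. -/
theorem ContDiffAt.exists_contDiff_eventuallyEq {φ : Euc N → ℝ} {x : Euc N}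
    (h : ContDiffAt ℝ 2 φ x) : ∃ ψ : Euc N → ℝ, ContDiff ℝ 2 ψ ∧ ψ =ᶠ[𝓝 x] φ := by
  obtain ⟨r, hr, hball⟩ := Metric.eventually_nhds_iff_ball.1 (h.eventually (by simp))
  let f : ContDiffBump x := ⟨r / 4, r / 2, by positivity, by linarith⟩
  refine ⟨fun y => f y * φ y, contDiff_iff_contDiffAt.2 fun y => ?_, ?_⟩
  · by_cases hy : y ∈ ball x r
    · exact f.contDiff.contDiffAt.mul (hball y hy)
    · have : (fun y => f y * φ y) =ᶠ[𝓝 y] fun _ => 0 := by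
        have hy' : y ∈ (closedBall x (r / 2))ᶜ := by
          simp only [mem_compl_iff, mem_closedBall, mem_ball, not_lt, not_le] at *
          linarith
        filter_upwards [isClosed_closedBall.isOpen_compl.mem_nhds hy'] with z hz
        rw [f.zero_of_le_dist (by simpa using (le_of_lt (by simpa using hz))), zero_mul]
      exact contDiffAt_const.congr_of_eventuallyEq this
  · filter_upwards [f.eventuallyEq_one] with y hy
    simp [hy]

end Calculus

section HarmonicPolynomials

variable {N : ℕ}

/-- The polynomial function on `ℝ^N` attached to a multivariate polynomial. -/
noncomputable def polyFun (p : MvPolynomial (Fin N) ℝ) (x : Euc N) : ℝ :=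
  MvPolynomial.eval (fun i => x i) p

/-- The Laplacian acting on multivariate polynomials. -/
noncomputable def polyLap : MvPolynomial (Fin N) ℝ →ₗ[ℝ] MvPolynomial (Fin N) ℝ :=
  ∑ i : Fin N, (MvPolynomial.pderiv i).toLinearMap ∘ₗ (MvPolynomial.pderiv i).toLinearMap

theorem hasFDerivAt_polyFun (p : MvPolynomial (Fin N) ℝ) (x : Euc N) :
    HasFDerivAt (polyFun p)
      (∑ i, polyFun (MvPolynomial.pderiv i p) x • (EuclideanSpace.proj i : Euc N →L[ℝ] ℝ)) x := by
  induction p using MvPolynomial.induction_on with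
  | C a =>
    have : polyFun (MvPolynomial.C a) = fun _ : Euc N => a := by ext; simp [polyFun]
    rw [this]
    refine (hasFDerivAt_const a x).congr_fderiv ?_
    simp [polyFun]
  | add p q hp hq =>
    have : polyFun (p + q) = fun y : Euc N => polyFun p y + polyFun q y := by
      ext; simp [polyFun]
    rw [this]
    refine (hp.add hq).congr_fderiv ?_
    rw [← Finset.sum_add_distrib]
    refine Finset.sum_congr rfl fun i _ => ?_
    rw [← add_smul]
    simp [polyFun]
  | mul_X p j hp =>
    have : polyFun (p * MvPolynomial.X j)
        = fun y : Euc N => polyFun p y * (EuclideanSpace.proj j : Euc N →L[ℝ] ℝ) y := by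
      ext; simp [polyFun]
    rw [this]
    refine (hp.mul (EuclideanSpace.proj j : Euc N →L[ℝ] ℝ).hasFDerivAt).congr_fderiv ?_
    ext y
    simp only [polyFun, MvPolynomial.pderiv_mul, MvPolynomial.pderiv_X, map_add, map_mul,
      MvPolynomial.eval_X, add_apply, smul_apply, sum_apply, smul_eq_mul, Finset.mul_sum,
      add_mul, Finset.sum_add_distrib]
    have hs : ∀ g : Fin N → MvPolynomial (Fin N) ℝ,
        (∀ i, g i = (Pi.single i 1 : Fin N → MvPolynomial (Fin N) ℝ) j) →
        ∑ i, MvPolynomial.eval (fun i => x i) p * MvPolynomial.eval (fun i => x i) (g i)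
          * (EuclideanSpace.proj i : Euc N →L[ℝ] ℝ) y
        = MvPolynomial.eval (fun i => x i) p * (EuclideanSpace.proj j : Euc N →L[ℝ] ℝ) y := by
      intro g hg
      rw [Finset.sum_eq_single j]
      · simp [hg]
      · intro b _ hb
        simp [hg, hb.symm]
      · simp
    rw [hs _ fun i => rfl, add_comm]
    have hx : (EuclideanSpace.proj j : Euc N →L[ℝ] ℝ) x = x j := rfl
    rw [hx]
    congr 1
    refine Finset.sum_congr rfl fun i _ => ?_
    ring

theorem polyFun_sub (p q : MvPolynomial (Fin N) ℝ) (x : Euc N) :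
    polyFun (p - q) x = polyFun p x - polyFun q x := by simp [polyFun]

theorem polyFun_mul (p q : MvPolynomial (Fin N) ℝ) (x : Euc N) :
    polyFun (p * q) x = polyFun p x * polyFun q x := by simp [polyFun]

theorem analyticOnNhd_polyFun (p : MvPolynomial (Fin N) ℝ) :
    AnalyticOnNhd ℝ (polyFun p) univ := by
  have h := AnalyticOnNhd.aeval_mvPolynomial (𝕜 := ℝ) (E := Euc N) (B := ℝ) (A := ℝ)
    (s := univ) (f := fun (x : Euc N) (i : Fin N) => x i)
    (fun i => (EuclideanSpace.proj i : Euc N →L[ℝ] ℝ).analyticOnNhd univ) p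
  exact h

theorem contDiff_polyFun (p : MvPolynomial (Fin N) ℝ) : ContDiff ℝ 2 (polyFun p) :=
  contDiff_iff_contDiffAt.2 fun x => (analyticOnNhd_polyFun p x (mem_univ x)).contDiffAt

theorem lapl_polyFun (p : MvPolynomial (Fin N) ℝ) (x : Euc N) :
    lapl (polyFun p) x = polyFun (polyLap p) x := by
  have h1 : fderiv ℝ (polyFun p) = fun y : Euc N =>
      ∑ i, polyFun (MvPolynomial.pderiv i p) y • (EuclideanSpace.proj i : Euc N →L[ℝ] ℝ) :=
    funext fun y => (hasFDerivAt_polyFun p y).fderiv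
  have h2 : HasFDerivAt (fun y : Euc N =>
      ∑ i, polyFun (MvPolynomial.pderiv i p) y • (EuclideanSpace.proj i : Euc N →L[ℝ] ℝ)) _ x :=
    HasFDerivAt.fun_sum (u := Finset.univ) fun i _ =>
      (hasFDerivAt_polyFun (MvPolynomial.pderiv i p) x).smul_const
        (EuclideanSpace.proj i : Euc N →L[ℝ] ℝ)
  rw [lapl_eq_sum_fderiv, h1, h2.fderiv]
  simp [polyLap, polyFun, sum_apply, ContinuousLinearMap.smulRight_apply]

theorem totalDegree_pderiv_le (p : MvPolynomial (Fin N) ℝ) (i : Fin N) :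
    (MvPolynomial.pderiv i p).totalDegree ≤ p.totalDegree - 1 := by
  refine Finset.sup_le fun s hs => ?_
  have hs' : s + Finsupp.single i 1 ∈ p.support := by
    rw [MvPolynomial.mem_support_iff, MvPolynomial.coeff_pderiv] at hs
    exact MvPolynomial.mem_support_iff.2 (left_ne_zero_of_mul hs)
  have := MvPolynomial.le_totalDegree hs'
  rw [Finsupp.sum_add_index' (by simp) (by simp)] at this
  simp at this
  omega

theorem totalDegree_polyLap_le (p : MvPolynomial (Fin N) ℝ) :
    (polyLap p).totalDegree ≤ p.totalDegree - 2 := by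
  rw [polyLap, LinearMap.sum_apply]
  refine MvPolynomial.totalDegree_finsetSum_le fun i _ => ?_
  have h1 := totalDegree_pderiv_le p i
  have h2 := totalDegree_pderiv_le (MvPolynomial.pderiv i p) i
  have h3 := h2.trans (Nat.sub_le_sub_right h1 1)
  exact h3.trans (by omega)

/-- Comparison in a ball between a continuous viscosity subsolution of `-Δ W ≤ A` and a harmonic
function. -/
theorem le_of_viscosity_of_harmonic (hN : 1 ≤ N) {W H : Euc N → ℝ} {x₀ : Euc N} {r A δ η : ℝ}
    (hη : 0 < η) (hW : ContinuousOn W (closedBall x₀ r))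
    (hsub : ∀ ψ : Euc N → ℝ, ContDiff ℝ 2 ψ → ∀ x ∈ ball x₀ r,
      IsLocalMax (fun y => W y - ψ y) x → -lapl ψ x ≤ A)
    (hH : ContDiff ℝ 2 H) (hH0 : ∀ x, lapl H x = 0)
    (hbd : ∀ x ∈ sphere x₀ r, W x ≤ H x + δ) :
    ∀ x ∈ closedBall x₀ r,
      W x ≤ H x + δ + (A + η) / (2 * N) * (r ^ 2 - ‖x - x₀‖ ^ 2) := by
  intro x hx
  have hN' : (0 : ℝ) < N := by exact_mod_cast hN
  set c := (A + η) / (2 * N)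
  set ψ : Euc N → ℝ := fun y => H y - c * ‖y - x₀‖ ^ 2
  have hψ : ContDiff ℝ 2 ψ := hH.sub (contDiff_const.mul (contDiff_norm_sub_sq x₀))
  obtain ⟨z, hz, hmax⟩ := (isCompact_closedBall x₀ r).exists_isMaxOn ⟨x, hx⟩
    (hW.sub hψ.continuous.continuousOn)
  have hzs : z ∈ sphere x₀ r := by
    by_contra hzs
    have hzb : z ∈ ball x₀ r := by
      rw [mem_closedBall] at hz
      rw [mem_sphere] at hzs
      exact mem_ball.2 (lt_of_le_of_ne hz hzs)
    have hloc : IsLocalMax (fun y => W y - ψ y) z :=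
      hmax.isLocalMax (mem_of_superset (isOpen_ball.mem_nhds hzb) ball_subset_closedBall)
    have h1 := hsub ψ hψ z hzb hloc
    have h2 : lapl ψ z = 0 - c * (2 * N) := by
      rw [lapl_sub hH.contDiffAt (contDiff_const.mul (contDiff_norm_sub_sq x₀)).contDiffAt,
        lapl_const_mul c (contDiff_norm_sub_sq x₀).contDiffAt, lapl_norm_sub_sq, hH0]
    have h3 : c * (2 * N) = A + η := by simp only [c]; field_simp
    linarith
  have h1 : W x - ψ x ≤ W z - ψ z := hmax hx
  have h2 := hbd z hzs
  have h3 : ‖z - x₀‖ = r := by simpa [dist_eq_norm] using hzs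
  simp only [ψ, h3] at h1
  linarith

/-- The maximum principle for harmonic functions in a ball. -/
theorem harmonic_le_of_sphere_le (hN : 1 ≤ N) {H : Euc N → ℝ} {x₀ : Euc N} {r M : ℝ}
    (hH : ContDiff ℝ 2 H) (hH0 : ∀ x, lapl H x = 0)
    (hbd : ∀ x ∈ sphere x₀ r, H x ≤ M) : ∀ x ∈ closedBall x₀ r, H x ≤ M := by
  intro x hx
  have hkey : ∀ η > 0, H x ≤ M + η / (2 * N) * (r ^ 2 - ‖x - x₀‖ ^ 2) := by
    intro η hη
    have := le_of_viscosity_of_harmonic hN (W := H) (H := fun _ => 0) (A := 0) (δ := M) hη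
      hH.continuous.continuousOn ?_ contDiff_const (lapl_const 0) (by simpa using hbd) x hx
    · simpa using this
    · intro ψ hψ y _ hy
      have h1 := hy.lapl_nonpos (hH.sub hψ).contDiffAt
      rw [lapl_sub hH.contDiffAt hψ.contDiffAt, hH0] at h1
      linarith
  have hlim : Tendsto (fun η : ℝ => M + η / (2 * N) * (r ^ 2 - ‖x - x₀‖ ^ 2)) (𝓝[>] 0)
      (𝓝 (M + 0 / (2 * N) * (r ^ 2 - ‖x - x₀‖ ^ 2))) :=
    (Continuous.tendsto (by fun_prop) 0).mono_left nhdsWithin_le_nhds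
  have := ge_of_tendsto hlim (eventually_mem_nhdsWithin.mono fun η hη => hkey η hη)
  simpa using this

/-- Every polynomial agrees on a sphere centred at the origin with a harmonic polynomial. -/
theorem exists_harmonic_polyFun (hN : 1 ≤ N) {r : ℝ} (hr : 0 < r)
    (p : MvPolynomial (Fin N) ℝ) :
    ∃ H : MvPolynomial (Fin N) ℝ, (∀ x, lapl (polyFun H) x = 0) ∧
      ∀ x ∈ sphere (0 : Euc N) r, polyFun H x = polyFun p x := by
  classical
  set q : MvPolynomial (Fin N) ℝ := MvPolynomial.C (r ^ 2) - ∑ i, MvPolynomial.X i ^ 2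
  have hq : ∀ x : Euc N, polyFun q x = r ^ 2 - ‖x‖ ^ 2 := fun x => by
    simp [q, polyFun, EuclideanSpace.norm_sq_eq]
  have hqd : q.totalDegree ≤ 2 := by
    refine (MvPolynomial.totalDegree_sub _ _).trans (max_le ?_ ?_)
    · rw [MvPolynomial.totalDegree_C]; norm_num
    refine MvPolynomial.totalDegree_finsetSum_le fun i _ => ?_
    exact (MvPolynomial.totalDegree_X_pow i 2).le
  set W := MvPolynomial.restrictTotalDegree (Fin N) ℝ p.totalDegree
  have hmaps : ∀ f ∈ W, (polyLap ∘ₗ LinearMap.mulLeft ℝ q) f ∈ W := by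
    intro f hf
    rw [MvPolynomial.mem_restrictTotalDegree] at *
    have h1 := totalDegree_polyLap_le (q * f)
    have h2 := MvPolynomial.totalDegree_mul q f
    simp only [LinearMap.comp_apply, LinearMap.mulLeft_apply]
    omega
  set T : W →ₗ[ℝ] W := (polyLap ∘ₗ LinearMap.mulLeft ℝ q).restrict hmaps
  have hinj : Function.Injective T := by
    rw [← LinearMap.ker_eq_bot, LinearMap.ker_eq_bot']
    intro f hf
    have hf0 : polyLap (q * (f : MvPolynomial (Fin N) ℝ)) = 0 := by
      have := congrArg Subtype.val hf
      simpa [T] using this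
    have hl : ∀ x, lapl (polyFun (q * (f : MvPolynomial (Fin N) ℝ))) x = 0 := fun x => by
      rw [lapl_polyFun, hf0]; simp [polyFun]
    have hsph : ∀ x ∈ sphere (0 : Euc N) r,
        polyFun (q * (f : MvPolynomial (Fin N) ℝ)) x = 0 := fun x hx => by
      have : ‖x‖ = r := by simpa using hx
      rw [polyFun_mul, hq, this]; simp
    have hzero : ∀ x ∈ ball (0 : Euc N) r, polyFun (f : MvPolynomial (Fin N) ℝ) x = 0 := by
      intro x hx
      have h1 := harmonic_le_of_sphere_le hN (contDiff_polyFun _) hl (M := 0)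
        (fun x hx => (hsph x hx).le) x (ball_subset_closedBall hx)
      have h2 := harmonic_le_of_sphere_le hN (contDiff_polyFun _).neg (M := 0)
        (fun x => by rw [lapl_neg, hl, neg_zero])
        (fun x hx => by rw [hsph x hx, neg_zero]) x (ball_subset_closedBall hx)
      have h3 : polyFun (q * (f : MvPolynomial (Fin N) ℝ)) x = 0 := by linarith
      rw [polyFun_mul, hq] at h3
      have h4 : ‖x‖ < r := by simpa using hx
      have h5 : r ^ 2 - ‖x‖ ^ 2 ≠ 0 := by nlinarith [norm_nonneg x]
      exact (mul_eq_zero.1 h3).resolve_left h5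
    have hall : polyFun (f : MvPolynomial (Fin N) ℝ) = fun _ => 0 := by
      refine (analyticOnNhd_polyFun _).eq_of_eventuallyEq (z₀ := 0)
        (analyticOnNhd_const (v := (0 : ℝ))) ?_
      exact mem_of_superset (isOpen_ball.mem_nhds (mem_ball_self hr)) hzero
    have : (f : MvPolynomial (Fin N) ℝ) = 0 := by
      refine MvPolynomial.funext fun y => ?_
      have := congrFun hall (WithLp.toLp 2 y)
      simpa [polyFun] using this
    exact Subtype.ext this
  have hsurj : Function.Surjective T := LinearMap.injective_iff_surjective.1 hinj
  have hp : polyLap p ∈ W := by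
    rw [MvPolynomial.mem_restrictTotalDegree]
    exact (totalDegree_polyLap_le p).trans (Nat.sub_le _ _)
  obtain ⟨f, hf⟩ := hsurj ⟨polyLap p, hp⟩
  have hf' : polyLap (q * (f : MvPolynomial (Fin N) ℝ)) = polyLap p := by
    have := congrArg Subtype.val hf
    simpa [T] using this
  refine ⟨p - q * f, fun x => ?_, fun x hx => ?_⟩
  · rw [lapl_polyFun, map_sub, hf', sub_self]; simp [polyFun]
  · have : ‖x‖ = r := by simpa using hx
    rw [polyFun_sub, polyFun_mul, hq, this]; simp

/-- Polynomial functions are dense in the continuous functions on a compact set. -/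
theorem exists_polyFun_near {K : Set (Euc N)} (hK : IsCompact K) {g : Euc N → ℝ}
    (hg : ContinuousOn g K) {δ : ℝ} (hδ : 0 < δ) :
    ∃ p : MvPolynomial (Fin N) ℝ, ∀ x ∈ K, |polyFun p x - g x| < δ := by
  have : CompactSpace K := isCompact_iff_compactSpace.1 hK
  let co : Fin N → C(K, ℝ) := fun i => ⟨fun x => (x : Euc N) i, by fun_prop⟩
  have hval : ∀ (p : MvPolynomial (Fin N) ℝ) (x : K),
      (MvPolynomial.aeval co p : C(K, ℝ)) x = polyFun p x := by
    intro p x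
    induction p using MvPolynomial.induction_on with
    | C a => simp [polyFun]
    | add p q hp hq => simp only [map_add, ContinuousMap.add_apply, hp, hq]; simp [polyFun]
    | mul_X p j hp =>
      simp only [map_mul, ContinuousMap.mul_apply, hp, MvPolynomial.aeval_X]
      simp [polyFun, co]
  have hsep : (MvPolynomial.aeval (R := ℝ) co).range.SeparatesPoints := by
    intro x y hxy
    have hne : (x : Euc N) ≠ y := fun h => hxy (Subtype.ext h)
    obtain ⟨i, hi⟩ : ∃ i, (x : Euc N) i ≠ (y : Euc N) i := by
      by_contra! h
      exact hne (PiLp.ext h)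
    refine ⟨co i, ⟨co i, ⟨MvPolynomial.X i, by simp⟩, rfl⟩, hi⟩
  obtain ⟨⟨f, hf⟩, hnear⟩ := ContinuousMap.exists_mem_subalgebra_near_continuous_of_separatesPoints
    _ hsep (fun x : K => g x) (continuousOn_iff_continuous_domRestrict.1 hg) δ hδ
  obtain ⟨p, rfl⟩ := hf
  refine ⟨p, fun x hx => ?_⟩
  have := hnear ⟨x, hx⟩
  rw [← hval p ⟨x, hx⟩]
  exact this

/-- A finite family of functions which are viscosity subsolutions of `-Δ W_j ≤ A_j` in a ball: if
a positive combination attains its maximum over the sphere and the centre at the centre, then the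
combination of the constants is nonnegative. -/
theorem sum_nonneg_of_viscosity_of_center_max (hN : 1 ≤ N) {ι : Type*} [Fintype ι]
    {W : ι → Euc N → ℝ} {A c : ι → ℝ} (hc : ∀ i, 0 ≤ c i) {x₀ : Euc N} {r : ℝ} (hr : 0 < r)
    (hW : ∀ i, ContinuousOn (W i) (closedBall x₀ r))
    (hsub : ∀ i, ∀ ψ : Euc N → ℝ, ContDiff ℝ 2 ψ → ∀ x ∈ ball x₀ r,
      IsLocalMax (fun y => W i y - ψ y) x → -lapl ψ x ≤ A i)
    (hmax : ∀ x ∈ sphere x₀ r, ∑ i, c i * W i x ≤ ∑ i, c i * W i x₀) :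
    0 ≤ ∑ i, c i * A i := by
  have hN' : (0 : ℝ) < N := by exact_mod_cast hN
  have hkey : ∀ δ > 0, 0 ≤ 2 * δ * ∑ i, c i +
      r ^ 2 / (2 * N) * (∑ i, c i * A i + δ * ∑ i, c i) := by
    intro δ hδ
    have hex : ∀ i, ∃ H : Euc N → ℝ, ContDiff ℝ 2 H ∧ (∀ x, lapl H x = 0) ∧
        ∀ x ∈ sphere x₀ r, |H x - W i x| < δ := by
      intro i
      have hg : ContinuousOn (fun y => W i (y + x₀)) (sphere (0 : Euc N) r) := by
        refine (hW i).comp (by fun_prop) fun y hy => ?_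
        simp only [mem_sphere, dist_zero_right] at hy
        simp [hy]
      obtain ⟨p, hp⟩ := exists_polyFun_near (isCompact_sphere 0 r) hg hδ
      obtain ⟨H, hH0, hHp⟩ := exists_harmonic_polyFun hN hr p
      refine ⟨fun y => polyFun H (y + -x₀), (contDiff_polyFun H).comp (by fun_prop),
        fun x => ?_, fun x hx => ?_⟩
      · rw [lapl_comp_add_right, hH0]
      · have hx' : x + -x₀ ∈ sphere (0 : Euc N) r := by
          simpa [dist_eq_norm, sub_eq_add_neg] using hx
        have := hp _ hx'
        rw [← hHp _ hx'] at this
        simpa using this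
    choose H hHs hH0 hHW using hex
    have h1 : ∀ i, W i x₀ ≤ H i x₀ + δ + (A i + δ) / (2 * N) * r ^ 2 := by
      intro i
      have := le_of_viscosity_of_harmonic hN hδ (hW i) (hsub i) (hHs i) (hH0 i) (δ := δ)
        (fun x hx => by have := abs_lt.1 (hHW i x hx); linarith) x₀ (mem_closedBall_self hr.le)
      simpa using this
    have h2 : ∑ i, c i * H i x₀ ≤ ∑ i, c i * W i x₀ + δ * ∑ i, c i := by
      refine harmonic_le_of_sphere_le hN (H := fun x => ∑ i, c i * H i x) ?_ ?_ ?_ x₀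
        (mem_closedBall_self hr.le)
      · exact ContDiff.sum fun i _ => contDiff_const.mul (hHs i)
      · intro x
        rw [lapl_sum _ fun i _ => (contDiff_const.mul (hHs i)).contDiffAt]
        refine Finset.sum_eq_zero fun i _ => ?_
        rw [lapl_const_mul _ (hHs i).contDiffAt, hH0, mul_zero]
      · intro x hx
        refine le_trans ?_ (add_le_add_left (hmax x hx) _)
        rw [Finset.mul_sum, ← Finset.sum_add_distrib]
        refine Finset.sum_le_sum fun i _ => ?_
        have := abs_lt.1 (hHW i x hx)
        nlinarith [hc i]
    have h3 : ∑ i, c i * W i x₀ ≤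
        ∑ i, c i * (H i x₀ + δ + (A i + δ) / (2 * N) * r ^ 2) :=
      Finset.sum_le_sum fun i _ => mul_le_mul_of_nonneg_left (h1 i) (hc i)
    have h4 : ∑ i, c i * (H i x₀ + δ + (A i + δ) / (2 * N) * r ^ 2) =
        ∑ i, c i * H i x₀ + δ * ∑ i, c i +
          r ^ 2 / (2 * N) * (∑ i, c i * A i + δ * ∑ i, c i) := by
      simp only [Finset.mul_sum, ← Finset.sum_add_distrib]
      refine Finset.sum_congr rfl fun i _ => ?_
      ring
    linarith
  have hlim : Tendsto (fun δ : ℝ => 2 * δ * ∑ i, c i +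
      r ^ 2 / (2 * N) * (∑ i, c i * A i + δ * ∑ i, c i)) (𝓝[>] 0)
      (𝓝 (2 * 0 * ∑ i, c i + r ^ 2 / (2 * N) * (∑ i, c i * A i + 0 * ∑ i, c i))) :=
    (Continuous.tendsto (by fun_prop) 0).mono_left nhdsWithin_le_nhds
  have h := ge_of_tendsto hlim (eventually_mem_nhdsWithin.mono fun η hη => hkey η hη)
  simp only [mul_zero, zero_mul, add_zero, zero_add] at h
  exact nonneg_of_mul_nonneg_right h (by positivity)

end HarmonicPolynomials

section SupConvolution

variable {N : ℕ}

theorem UpperSemicontinuousOn.le_of_tendsto {X : Type*} [TopologicalSpace X] {K : Set X}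
    {f : X → ℝ} (hf : UpperSemicontinuousOn f K) {y : ℕ → X} {y₀ : X} (hy : ∀ n, y n ∈ K)
    (hy₀ : y₀ ∈ K) (hlim : Tendsto y atTop (𝓝 y₀)) {l : ℝ}
    (hl : Tendsto (fun n => f (y n)) atTop (𝓝 l)) : l ≤ f y₀ := by
  refine le_of_forall_gt_imp_ge_of_dense fun b hb => ?_
  have h1 : Tendsto y atTop (𝓝[K] y₀) :=
    tendsto_nhdsWithin_iff.2 ⟨hlim, Eventually.of_forall hy⟩
  exact _root_.le_of_tendsto hl ((h1.eventually (hf y₀ hy₀ b hb)).mono fun n hn => hn.le)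

theorem continuous_lapl {φ : Euc N → ℝ} (hφ : ContDiff ℝ 2 φ) : Continuous (lapl φ) := by
  unfold lapl
  refine continuous_finsetSum _ fun i _ => ?_
  exact (hφ.continuous_iteratedFDeriv (m := 2) le_rfl).eval_const _

theorem continuous_gradient {φ : Euc N → ℝ} (hφ : ContDiff ℝ 2 φ) :
    Continuous (gradient φ) := by
  unfold gradient
  exact (InnerProductSpace.toDual ℝ (Euc N)).symm.continuous.comp
    (hφ.continuous_fderiv (by norm_num))

/-- The paraboloid penalization defining the shifted sup-convolution of `f`. -/
noncomputable def penal (f : Euc N → ℝ) (a : ℝ) (s x y : Euc N) : ℝ := f y - a * ‖y - x - s‖ ^ 2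

theorem penal_eq (f : Euc N → ℝ) (a : ℝ) (s x y : Euc N) :
    penal f a s x y = f y - a * ‖x - (y - s)‖ ^ 2 := by
  rw [penal, ← norm_neg]
  congr 4
  abel

theorem hasGradientAt_penal (f : Euc N → ℝ) (a : ℝ) (s x y : Euc N) :
    HasGradientAt (fun x => penal f a s x y) ((2 * a) • (y - x - s)) x := by
  have h := (hasGradientAt_const x (f y)).sub' ((hasGradientAt_norm_sub_sq (y - s) x).const_mul' a)
  have e : (fun x => penal f a s x y) = fun x => f y - a * ‖x - (y - s)‖ ^ 2 :=
    funext fun x => penal_eq f a s x y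
  rw [e]
  convert h using 1
  module

theorem exists_isMaxOn_penal {K : Set (Euc N)} (hK : IsCompact K) (hne : K.Nonempty)
    {f : Euc N → ℝ} (hf : UpperSemicontinuousOn f K) (a : ℝ) (s x : Euc N) :
    ∃ y ∈ K, IsMaxOn (penal f a s x) K y := by
  refine UpperSemicontinuousOn.exists_isMaxOn hne hK ?_
  have h : ContinuousOn (fun y : Euc N => -(a * ‖y - x - s‖ ^ 2)) K := by fun_prop
  exact hf.add h.upperSemicontinuousOn

theorem continuous_of_isMaxOn_penal {K : Set (Euc N)} (hK : IsCompact K) {f : Euc N → ℝ}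
    {a : ℝ} (ha : 0 < a) {s : Euc N} {Y : Euc N → Euc N}
    (hY : ∀ x, Y x ∈ K ∧ IsMaxOn (penal f a s x) K (Y x)) :
    Continuous (fun x => penal f a s x (Y x)) := by
  obtain ⟨R, hR⟩ := hK.isBounded.exists_norm_le
  have hkey : ∀ x x' : Euc N, ∀ y ∈ K, dist x' x < 1 →
      |penal f a s x y - penal f a s x' y| ≤ a * (2 * (R + ‖x‖ + 1 + ‖s‖)) * dist x' x := by
    intro x x' y hy hx
    have e : penal f a s x y - penal f a s x' y
        = a * ((‖y - x' - s‖ - ‖y - x - s‖) * (‖y - x' - s‖ + ‖y - x - s‖)) := by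
      simp only [penal]; ring
    have h1 : |‖y - x' - s‖ - ‖y - x - s‖| ≤ dist x' x := by
      refine (abs_norm_sub_norm_le _ _).trans ?_
      rw [dist_comm, dist_eq_norm]
      apply le_of_eq
      congr 1
      abel
    have h2 : ‖y - x - s‖ ≤ R + ‖x‖ + ‖s‖ :=
      (norm_sub_le _ _).trans (by linarith [norm_sub_le y x, hR y hy])
    have h4 : ‖y - x' - s‖ ≤ ‖y - x - s‖ + dist x' x := by
      linarith [le_abs_self (‖y - x' - s‖ - ‖y - x - s‖)]
    have h3 : |‖y - x' - s‖ + ‖y - x - s‖| ≤ 2 * (R + ‖x‖ + 1 + ‖s‖) := by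
      rw [abs_of_nonneg (by positivity)]
      linarith
    rw [e, abs_mul, abs_of_pos ha, abs_mul]
    calc a * (|‖y - x' - s‖ - ‖y - x - s‖| * |‖y - x' - s‖ + ‖y - x - s‖|)
        ≤ a * (dist x' x * (2 * (R + ‖x‖ + 1 + ‖s‖))) := by gcongr
      _ = _ := by ring
  refine continuous_iff_continuousAt.2 fun x =>
    continuousAt_of_locally_lipschitz one_pos (a * (2 * (R + ‖x‖ + 1 + ‖s‖))) fun x' hx' => ?_
  have h1 := hkey x x' (Y x) (hY x).1 hx'
  have h2 := hkey x x' (Y x') (hY x').1 hx'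
  have h3 : penal f a s x (Y x') ≤ penal f a s x (Y x) := (hY x).2 (hY x').1
  have h4 : penal f a s x' (Y x) ≤ penal f a s x' (Y x') := (hY x').2 (hY x).1
  rw [Real.dist_eq]
  rw [abs_le] at *
  constructor <;> linarith [h1.1, h1.2, h2.1, h2.2]

/-- If the sup-convolution has a unique optimal point at `x₀`, then optimal points at nearby
centres are close to it, together with the values of the function. -/
theorem eventually_argmax_penal_near {K : Set (Euc N)} (hK : IsCompact K) {f : Euc N → ℝ}
    (hf : UpperSemicontinuousOn f K) {a : ℝ} (ha : 0 < a) {s : Euc N} {Y : Euc N → Euc N}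
    (hY : ∀ x, Y x ∈ K ∧ IsMaxOn (penal f a s x) K (Y x)) {x₀ y₀ : Euc N} (hy₀ : y₀ ∈ K)
    (huniq : ∀ y ∈ K, IsMaxOn (penal f a s x₀) K y → y = y₀) {r : ℝ} (hr : 0 < r) :
    ∀ᶠ x in 𝓝 x₀, ‖Y x - y₀‖ < r ∧ |f (Y x) - f y₀| < r := by
  by_contra hcon
  rw [Filter.not_eventually] at hcon
  push Not at hcon
  obtain ⟨x, hx, hxr⟩ := exists_seq_forall_of_frequently hcon
  obtain ⟨y, hyK, σ, hσ, hlim⟩ := hK.tendsto_subseq fun n => (hY (x n)).1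
  have hxσ : Tendsto (x ∘ σ) atTop (𝓝 x₀) := hx.comp hσ.tendsto_atTop
  have hU : Tendsto (fun n => penal f a s (x (σ n)) (Y (x (σ n)))) atTop
      (𝓝 (penal f a s x₀ (Y x₀))) :=
    ((continuous_of_isMaxOn_penal hK ha hY).tendsto x₀).comp hxσ
  have hfl : Tendsto (fun n => f (Y (x (σ n)))) atTop
      (𝓝 (penal f a s x₀ (Y x₀) + a * ‖y - x₀ - s‖ ^ 2)) := by
    have h2 : Tendsto (fun n => a * ‖Y (x (σ n)) - x (σ n) - s‖ ^ 2) atTop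
        (𝓝 (a * ‖y - x₀ - s‖ ^ 2)) :=
      ((((hlim.sub hxσ).sub_const s).norm.pow 2).const_mul a)
    refine (hU.add h2).congr fun n => ?_
    simp [penal]
  have hle := hf.le_of_tendsto (fun n => (hY (x (σ n))).1) hyK hlim hfl
  have hymax : IsMaxOn (penal f a s x₀) K y := fun z hz => by
    have h1 : penal f a s x₀ z ≤ penal f a s x₀ (Y x₀) := (hY x₀).2 hz
    have h2 : penal f a s x₀ (Y x₀) ≤ penal f a s x₀ y := by
      have : penal f a s x₀ y = f y - a * ‖y - x₀ - s‖ ^ 2 := rfl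
      linarith
    exact h1.trans h2
  obtain rfl := huniq y hyK hymax
  have hYx : Y x₀ = y := huniq _ (hY x₀).1 (hY x₀).2
  have hfl' : Tendsto (fun n => f (Y (x (σ n)))) atTop (𝓝 (f y)) := by
    convert hfl using 2
    rw [hYx, penal]
    ring
  have e1 : ∀ᶠ n in atTop, ‖Y (x (σ n)) - y‖ < r := by
    have := (tendsto_iff_norm_sub_tendsto_zero.1 hlim)
    exact this.eventually (gt_mem_nhds hr)
  have e2 : ∀ᶠ n in atTop, |f (Y (x (σ n))) - f y| < r := by
    have := (tendsto_iff_norm_sub_tendsto_zero.1 hfl')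
    exact this.eventually (gt_mem_nhds hr)
  obtain ⟨n, h1, h2⟩ := (e1.and e2).exists
  exact absurd h2 (not_lt.2 (hxr (σ n) h1))

/-- A localized viscosity inequality `-Δψ ≤ A` for test functions touching `f` from above on `K`
at points, values and slopes close to `(y, f y, p)`. -/
def LocalSub (K : Set (Euc N)) (f : Euc N → ℝ) (y p : Euc N) (A : ℝ) : Prop :=
  ∃ r > 0, ∀ ψ : Euc N → ℝ, ContDiff ℝ 2 ψ → ∀ z ∈ K, ‖z - y‖ < r → |f z - f y| < r →
    ‖gradient ψ z - p‖ < r → IsLocalMaxOn (fun x => f x - ψ x) K z → -lapl ψ z ≤ A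

theorem gradient_eq_of_isLocalMax_supConv {K : Set (Euc N)} {f : Euc N → ℝ} {a : ℝ}
    {s : Euc N} {Y : Euc N → Euc N} (hY : ∀ x, Y x ∈ K ∧ IsMaxOn (penal f a s x) K (Y x))
    {ψ : Euc N → ℝ} (hψ : ContDiff ℝ 2 ψ) {x : Euc N}
    (hmax : IsLocalMax (fun x => penal f a s x (Y x) - ψ x) x) :
    gradient ψ x = (2 * a) • (Y x - x - s) := by
  have h : IsLocalMax (fun z => penal f a s z (Y x) - ψ z) x := by
    filter_upwards [hmax] with z hz
    have : penal f a s z (Y x) ≤ penal f a s z (Y z) := (hY z).2 (hY x).1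
    linarith
  have := h.hasGradientAt_eq_zero
    ((hasGradientAt_penal f a s x (Y x)).sub' hψ.contDiffAt.hasGradientAt')
  exact (sub_eq_zero.1 this).symm

theorem isLocalMaxOn_translate_of_isLocalMax_supConv {K : Set (Euc N)} {f : Euc N → ℝ} {a : ℝ}
    {s : Euc N} {Y : Euc N → Euc N} (hY : ∀ x, Y x ∈ K ∧ IsMaxOn (penal f a s x) K (Y x))
    {ψ : Euc N → ℝ} {x : Euc N} (hmax : IsLocalMax (fun x => penal f a s x (Y x) - ψ x) x) :
    IsLocalMaxOn (fun z => f z - ψ (z + (x - Y x))) K (Y x) := by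
  have hc : Tendsto (fun z => z + (x - Y x)) (𝓝[K] (Y x)) (𝓝 x) := by
    have : Tendsto (fun z => z + (x - Y x)) (𝓝 (Y x)) (𝓝 (Y x + (x - Y x))) :=
      (continuous_id.add continuous_const).tendsto _
    rw [add_sub_cancel] at this
    exact this.mono_left nhdsWithin_le_nhds
  filter_upwards [hc.eventually hmax, self_mem_nhdsWithin] with z hz hzK
  have h1 : penal f a s (z + (x - Y x)) z
      ≤ penal f a s (z + (x - Y x)) (Y (z + (x - Y x))) := (hY _).2 hzK
  have h2 : z - (z + (x - Y x)) - s = Y x - x - s := by abel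
  simp only [penal, h2] at h1 hz
  rw [add_sub_cancel]
  linarith

/-- First and second order conditions at a maximum point of a sum of sup-convolutions. -/
theorem lapl_le_of_isMax_sum_penal (hN : 1 ≤ N) {ι : Type*} [Fintype ι] {K : Set (Euc N)}
    (hK : IsCompact K) {f : ι → Euc N → ℝ} (hf : ∀ i, UpperSemicontinuousOn (f i) K)
    {c A : ι → ℝ} (hc : ∀ i, 0 < c i) {a : ℝ} (ha : 0 < a) {s : ι → Euc N} {φ : Euc N → ℝ}
    (hφ : ContDiff ℝ 2 φ) {x₀ : Euc N} {y₀ : ι → Euc N} (hy₀ : ∀ i, y₀ i ∈ K)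
    (hmax : ∀ (x : Euc N) (y : ι → Euc N), (∀ i, y i ∈ K) →
      ∑ i, c i * penal (f i) a (s i) x (y i) + φ x
        ≤ ∑ i, c i * penal (f i) a (s i) x₀ (y₀ i) + φ x₀) :
    ∑ i, c i • (2 * a) • (y₀ i - x₀ - s i) + gradient φ x₀ = 0 ∧
    ((∀ i, LocalSub K (f i) (y₀ i) ((2 * a) • (y₀ i - x₀ - s i)) (A i)) →
      lapl φ x₀ ≤ ∑ i, c i * A i) := by
  classical
  have hgrad : ∀ y : ι → Euc N, (∀ i, y i ∈ K) →
      (∑ i, c i * penal (f i) a (s i) x₀ (y₀ i) ≤ ∑ i, c i * penal (f i) a (s i) x₀ (y i)) →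
      ∑ i, c i • (2 * a) • (y i - x₀ - s i) + gradient φ x₀ = 0 := by
    intro y hy hle
    have hm : IsLocalMax (fun x => ∑ i, c i * penal (f i) a (s i) x (y i) + φ x) x₀ :=
      Eventually.of_forall fun x => (hmax x y hy).trans (add_le_add_left hle _)
    exact hm.hasGradientAt_eq_zero ((HasGradientAt.sum' Finset.univ fun i _ =>
      (hasGradientAt_penal (f i) a (s i) x₀ (y i)).const_mul' (c i)).add'
        hφ.contDiffAt.hasGradientAt')
  refine ⟨hgrad y₀ hy₀ le_rfl, fun hsub => ?_⟩
  have hupd : ∀ i z, ∑ j, c j * penal (f j) a (s j) x₀ (Function.update y₀ i z j)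
      = ∑ j, c j * penal (f j) a (s j) x₀ (y₀ j)
        + c i * (penal (f i) a (s i) x₀ z - penal (f i) a (s i) x₀ (y₀ i)) := by
    intro i z
    rw [← sub_eq_iff_eq_add', ← Finset.sum_sub_distrib, Finset.sum_eq_single i]
    · simp only [Function.update_self]; ring
    · intro j _ hj
      simp [Function.update_of_ne hj]
    · simp
  have hupdK : ∀ i, ∀ z ∈ K, ∀ j, Function.update y₀ i z j ∈ K := by
    intro i z hz j
    by_cases hj : j = i
    · subst hj; simpa using hz
    · simpa [Function.update_of_ne hj] using hy₀ j
  have hargmax : ∀ i, IsMaxOn (penal (f i) a (s i) x₀) K (y₀ i) := by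
    intro i z hz
    have h1 := hmax x₀ (Function.update y₀ i z) (hupdK i z hz)
    rw [hupd] at h1
    have h2 : c i * (penal (f i) a (s i) x₀ z - penal (f i) a (s i) x₀ (y₀ i)) ≤ 0 := by linarith
    have h3 := nonpos_of_mul_nonpos_right h2 (hc i)
    exact sub_nonpos.1 h3
  have huniq : ∀ i, ∀ y ∈ K, IsMaxOn (penal (f i) a (s i) x₀) K y → y = y₀ i := by
    intro i y hy hym
    have h1 : penal (f i) a (s i) x₀ (y₀ i) ≤ penal (f i) a (s i) x₀ y := hym (hy₀ i)
    have h2 := hgrad (Function.update y₀ i y) (hupdK i y hy) (by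
      rw [hupd]
      have := mul_nonneg (hc i).le (sub_nonneg.2 h1)
      linarith)
    have h3 := hgrad y₀ hy₀ le_rfl
    have h4 : ∑ j, c j • (2 * a) • (Function.update y₀ i y j - x₀ - s j)
        - ∑ j, c j • (2 * a) • (y₀ j - x₀ - s j) = 0 := by
      rw [sub_eq_zero]
      exact add_right_cancel (h2.trans h3.symm)
    rw [← Finset.sum_sub_distrib, Finset.sum_eq_single i] at h4
    · rw [Function.update_self] at h4
      have h5 : (c i * (2 * a)) • (y - y₀ i) = 0 := by
        rw [← h4]; module
      have h6 : c i * (2 * a) ≠ 0 := by have := hc i; positivity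
      exact sub_eq_zero.1 ((smul_eq_zero.1 h5).resolve_left h6)
    · intro j _ hj
      simp [Function.update_of_ne hj]
    · simp
  rcases isEmpty_or_nonempty ι with hι | ⟨⟨i₀⟩⟩
  · have : IsLocalMax φ x₀ := Eventually.of_forall fun x => by
      simpa using hmax x y₀ hy₀
    simpa using this.lapl_nonpos hφ.contDiffAt
  have hKne : K.Nonempty := ⟨_, hy₀ i₀⟩
  choose Y hYK hYm using fun i x => exists_isMaxOn_penal hK hKne (hf i) a (s i) x
  have hY : ∀ i x, Y i x ∈ K ∧ IsMaxOn (penal (f i) a (s i) x) K (Y i x) :=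
    fun i x => ⟨hYK i x, hYm i x⟩
  have hYx₀ : ∀ i, Y i x₀ = y₀ i := fun i => huniq i _ (hYK i x₀) (hYm i x₀)
  choose ρ hρ hρsub using hsub
  refine le_of_forall_pos_le_add fun η hη => ?_
  have hYc : ∀ i, ContinuousAt (Y i) x₀ := fun i => by
    rw [Metric.continuousAt_iff']
    intro e he
    filter_upwards [eventually_argmax_penal_near hK (hf i) ha (hY i) (hy₀ i) (huniq i) he]
      with x hx
    rw [hYx₀, dist_eq_norm]
    exact hx.1
  have hev : ∀ᶠ x in 𝓝 x₀, lapl φ x₀ - η < lapl φ x ∧ ∀ i, (‖Y i x - y₀ i‖ < ρ i ∧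
      |f i (Y i x) - f i (y₀ i)| < ρ i) ∧
      ‖(2 * a) • (Y i x - x - s i) - (2 * a) • (y₀ i - x₀ - s i)‖ < ρ i := by
    refine ((continuous_lapl hφ).continuousAt.eventually (lt_mem_nhds (by linarith))).and
      (eventually_all.2 fun i => (eventually_argmax_penal_near hK (hf i) ha (hY i) (hy₀ i)
        (huniq i) (hρ i)).and ?_)
    have ht : ContinuousAt (fun x => ‖(2 * a) • (Y i x - x - s i)
        - (2 * a) • (y₀ i - x₀ - s i)‖) x₀ := by
      have := hYc i
      fun_prop
    have h0 : ‖(2 * a) • (Y i x₀ - x₀ - s i) - (2 * a) • (y₀ i - x₀ - s i)‖ < ρ i := by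
      rw [hYx₀, sub_self, norm_zero]
      exact hρ i
    exact ht.eventually (gt_mem_nhds h0)
  obtain ⟨R, hR, hball⟩ := Metric.eventually_nhds_iff_ball.1 hev
  have key := sum_nonneg_of_viscosity_of_center_max hN (ι := Option ι)
    (W := fun o => o.elim φ fun i x => penal (f i) a (s i) x (Y i x))
    (A := fun o => o.elim (-lapl φ x₀ + η) A) (c := fun o => o.elim 1 c) (x₀ := x₀) (r := R)
    (by rintro (_ | i) <;> simp [(hc _).le]) hR
    (by
      rintro (_ | i)
      · exact hφ.continuous.continuousOn
      · exact (continuous_of_isMaxOn_penal hK ha (hY i)).continuousOn)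
    (by
      rintro (_ | i) ψ hψ x hx hm
      · have h1 := hm.lapl_nonpos (hφ.sub hψ).contDiffAt
        have h2 := lapl_sub (x := x) hφ.contDiffAt hψ.contDiffAt
        simp only [Option.elim] at h1 ⊢
        rw [h2] at h1
        linarith [(hball x hx).1]
      · simp only [Option.elim] at hm ⊢
        have hg := gradient_eq_of_isLocalMax_supConv (hY i) hψ hm
        have hl := isLocalMaxOn_translate_of_isLocalMax_supConv (hY i) hm
        have hb := (hball x hx).2 i
        have := hρsub i (fun z => ψ (z + (x - Y i x)))
          (hψ.comp (contDiff_id.add contDiff_const)) (Y i x) (hYK i x) hb.1.1 hb.1.2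
          (by rw [gradient_comp_add_right, add_sub_cancel, hg]; exact hb.2) hl
        rwa [lapl_comp_add_right, add_sub_cancel] at this)
    (by
      intro x _
      simp only [Fintype.sum_option, Option.elim]
      have := hmax x (fun i => Y i x) (fun i => hYK i x)
      simp only [hYx₀]
      linarith)
  simp only [Fintype.sum_option, Option.elim] at key
  linarith

end SupConvolution

section Doubling

variable {N : ℕ}

theorem exists_max_sum_penal {ι : Type*} [Fintype ι] {K : Set (Euc N)} (hK : IsCompact K)
    (hne : K.Nonempty) {f : ι → Euc N → ℝ} (hf : ∀ i, UpperSemicontinuousOn (f i) K)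
    {c : ι → ℝ} (hc : ∀ i, 0 < c i) {a : ℝ} (ha : 0 < a) (s : ι → Euc N) (x₀ : Euc N) {θ : ℝ}
    (hθ : 0 < θ) :
    ∃ (x₁ : Euc N) (y₁ : ι → Euc N), (∀ i, y₁ i ∈ K) ∧
      ∀ (x : Euc N) (y : ι → Euc N), (∀ i, y i ∈ K) →
        ∑ i, c i * penal (f i) a (s i) x (y i) + -(θ * ‖x - x₀‖ ^ 2)
          ≤ ∑ i, c i * penal (f i) a (s i) x₁ (y₁ i) + -(θ * ‖x₁ - x₀‖ ^ 2) := by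
  choose Y hYK hYm using fun i x => exists_isMaxOn_penal hK hne (hf i) a (s i) x
  have hY : ∀ i x, Y i x ∈ K ∧ IsMaxOn (penal (f i) a (s i) x) K (Y i x) :=
    fun i x => ⟨hYK i x, hYm i x⟩
  choose b hbK hb using fun i => UpperSemicontinuousOn.exists_isMaxOn hne hK (hf i)
  have hcont : Continuous fun x => θ * ‖x - x₀‖ ^ 2 -
      ∑ i, c i * penal (f i) a (s i) x (Y i x) := by
    refine Continuous.sub (by fun_prop) (continuous_finsetSum _ fun i _ => ?_)
    exact continuous_const.mul (continuous_of_isMaxOn_penal hK ha (hY i))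
  have hlow : ∀ x, θ * ‖x - x₀‖ ^ 2 - ∑ i, c i * f i (b i) ≤ θ * ‖x - x₀‖ ^ 2 -
      ∑ i, c i * penal (f i) a (s i) x (Y i x) := by
    intro x
    refine sub_le_sub_left (Finset.sum_le_sum fun i _ => ?_) _
    refine mul_le_mul_of_nonneg_left ?_ (hc i).le
    have h1 : f i (Y i x) ≤ f i (b i) := hb i (hYK i x)
    have h2 : 0 ≤ a * ‖Y i x - x - s i‖ ^ 2 := by positivity
    rw [penal]
    linarith
  have hcoer : Tendsto (fun x => θ * ‖x - x₀‖ ^ 2 -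
      ∑ i, c i * penal (f i) a (s i) x (Y i x)) (cocompact (Euc N)) atTop := by
    refine tendsto_atTop_mono hlow ?_
    have h1 : Tendsto (fun x : Euc N => ‖x - x₀‖) (cocompact (Euc N)) atTop := by
      have := tendsto_dist_left_cocompact_atTop x₀ (α := Euc N)
      refine this.congr fun x => ?_
      rw [dist_comm, dist_eq_norm]
    exact tendsto_atTop_add_const_right _ _
      (((tendsto_pow_atTop two_ne_zero).comp h1).const_mul_atTop hθ)
  obtain ⟨x₁, hx₁⟩ := hcont.exists_forall_le hcoer
  refine ⟨x₁, fun i => Y i x₁, fun i => hYK i x₁, fun x y hy => ?_⟩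
  have h1 : ∑ i, c i * penal (f i) a (s i) x (y i) ≤ ∑ i, c i * penal (f i) a (s i) x (Y i x) :=
    Finset.sum_le_sum fun i _ => mul_le_mul_of_nonneg_left (hYm i x (hy i)) (hc i).le
  have h2 := hx₁ x
  linarith

/-- Points almost maximizing a separated sum of upper semicontinuous functions are close to the
strict maximum point on the diagonal, together with the values of each function. -/
theorem exists_near_of_almost_max {ι : Type*} [Fintype ι] [Nonempty ι] {K : Set (Euc N)}
    (hK : IsCompact K) {f : ι → Euc N → ℝ} (hf : ∀ i, UpperSemicontinuousOn (f i) K) {c : ι → ℝ}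
    (hc : ∀ i, 0 < c i) {x₀ : Euc N} (hmax : ∀ x ∈ K, ∑ i, c i * f i x ≤ ∑ i, c i * f i x₀)
    {θ : ℝ} (hθ : 0 < θ) {κ : ℝ} (hκ : 0 < κ) :
    ∃ κ' > 0, ∀ (x : Euc N) (y : ι → Euc N), (∀ i, y i ∈ K) → (∀ i, ‖y i - x‖ ≤ κ') →
      ∑ i, c i * f i x₀ - κ' ≤ ∑ i, c i * f i (y i) - θ * ‖x - x₀‖ ^ 2 →
      ‖x - x₀‖ ≤ κ ∧ ∀ i, |f i (y i) - f i x₀| ≤ κ := by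
  by_contra! hcon
  have hpos : ∀ n : ℕ, (0 : ℝ) < 1 / ((n : ℝ) + 1) := fun n => Nat.one_div_pos_of_nat
  choose x y hyK hyx hval hfar using fun n : ℕ => hcon (1 / ((n : ℝ) + 1)) (hpos n)
  obtain ⟨z', hz', σ, hσ, hlim⟩ := (isCompact_univ_pi fun _ : ι => hK).tendsto_subseq
    (x := y) fun n i _ => hyK n i
  have h0 : Tendsto (fun n => 1 / ((σ n : ℝ) + 1)) atTop (𝓝 0) :=
    tendsto_one_div_add_atTop_nhds_zero_nat.comp hσ.tendsto_atTop
  have hyi : ∀ i, Tendsto (fun n => y (σ n) i) atTop (𝓝 (z' i)) := fun i =>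
    (tendsto_pi_nhds.1 hlim) i
  have hdiff : ∀ i, Tendsto (fun n => y (σ n) i - x (σ n)) atTop (𝓝 0) := fun i =>
    squeeze_zero_norm (fun n => hyx (σ n) i) h0
  have hxi : ∀ i, Tendsto (fun n => x (σ n)) atTop (𝓝 (z' i)) := fun i => by
    simpa using (hyi i).sub (hdiff i)
  set i₀ : ι := Classical.arbitrary ι
  set z := z' i₀ with hz
  have hz'z : ∀ i, z' i = z := fun i => tendsto_nhds_unique (hxi i) (hxi i₀)
  have hzK : z ∈ K := hz' i₀ (mem_univ _)
  have hyz : ∀ i, Tendsto (fun n => y (σ n) i) atTop (𝓝[K] z) := fun i =>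
    tendsto_nhdsWithin_iff.2 ⟨hz'z i ▸ hyi i, Eventually.of_forall fun n => hyK _ i⟩
  have husc : ∀ e > 0, ∀ᶠ n in atTop, ∀ i, f i (y (σ n) i) < f i z + e := fun e he =>
    eventually_all.2 fun i => (hyz i).eventually (hf i z hzK _ (by linarith))
  have hcs : 0 ≤ ∑ i, c i := Finset.sum_nonneg fun i _ => (hc i).le
  have hbound : ∀ e > 0, θ * ‖z - x₀‖ ^ 2 ≤ e * ∑ i, c i := by
    intro e he
    have h1 : Tendsto (fun n => θ * ‖x (σ n) - x₀‖ ^ 2) atTop (𝓝 (θ * ‖z - x₀‖ ^ 2)) :=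
      ((((hxi i₀).sub_const x₀).norm.pow 2).const_mul θ)
    have h2 : Tendsto (fun n => e * ∑ i, c i + 1 / ((σ n : ℝ) + 1)) atTop
        (𝓝 (e * ∑ i, c i + 0)) := tendsto_const_nhds.add h0
    rw [add_zero] at h2
    refine le_of_tendsto_of_tendsto h1 h2 ?_
    filter_upwards [husc e he] with n hn
    have h3 := hval (σ n)
    have h4 : ∑ i, c i * f i (y (σ n) i) ≤ ∑ i, c i * f i z + e * ∑ i, c i := by
      rw [Finset.mul_sum, ← Finset.sum_add_distrib]
      refine Finset.sum_le_sum fun i _ => ?_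
      nlinarith [hn i, hc i]
    linarith [hmax z hzK]
  have hzx : z = x₀ := by
    have h1 : θ * ‖z - x₀‖ ^ 2 ≤ 0 := by
      by_contra! hlt
      have h2 := hbound (θ * ‖z - x₀‖ ^ 2 / (2 * (∑ i, c i + 1))) (by positivity)
      rw [div_mul_eq_mul_div, le_div_iff₀ (by positivity)] at h2
      nlinarith
    have h2 : ‖z - x₀‖ ^ 2 ≤ 0 := nonpos_of_mul_nonpos_right h1 hθ
    exact sub_eq_zero.1 (norm_eq_zero.1 (pow_eq_zero_iff two_ne_zero |>.1
      (le_antisymm h2 (by positivity))))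
  rw [hzx] at husc
  have e1 : ∀ᶠ n in atTop, ‖x (σ n) - x₀‖ < κ := by
    have h := hxi i₀
    rw [← hz, hzx] at h
    exact (tendsto_iff_norm_sub_tendsto_zero.1 h).eventually (gt_mem_nhds hκ)
  have e2 : ∀ i, ∀ᶠ n in atTop, f i x₀ - κ ≤ f i (y (σ n) i) := by
    intro i
    set e : ℝ := c i * κ / (2 * (∑ j, c j + 1)) with he
    have hepos : 0 < e := by have := hc i; positivity
    have hlt : (0 : ℝ) < c i * κ / 2 := by have := hc i; positivity
    filter_upwards [husc e hepos, h0.eventually (gt_mem_nhds hlt)] with n hn hn2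
    have h3 := hval (σ n)
    have h5 : 0 ≤ θ * ‖x (σ n) - x₀‖ ^ 2 := by positivity
    have h4 : ∑ j, c j * (f j x₀ + e - f j (y (σ n) j))
        ≥ c i * (f i x₀ + e - f i (y (σ n) i)) := by
      refine Finset.single_le_sum (f := fun j => c j * (f j x₀ + e - f j (y (σ n) j)))
        (fun j _ => ?_) (Finset.mem_univ i)
      have := hn j
      exact mul_nonneg (hc j).le (by linarith)
    have h6 : ∑ j, c j * (f j x₀ + e - f j (y (σ n) j))
        = ∑ j, c j * f j x₀ + e * ∑ j, c j - ∑ j, c j * f j (y (σ n) j) := by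
      rw [Finset.mul_sum, ← Finset.sum_add_distrib, ← Finset.sum_sub_distrib]
      exact Finset.sum_congr rfl fun j _ => by ring
    have h7 : e * ∑ j, c j ≤ c i * κ / 2 := by
      rw [he, div_mul_eq_mul_div, div_le_div_iff₀ (by positivity) (by positivity)]
      have : 0 < c i * κ := mul_pos (hc i) hκ
      nlinarith
    have h8 : c i * (f i x₀ + e - f i (y (σ n) i)) ≤ c i * κ := by linarith
    have h9 := le_of_mul_le_mul_left h8 (hc i)
    linarith
  obtain ⟨n, h1, h2, h3⟩ := (e1.and ((eventually_all.2 e2).and (husc κ hκ))).exists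
  obtain ⟨i, hi⟩ := hfar (σ n) h1.le
  refine absurd hi (not_lt.2 (abs_le.2 ⟨by linarith [h2 i], by linarith [h3 i]⟩))

/-- Existence of maximum points of the penalized functional, with points and values converging. -/
theorem exists_doubling_points {ι : Type*} [Fintype ι] [Nonempty ι] {K : Set (Euc N)}
    (hK : IsCompact K) {f : ι → Euc N → ℝ} (hf : ∀ i, UpperSemicontinuousOn (f i) K) {B : ℝ}
    (hB : ∀ i, ∀ x ∈ K, |f i x| ≤ B) {c : ι → ℝ} (hc : ∀ i, 0 < c i) {x₀ : Euc N} (hx₀ : x₀ ∈ K)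
    (hmax : ∀ x ∈ K, ∑ i, c i * f i x ≤ ∑ i, c i * f i x₀) {θ : ℝ} (hθ : 0 < θ) {κ : ℝ}
    (hκ : 0 < κ) :
    ∃ κ' > 0, ∀ s : ι → Euc N, (∀ i, ‖s i‖ ≤ κ') → (∀ i, x₀ + s i ∈ K) →
      (∀ i, f i x₀ - κ' ≤ f i (x₀ + s i)) → ∀ ν > 0, ∃ a > 0, ∃ (x₁ : Euc N) (y₁ : ι → Euc N),
        (∀ i, y₁ i ∈ K) ∧
        (∀ (x : Euc N) (y : ι → Euc N), (∀ i, y i ∈ K) →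
          ∑ i, c i * penal (f i) a (s i) x (y i) + -(θ * ‖x - x₀‖ ^ 2)
            ≤ ∑ i, c i * penal (f i) a (s i) x₁ (y₁ i) + -(θ * ‖x₁ - x₀‖ ^ 2)) ∧
        (∀ i, ‖y₁ i - x₁ - s i‖ ≤ ν) ∧ ‖x₁ - x₀‖ ≤ κ ∧ ∀ i, |f i (y₁ i) - f i x₀| ≤ κ := by
  obtain ⟨κ₀, hκ₀, hnear⟩ := exists_near_of_almost_max hK hf hc hmax hθ hκ
  have hcs : 0 ≤ ∑ i, c i := Finset.sum_nonneg fun i _ => (hc i).le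
  have hB0 : 0 ≤ B := (abs_nonneg _).trans (hB (Classical.arbitrary ι) x₀ hx₀)
  set κ' : ℝ := min (κ₀ / 2) (κ₀ / (∑ i, c i + 1)) with hκ'
  have hκ'pos : 0 < κ' := by positivity
  have hκ'1 : κ' ≤ κ₀ / 2 := min_le_left _ _
  have hκ'2 : κ' * ∑ i, c i ≤ κ₀ := by
    have : κ' * (∑ i, c i + 1) ≤ κ₀ := by
      rw [← le_div_iff₀ (by positivity)]
      exact min_le_right _ _
    nlinarith
  refine ⟨κ', hκ'pos, fun s hs hsK hsf ν hν => ?_⟩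
  set μ : ℝ := min ν (κ₀ / 2) with hμ
  have hμpos : 0 < μ := by positivity
  set L : ℝ := (2 * B + κ') * ∑ i, c i with hL
  have hL0 : 0 ≤ L := by positivity
  set a : ℝ := ∑ i, L / (c i * μ ^ 2) + 1 with ha
  have hterm : ∀ i, 0 ≤ L / (c i * μ ^ 2) := fun i => by have := hc i; positivity
  have hapos : 0 < a := by
    have := Finset.sum_nonneg fun i (_ : i ∈ Finset.univ) => hterm i
    linarith
  obtain ⟨x₁, y₁, hy₁, hm⟩ := exists_max_sum_penal hK ⟨x₀, hx₀⟩ hf hc hapos s x₀ hθ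
  have hm0 := hm x₀ (fun i => x₀ + s i) hsK
  have e0 : ∀ i, penal (f i) a (s i) x₀ (x₀ + s i) = f i (x₀ + s i) := fun i => by
    simp [penal]
  simp only [e0] at hm0
  have hlow : ∑ i, c i * f i x₀ - κ' * ∑ i, c i ≤ ∑ i, c i * f i (x₀ + s i) := by
    rw [Finset.mul_sum, ← Finset.sum_sub_distrib]
    refine Finset.sum_le_sum fun i _ => ?_
    nlinarith [hsf i, hc i]
  have hexp : ∑ i, c i * penal (f i) a (s i) x₁ (y₁ i)
      = ∑ i, c i * f i (y₁ i) - ∑ i, c i * (a * ‖y₁ i - x₁ - s i‖ ^ 2) := by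
    rw [← Finset.sum_sub_distrib]
    exact Finset.sum_congr rfl fun i _ => by rw [penal]; ring
  have hpen0 : 0 ≤ ∑ i, c i * (a * ‖y₁ i - x₁ - s i‖ ^ 2) :=
    Finset.sum_nonneg fun i _ => by have := hc i; positivity
  have hx1 : 0 ≤ θ * ‖x₁ - x₀‖ ^ 2 := by positivity
  have hx00 : θ * ‖x₀ - x₀‖ ^ 2 = 0 := by simp
  have hpen : ∑ i, c i * (a * ‖y₁ i - x₁ - s i‖ ^ 2) ≤ L := by
    have h1 : ∑ i, c i * f i (y₁ i) - ∑ i, c i * f i x₀ ≤ 2 * B * ∑ i, c i := by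
      rw [Finset.mul_sum, ← Finset.sum_sub_distrib]
      refine Finset.sum_le_sum fun i _ => ?_
      have h2 := abs_le.1 (hB i _ (hy₁ i))
      have h3 := abs_le.1 (hB i _ hx₀)
      nlinarith [hc i]
    rw [hL]
    nlinarith
  have hdist : ∀ i, ‖y₁ i - x₁ - s i‖ ≤ μ := by
    intro i
    have h1 : c i * (a * ‖y₁ i - x₁ - s i‖ ^ 2) ≤ L :=
      (Finset.single_le_sum (f := fun i => c i * (a * ‖y₁ i - x₁ - s i‖ ^ 2))
        (fun j _ => by have := hc j; positivity) (Finset.mem_univ i)).trans hpen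
    have h2 : L ≤ a * (c i * μ ^ 2) := by
      rw [← div_le_iff₀ (by have := hc i; positivity)]
      have := Finset.single_le_sum (f := fun i => L / (c i * μ ^ 2))
        (fun j _ => hterm j) (Finset.mem_univ i)
      linarith
    have h3 : (c i * a) * ‖y₁ i - x₁ - s i‖ ^ 2 ≤ (c i * a) * μ ^ 2 := by linarith
    have h4 := le_of_mul_le_mul_left h3 (mul_pos (hc i) hapos)
    exact (pow_le_pow_iff_left₀ (norm_nonneg _) hμpos.le two_ne_zero).1 h4
  have hfin := hnear x₁ y₁ hy₁ (fun i => by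
    have h1 : y₁ i - x₁ = (y₁ i - x₁ - s i) + s i := by abel
    rw [h1]
    have := min_le_right ν (κ₀ / 2)
    linarith [norm_add_le (y₁ i - x₁ - s i) (s i), hs i, hdist i]) (by linarith)
  exact ⟨a, hapos, x₁, y₁, hy₁, hm, fun i => (hdist i).trans (min_le_left _ _), hfin.1, hfin.2⟩

end Doubling

section BoundaryBarrier

variable {N : ℕ}

theorem statOp_congr {h : Euc N → ℝ} {lam m : ℝ} {φ ψ : Euc N → ℝ} {x : Euc N}
    (hφψ : φ =ᶠ[𝓝 x] ψ) (r : ℝ) : statOp h lam m φ r x = statOp h lam m ψ r x := by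
  simp only [statOp, lapl_congr hφψ, gradient_congr hφψ]

theorem IsStatSub.test_contDiffAt {Ω : Set (Euc N)} {h k : Euc N → ℝ} {lam m : ℝ}
    {u : Euc N → ℝ} (hu : IsStatSub Ω h k lam m u) {φ : Euc N → ℝ} {x : Euc N}
    (hφ : ContDiffAt ℝ 2 φ x) (hx : x ∈ closure Ω)
    (hmax : IsLocalMaxOn (fun y => u y - φ y) (closure Ω) x) :
    (x ∈ Ω → statOp h lam m φ (u x) x ≤ 0) ∧
      (x ∈ frontier Ω → min (statOp h lam m φ (u x) x) (u x - k x) ≤ 0) := by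
  obtain ⟨ψ, hψ, he⟩ := hφ.exists_contDiff_eventuallyEq
  rw [← statOp_congr he]
  refine hu.2 ψ hψ x hx ?_
  filter_upwards [hmax, he.filter_mono nhdsWithin_le_nhds] with y hy hey
  simp only [Pi.sub_apply]
  rw [hey, he.eq_of_nhds]
  exact hy

theorem IsStatSuper.test_contDiffAt {Ω : Set (Euc N)} {h k : Euc N → ℝ} {lam m : ℝ}
    {v : Euc N → ℝ} (hv : IsStatSuper Ω h k lam m v) {φ : Euc N → ℝ} {x : Euc N}
    (hφ : ContDiffAt ℝ 2 φ x) (hx : x ∈ closure Ω)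
    (hmin : IsLocalMinOn (fun y => v y - φ y) (closure Ω) x) :
    (x ∈ Ω → 0 ≤ statOp h lam m φ (v x) x) ∧
      (x ∈ frontier Ω → 0 ≤ max (statOp h lam m φ (v x) x) (v x - k x)) := by
  obtain ⟨ψ, hψ, he⟩ := hφ.exists_contDiff_eventuallyEq
  rw [← statOp_congr he]
  refine hv.2 ψ hψ x hx ?_
  filter_upwards [hmin, he.filter_mono nhdsWithin_le_nhds] with y hy hey
  simp only [Pi.sub_apply]
  rw [hey, he.eq_of_nhds]
  exact hy

set_option maxHeartbeats 1000000 in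
/-- A barrier at a boundary point of `{ρ ≤ 0}`, strict for the operator `-Δ - |D·|²`. -/
theorem exists_boundary_barrier {ρ : Euc N → ℝ} (hρ : ContDiff ℝ 2 ρ) {x₀ : Euc N}
    (h0 : ρ x₀ = 0) (hg : gradient ρ x₀ ≠ 0) {r₀ : ℝ} (hr₀ : 0 < r₀) {M : ℝ} (hM : 0 < M)
    (Λ : ℝ) :
    ∃ d₀ > 0, ∃ φ : Euc N → ℝ, φ x₀ = 0 ∧ (∀ x, ρ x ≤ 0 → ContDiffAt ℝ 2 φ x) ∧
      (∀ x, ρ x ≤ 0 → 0 ≤ φ x) ∧ (∀ x, ρ x ≤ 0 → r₀ ≤ ‖x - x₀‖ → M ≤ φ x) ∧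
      (∀ x, ρ x ≤ -d₀ → M ≤ φ x) ∧
      ∃ r > 0, (∀ x, ρ x ≤ 0 → r ≤ ‖x - x₀‖ → M ≤ φ x) ∧
        ∀ x, ρ x ≤ 0 → ‖x - x₀‖ ≤ r → -d₀ ≤ ρ x →
          Λ ≤ -lapl φ x - ‖gradient φ x‖ ^ 2 := by
  set c : ℝ := ‖gradient ρ x₀‖ / 2 with hc
  have hgpos : 0 < ‖gradient ρ x₀‖ := norm_pos_iff.2 hg
  have hcpos : 0 < c := by positivity
  set C : ℝ := |lapl ρ x₀| + 1 with hC
  have hev : ∀ᶠ x in 𝓝 x₀, c < ‖gradient ρ x‖ ∧ |lapl ρ x| < C :=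
    ((continuous_gradient hρ).norm.continuousAt.eventually (lt_mem_nhds (by linarith))).and
      ((continuous_lapl hρ).abs.continuousAt.eventually (gt_mem_nhds (by linarith)))
  obtain ⟨r₁, hr₁, hball⟩ := Metric.eventually_nhds_iff_ball.1 hev
  set r : ℝ := min r₀ (r₁ / 2) with hr
  have hrpos : 0 < r := by positivity
  have hrr₀ : r ≤ r₀ := min_le_left _ _
  have hrr₁ : r < r₁ := (min_le_right _ _).trans_lt (by linarith)
  set R : ℝ := M / r ^ 2 with hR
  have hRpos : 0 < R := by positivity
  set L : ℝ := |Λ| + 2 * N * R + 8 * R ^ 2 * r ^ 2 with hL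
  have hL0 : 0 ≤ L := by positivity
  set X₀ : ℝ := 4 * C / c ^ 2 + 16 * L / c ^ 2 + 1 with hX₀
  have hX₀pos : 0 < X₀ := by positivity
  have hquad : ∀ X, X₀ ≤ X → L ≤ X ^ 2 * c ^ 2 / 8 - C * X / 4 := by
    intro X hX
    have h1 : 4 * C + 16 * L + c ^ 2 ≤ X * c ^ 2 := by
      have : X₀ * c ^ 2 ≤ X * c ^ 2 := by gcongr
      have e : X₀ * c ^ 2 = 4 * C + 16 * L + c ^ 2 := by
        rw [hX₀]; field_simp
      linarith
    have hX1 : 1 ≤ X := by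
      have : 0 ≤ 4 * C / c ^ 2 + 16 * L / c ^ 2 := by positivity
      linarith
    have h2 : X * (4 * C + 16 * L + c ^ 2) ≤ X * (X * c ^ 2) := by gcongr
    have h3 : L ≤ X * L := le_mul_of_one_le_left hL0 hX1
    have h4 : 0 ≤ X * c ^ 2 := by positivity
    have h5 : 0 ≤ X * C := by positivity
    linarith [show X ^ 2 * c ^ 2 / 8 - C * X / 4 = (X * (X * c ^ 2) - 2 * (X * C)) / 8 by ring]
  set d₀ : ℝ := 1 / (2 * X₀) with hd₀
  have hd₀pos : 0 < d₀ := by positivity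
  set e : ℝ := min d₀ (d₀ / Real.exp (4 * M)) with he
  have hepos : 0 < e := by positivity
  have hed₀ : e ≤ d₀ := min_le_left _ _
  have hede : Real.exp (4 * M) ≤ d₀ / e := by
    rw [le_div_iff₀ hepos, mul_comm, ← le_div_iff₀ (Real.exp_pos _)]
    exact min_le_right _ _
  let F : ℝ → ℝ := fun t => (1 / 4) * Real.log (1 + t / e)
  have hF0 : F 0 = 0 := by simp [F]
  have hFmono : ∀ s t, 0 ≤ s → s ≤ t → F s ≤ F t := by
    intro s t hs hst
    simp only [F]
    have : 0 < 1 + s / e := by positivity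
    gcongr
  have hFd₀ : M ≤ F d₀ := by
    simp only [F]
    have h1 : 4 * M ≤ Real.log (1 + d₀ / e) := by
      rw [Real.le_log_iff_exp_le (by positivity)]
      linarith
    linarith
  have hFder : ∀ t, -e < t → HasDerivAt F (1 / 4 * (e + t)⁻¹) t := by
    intro t ht
    have h1 : 0 < 1 + t / e := by
      have : -1 < t / e := by rw [lt_div_iff₀ hepos]; linarith
      linarith
    have h2 : HasDerivAt (fun t => 1 + t / e) (1 / e) t :=
      ((hasDerivAt_id t).div_const e).const_add 1
    have h3 := (h2.log h1.ne').const_mul (1 / 4)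
    refine h3.congr_deriv ?_
    have h4 : e + t ≠ 0 := by linarith
    have h5 : 1 + t / e = (e + t) / e := by field_simp
    rw [h5]
    field_simp
  have hFder2 : ∀ t, -e < t → HasDerivAt (fun t => 1 / 4 * (e + t)⁻¹)
      (-(1 / 4 * ((e + t)⁻¹) ^ 2)) t := by
    intro t ht
    have h3 : e + t ≠ 0 := by linarith
    have h2 : HasDerivAt (fun t => e + t) 1 t := (hasDerivAt_id t).const_add e
    have h4 := (h2.inv h3).const_mul (1 / 4)
    refine h4.congr_deriv ?_
    field_simp
  let φ : Euc N → ℝ := fun x => F (-ρ x) + R * ‖x - x₀‖ ^ 2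
  have hFcd : ∀ x, ρ x ≤ 0 → ContDiffAt ℝ 2 (fun x => F (-ρ x)) x := by
    intro x hx
    have h1 : 1 + -ρ x / e ≠ 0 := by
      have : 0 ≤ -ρ x / e := div_nonneg (by linarith) hepos.le
      linarith
    exact contDiffAt_const.mul ((contDiffAt_const.add
      (hρ.contDiffAt.neg.div_const e)).log h1)
  have hquadcd : ∀ x, ContDiffAt ℝ 2 (fun x : Euc N => R * ‖x - x₀‖ ^ 2) x := fun x =>
    contDiffAt_const.mul (contDiff_norm_sub_sq x₀).contDiffAt
  have hFnn : ∀ x, ρ x ≤ 0 → 0 ≤ F (-ρ x) := fun x hx => by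
    rw [← hF0]
    exact hFmono 0 _ le_rfl (by linarith)
  have hRr : ∀ x, ρ x ≤ 0 → r ≤ ‖x - x₀‖ → M ≤ φ x := by
    intro x hx hxr
    have h1 : R * r ^ 2 ≤ R * ‖x - x₀‖ ^ 2 := by gcongr
    have h2 : R * r ^ 2 = M := by rw [hR]; field_simp
    have := hFnn x hx
    simp only [φ]
    linarith
  refine ⟨d₀, hd₀pos, φ, by simp [φ, h0, hF0], fun x hx => (hFcd x hx).add (hquadcd x),
    fun x hx => add_nonneg (hFnn x hx) (by positivity),
    fun x hx hxr => hRr x hx (hrr₀.trans hxr), fun x hx => ?_, r, hrpos, hRr, ?_⟩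
  · have h1 := hFmono d₀ (-ρ x) hd₀pos.le (by linarith)
    have h2 : 0 ≤ R * ‖x - x₀‖ ^ 2 := by positivity
    simp only [φ]
    linarith
  intro x hx hxr hxd
  have hxb : x ∈ ball x₀ r₁ := by
    rw [mem_ball, dist_eq_norm]; exact hxr.trans_lt hrr₁
  obtain ⟨hgx, hlx⟩ := hball x hxb
  set X : ℝ := (e + -ρ x)⁻¹ with hX
  have hXpos : 0 < X := inv_pos.2 (by linarith)
  have hXX₀ : X₀ ≤ X := by
    rw [hX, le_inv_comm₀ hX₀pos (by linarith)]
    have : X₀⁻¹ = d₀ + d₀ := by rw [hd₀]; field_simp; norm_num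
    linarith
  have hgr : HasGradientAt (fun x => -ρ x) (-gradient ρ x) x :=
    hρ.contDiffAt.hasGradientAt'.neg'
  have hgφ : HasGradientAt φ ((1 / 4 * X) • (-gradient ρ x) + R • (2 : ℝ) • (x - x₀)) x :=
    (HasGradientAt.comp_real (hFder (-ρ x) (by linarith)) hgr).add'
      ((hasGradientAt_norm_sub_sq x₀ x).const_mul' R)
  have hlφ : lapl φ x = -(1 / 4 * X ^ 2) * ‖gradient ρ x‖ ^ 2 + 1 / 4 * X * (-lapl ρ x)
      + R * (2 * N) := by
    have h1 := lapl_add (x := x) (hFcd x hx) (hquadcd x)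
    have h2 := lapl_comp_real (F := F) (q := fun x => -ρ x) (x := x)
      (Filter.eventually_of_mem (Ioi_mem_nhds (show -e < -ρ x by linarith))
        (fun t ht => hFder t ht))
      (hFder2 (-ρ x) (by linarith)) hρ.contDiffAt.neg
    rw [hgr.gradient, norm_neg, lapl_neg] at h2
    have h3 := lapl_const_mul (x := x) R (contDiff_norm_sub_sq x₀).contDiffAt
    rw [lapl_norm_sub_sq] at h3
    rw [show lapl φ x = _ from h1, h2, h3]
  rw [hlφ, hgφ.gradient]
  have hn1 : ‖(1 / 4 * X) • (-gradient ρ x) + R • (2 : ℝ) • (x - x₀)‖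
      ≤ 1 / 4 * X * ‖gradient ρ x‖ + 2 * R * r := by
    refine (norm_add_le _ _).trans ?_
    rw [norm_smul, norm_smul, norm_smul, norm_neg, Real.norm_of_nonneg (by positivity),
      Real.norm_of_nonneg hRpos.le, Real.norm_of_nonneg (by norm_num)]
    have : R * ‖x - x₀‖ ≤ R * r := by gcongr
    linarith
  have hn2 : ‖(1 / 4 * X) • (-gradient ρ x) + R • (2 : ℝ) • (x - x₀)‖ ^ 2
      ≤ 2 * (1 / 4 * X * ‖gradient ρ x‖) ^ 2 + 2 * (2 * R * r) ^ 2 := by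
    refine (pow_le_pow_left₀ (norm_nonneg _) hn1 2).trans (add_sq_le.trans ?_)
    rw [mul_add]
  have hq := hquad X hXX₀
  have hgc : X ^ 2 * c ^ 2 ≤ X ^ 2 * ‖gradient ρ x‖ ^ 2 := by gcongr
  have hlc : X * -C ≤ X * lapl ρ x := by
    gcongr
    exact (abs_lt.1 hlx).1.le
  have hΛ := le_abs_self Λ
  linarith

theorem norm_rpow_le_one_add_sq {t m : ℝ} (ht : 0 ≤ t) (hm : 0 < m) (hm2 : m ≤ 2) :
    t ^ m ≤ 1 + t ^ 2 := by
  rcases le_total t 1 with h1 | h1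
  · have := Real.rpow_le_one ht h1 hm.le
    nlinarith [sq_nonneg t]
  · have := Real.rpow_le_rpow_of_exponent_le h1 hm2
    rw [Real.rpow_two] at this
    linarith

/-- Bounded subsolutions lie below the boundary datum. -/
theorem IsStatSub.le_boundary {Ω : Set (Euc N)} {ρ : Euc N → ℝ} (hρ : ContDiff ℝ 2 ρ)
    (hcl : closure Ω = {x | ρ x ≤ 0}) (hfr : frontier Ω = {x | ρ x = 0}) (hΩo : IsOpen Ω)
    (hK : IsCompact (closure Ω)) (hg : ∀ x ∈ frontier Ω, gradient ρ x ≠ 0)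
    {h k : Euc N → ℝ} {lam m : ℝ} {H : ℝ} (hH : ∀ x ∈ closure Ω, |h x| ≤ H)
    (hk : ContinuousOn k (frontier Ω)) {u : Euc N → ℝ} (hu : IsStatSub Ω h k lam m u) {B : ℝ}
    (hB : ∀ x ∈ closure Ω, |u x| ≤ B) : ∀ x ∈ frontier Ω, u x ≤ k x := by
  intro x₀ hx₀
  by_contra! hlt
  have hx₀K : x₀ ∈ closure Ω := frontier_subset_closure hx₀
  have hρx₀ : ρ x₀ = 0 := by rw [hfr] at hx₀; exact hx₀
  obtain ⟨r₀, hr₀, hkr⟩ := Metric.eventually_nhds_iff_ball.1 (eventually_nhdsWithin_iff.1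
    ((hk x₀ hx₀).eventually (gt_mem_nhds hlt)))
  have hB0 : 0 ≤ B := (abs_nonneg _).trans (hB x₀ hx₀K)
  obtain ⟨d₀, hd₀, φ, hφ0, hφcd, hφnn, hφr₀, hφd, r, hr, hφr, hφΛ⟩ :=
    exists_boundary_barrier hρ hρx₀
      (hg x₀ hx₀) hr₀ (show 0 < 2 * B + 1 by positivity) (|lam| * B + H + 1)
  have hφK : ContinuousOn φ (closure Ω) := fun x hx =>
    (hφcd x (by rw [hcl] at hx; exact hx)).continuousAt.continuousWithinAt
  obtain ⟨x₁, hx₁, hmax⟩ := UpperSemicontinuousOn.exists_isMaxOn ⟨x₀, hx₀K⟩ hK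
    (hu.1.add hφK.neg.upperSemicontinuousOn)
  have hρx₁ : ρ x₁ ≤ 0 := by rw [hcl] at hx₁; exact hx₁
  have h1 : u x₀ + -φ x₀ ≤ u x₁ + -φ x₁ := hmax hx₀K
  have hu0 := abs_le.1 (hB x₀ hx₀K)
  have hu1 := abs_le.1 (hB x₁ hx₁)
  have hnn := hφnn x₁ hρx₁
  have hr1 : ‖x₁ - x₀‖ < r := by
    by_contra! hge
    have := hφr x₁ hρx₁ hge
    linarith
  have hr2 : ‖x₁ - x₀‖ < r₀ := by
    by_contra! hge
    have := hφr₀ x₁ hρx₁ hge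
    linarith
  have hd1 : -d₀ < ρ x₁ := by
    by_contra! hge
    have := hφd x₁ hge
    linarith
  have hΛ := hφΛ x₁ hρx₁ hr1.le hd1.le
  have htest := hu.test_contDiffAt (hφcd x₁ hρx₁) hx₁ (IsMaxOn.localize fun x hx => by
    have : u x + -φ x ≤ u x₁ + -φ x₁ := hmax hx
    show u x - φ x ≤ u x₁ - φ x₁
    linarith)
  have hop : 0 < statOp h lam m φ (u x₁) x₁ := by
    rw [statOp]
    have h2 : 0 ≤ ‖gradient φ x₁‖ ^ m := by positivity
    have h3 : 0 ≤ ‖gradient φ x₁‖ ^ 2 := by positivity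
    have h4 : -(|lam| * B) ≤ lam * u x₁ := by
      have h5 : |lam * u x₁| ≤ |lam| * B := by
        rw [abs_mul]
        exact mul_le_mul_of_nonneg_left (hB x₁ hx₁) (abs_nonneg _)
      exact (abs_le.1 h5).1
    have h6 := (abs_le.1 (hH x₁ hx₁)).2
    linarith
  by_cases hx₁Ω : x₁ ∈ Ω
  · exact absurd (htest.1 hx₁Ω) (not_le.2 hop)
  · have hx₁f : x₁ ∈ frontier Ω := ⟨hx₁, by rwa [hΩo.interior_eq]⟩
    have hk1 : k x₁ < u x₀ := hkr x₁ (by rwa [mem_ball, dist_eq_norm]) hx₁f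
    refine absurd (htest.2 hx₁f) (not_le.2 (lt_min hop ?_))
    linarith

/-- If `m ≤ 2`, bounded supersolutions lie above the boundary datum. -/
theorem IsStatSuper.boundary_le {Ω : Set (Euc N)} {ρ : Euc N → ℝ} (hρ : ContDiff ℝ 2 ρ)
    (hcl : closure Ω = {x | ρ x ≤ 0}) (hfr : frontier Ω = {x | ρ x = 0}) (hΩo : IsOpen Ω)
    (hK : IsCompact (closure Ω)) (hg : ∀ x ∈ frontier Ω, gradient ρ x ≠ 0)
    {h k : Euc N → ℝ} {lam m : ℝ} (hm : 0 < m) (hm2 : m ≤ 2) {H : ℝ}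
    (hH : ∀ x ∈ closure Ω, |h x| ≤ H)
    (hk : ContinuousOn k (frontier Ω)) {v : Euc N → ℝ} (hv : IsStatSuper Ω h k lam m v) {B : ℝ}
    (hB : ∀ x ∈ closure Ω, |v x| ≤ B) : ∀ x ∈ frontier Ω, k x ≤ v x := by
  intro x₀ hx₀
  by_contra! hlt
  have hx₀K : x₀ ∈ closure Ω := frontier_subset_closure hx₀
  have hρx₀ : ρ x₀ = 0 := by rw [hfr] at hx₀; exact hx₀
  obtain ⟨r₀, hr₀, hkr⟩ := Metric.eventually_nhds_iff_ball.1 (eventually_nhdsWithin_iff.1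
    ((hk x₀ hx₀).eventually (lt_mem_nhds hlt)))
  have hB0 : 0 ≤ B := (abs_nonneg _).trans (hB x₀ hx₀K)
  obtain ⟨d₀, hd₀, φ, hφ0, hφcd, hφnn, hφr₀, hφd, r, hr, hφr, hφΛ⟩ :=
    exists_boundary_barrier hρ hρx₀
      (hg x₀ hx₀) hr₀ (show 0 < 2 * B + 1 by positivity) (|lam| * B + H + 2)
  have hφK : ContinuousOn φ (closure Ω) := fun x hx =>
    (hφcd x (by rw [hcl] at hx; exact hx)).continuousAt.continuousWithinAt
  obtain ⟨x₁, hx₁, hmin⟩ := LowerSemicontinuousOn.exists_isMinOn ⟨x₀, hx₀K⟩ hK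
    (hv.1.add hφK.lowerSemicontinuousOn)
  have hρx₁ : ρ x₁ ≤ 0 := by rw [hcl] at hx₁; exact hx₁
  have h1 : v x₁ + φ x₁ ≤ v x₀ + φ x₀ := hmin hx₀K
  have hu0 := abs_le.1 (hB x₀ hx₀K)
  have hu1 := abs_le.1 (hB x₁ hx₁)
  have hnn := hφnn x₁ hρx₁
  have hr1 : ‖x₁ - x₀‖ < r := by
    by_contra! hge
    have := hφr x₁ hρx₁ hge
    linarith
  have hr2 : ‖x₁ - x₀‖ < r₀ := by
    by_contra! hge
    have := hφr₀ x₁ hρx₁ hge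
    linarith
  have hd1 : -d₀ < ρ x₁ := by
    by_contra! hge
    have := hφd x₁ hge
    linarith
  have hΛ := hφΛ x₁ hρx₁ hr1.le hd1.le
  have htest := hv.test_contDiffAt (hφcd x₁ hρx₁).neg hx₁ (IsMinOn.localize fun x hx => by
    have : v x₁ + φ x₁ ≤ v x + φ x := hmin hx
    show v x₁ - -φ x₁ ≤ v x - -φ x
    linarith)
  have hop : statOp h lam m (fun x => -φ x) (v x₁) x₁ < 0 := by
    rw [statOp, lapl_neg, ((hφcd x₁ hρx₁).hasGradientAt'.neg').gradient, norm_neg]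
    have h2 := norm_rpow_le_one_add_sq (norm_nonneg (gradient φ x₁)) hm hm2
    have h4 : lam * v x₁ ≤ |lam| * B := by
      have h5 : |lam * v x₁| ≤ |lam| * B := by
        rw [abs_mul]
        exact mul_le_mul_of_nonneg_left (hB x₁ hx₁) (abs_nonneg _)
      exact (abs_le.1 h5).2
    have h6 := (abs_le.1 (hH x₁ hx₁)).1
    linarith
  by_cases hx₁Ω : x₁ ∈ Ω
  · exact absurd (htest.1 hx₁Ω) (not_le.2 hop)
  · have hx₁f : x₁ ∈ frontier Ω := ⟨hx₁, by rwa [hΩo.interior_eq]⟩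
    have hk1 : v x₀ < k x₁ := hkr x₁ (by rwa [mem_ball, dist_eq_norm]) hx₁f
    refine absurd (htest.2 hx₁f) (not_le.2 (max_lt hop ?_))
    linarith

end BoundaryBarrier

section InnerShift

variable {N : ℕ}

/-- The algebraic inequality making `-(C/α) q ^ α - δ log q` a strict supersolution where the
slope `P` of `q` is bounded away from zero. -/
theorem superquadratic_barrier_ineq {m α C₁ δ q P l κ C₂ C₃ Λ : ℝ} (hm : 2 < m)
    (hα0 : 0 < α) (hα : (α - 1) * (m - 1) = -1) (hδ : 0 < δ) (hq0 : 0 < q) (hq1 : q ≤ 1)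
    (hκ : 0 < κ) (hκP : κ ≤ P) (hPC : P ≤ C₂) (hl : -(C₃ / q) ≤ l) (hC₁ : 1 ≤ C₁)
    (hΛ : Λ ≤ C₁) (hQ : C₂ ^ 2 + C₃ + 1 ≤ C₁ ^ (m - 1) * κ ^ m) :
    Λ ≤ -((C₁ * (1 - α) * q ^ (α - 2) + δ * (q ^ 2)⁻¹) * P ^ 2
      + -(C₁ * q ^ (α - 1) + δ * q⁻¹) * l) + ((C₁ * q ^ (α - 1) + δ * q⁻¹) * P) ^ m := by
  set g : ℝ := C₁ * q ^ (α - 1) + δ * q⁻¹ with hg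
  have hP0 : 0 < P := hκ.trans_le hκP
  have hC₁0 : 0 < C₁ := one_pos.trans_le hC₁
  have hα1 : α ≤ 1 := by nlinarith
  have hgpos : 0 < g := by positivity
  have hqinv : 1 ≤ q⁻¹ := (one_le_inv₀ hq0).2 hq1
  have hqa : 1 ≤ q ^ (α - 1) := Real.one_le_rpow_of_pos_of_le_one_of_nonpos hq0 hq1 (by linarith)
  have h2 : q ^ (α - 2) = q ^ (α - 1) * q⁻¹ := by
    rw [← Real.rpow_neg_one q, ← Real.rpow_add hq0]
    congr 1
    ring
  have hF : C₁ * (1 - α) * q ^ (α - 2) + δ * (q ^ 2)⁻¹ ≤ g * q⁻¹ := by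
    rw [h2, hg, show (q ^ 2)⁻¹ = q⁻¹ * q⁻¹ by rw [sq, mul_inv]]
    have : 0 ≤ C₁ * α * (q ^ (α - 1) * q⁻¹) := by positivity
    linarith
  have hgm : C₁ ^ (m - 1) * q⁻¹ ≤ g ^ (m - 1) := by
    have h3 : (C₁ * q ^ (α - 1)) ^ (m - 1) ≤ g ^ (m - 1) := by
      refine Real.rpow_le_rpow (by positivity) ?_ (by linarith)
      have : 0 < δ * q⁻¹ := by positivity
      linarith
    rwa [Real.mul_rpow hC₁0.le (by positivity), ← Real.rpow_mul hq0.le, hα,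
      Real.rpow_neg_one] at h3
  have hpow : g * q⁻¹ * (C₁ ^ (m - 1) * κ ^ m) ≤ (g * P) ^ m := by
    rw [Real.mul_rpow hgpos.le hP0.le]
    have h4 : g ^ m = g * g ^ (m - 1) := by
      rw [mul_comm, ← Real.rpow_add_one hgpos.ne']
      congr 1
      ring
    have h5 : κ ^ m ≤ P ^ m := Real.rpow_le_rpow hκ.le hκP (by linarith)
    rw [h4]
    calc g * q⁻¹ * (C₁ ^ (m - 1) * κ ^ m) = g * (C₁ ^ (m - 1) * q⁻¹) * κ ^ m := by ring
      _ ≤ g * g ^ (m - 1) * P ^ m := by gcongr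
  have hgq : C₁ ≤ g * q⁻¹ := by
    have h6 : C₁ ≤ g := by
      have : 0 < δ * q⁻¹ := by positivity
      nlinarith
    nlinarith
  have h7 : (C₁ * (1 - α) * q ^ (α - 2) + δ * (q ^ 2)⁻¹) * P ^ 2 ≤ g * q⁻¹ * C₂ ^ 2 := by
    have : P ^ 2 ≤ C₂ ^ 2 := by gcongr
    have h0 : 0 ≤ g * q⁻¹ := by positivity
    exact mul_le_mul hF this (by positivity) h0
  have h8 : -(g * q⁻¹ * C₃) ≤ g * l := by
    have := mul_le_mul_of_nonneg_left hl hgpos.le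
    rw [div_eq_mul_inv] at this
    linarith
  have h9 : g * q⁻¹ * (C₂ ^ 2 + C₃ + 1) ≤ g * q⁻¹ * (C₁ ^ (m - 1) * κ ^ m) := by gcongr
  linarith

theorem norm_fderiv_eq_norm_gradient (φ : Euc N → ℝ) (x : Euc N) :
    ‖fderiv ℝ φ x‖ = ‖gradient φ x‖ := by
  rw [gradient, LinearIsometryEquiv.norm_map]

set_option maxHeartbeats 1000000 in
/-- In the superquadratic case, bounded subsolutions near a boundary point `x₀` do not exceed by
much their values at suitable points in the inner normal direction. -/
theorem IsStatSub.eventually_exists_inner_shift {Ω : Set (Euc N)} {ρ : Euc N → ℝ}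
    (hρ : ContDiff ℝ 2 ρ) (hΩ : Ω = {x | ρ x < 0}) (hcl : closure Ω = {x | ρ x ≤ 0})
    (hK : IsCompact (closure Ω)) {h k : Euc N → ℝ} {lam m : ℝ} (hm : 2 < m) {H : ℝ}
    (hH : ∀ x ∈ closure Ω, |h x| ≤ H) {u : Euc N → ℝ} (hu : IsStatSub Ω h k lam m u) {B : ℝ}
    (hB : ∀ x ∈ closure Ω, |u x| ≤ B) {x₀ : Euc N} (hx₀ : ρ x₀ = 0) {κ e : ℝ} (hκ : 0 < κ)
    (he : 0 < e) :
    ∀ᶠ τ in 𝓝[>] (0 : ℝ), ∀ x ∈ Ω, ‖x - x₀‖ ≤ κ * τ →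
      ∃ z ∈ Ω, ‖z - x + τ • gradient ρ x₀‖ ≤ 2 * κ * τ ∧ u x ≤ u z + e := by
  set G := gradient ρ x₀ with hG
  set L : ℝ := ‖G‖ + κ with hL
  have hL0 : 0 < L := by positivity
  set C : ℝ := |lapl ρ x₀| + 1 with hC
  have hev : ∀ᶠ x in 𝓝 x₀, ‖gradient ρ x - G‖ < κ ∧ |lapl ρ x| < C := by
    refine (Filter.Tendsto.eventually (f := fun x => ‖gradient ρ x - G‖) (l₂ := 𝓝 0) ?_
      (gt_mem_nhds hκ)).and
      ((continuous_lapl hρ).abs.continuousAt.eventually (gt_mem_nhds (by linarith)))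
    exact tendsto_iff_norm_sub_tendsto_zero.1 ((continuous_gradient hρ).tendsto x₀)
  obtain ⟨r₁, hr₁, hball⟩ := Metric.eventually_nhds_iff_ball.1 hev
  have hgL : ∀ z ∈ ball x₀ r₁, ‖gradient ρ z‖ ≤ L := by
    intro z hz
    have h1 := norm_add_le (gradient ρ z - G) G
    rw [sub_add_cancel] at h1
    linarith [(hball z hz).1]
  have hLip : ∀ z ∈ ball x₀ r₁, -ρ z ≤ L * ‖z - x₀‖ := by
    intro z hz
    have h1 := (convex_ball x₀ r₁).norm_image_sub_le_of_norm_fderiv_le (𝕜 := ℝ) (f := ρ) (C := L)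
      (fun y _ => (hρ.differentiable (by norm_num)).differentiableAt)
      (fun y hy => by rw [norm_fderiv_eq_norm_gradient]; exact hgL y hy) (mem_ball_self hr₁) hz
    rw [hx₀, sub_zero] at h1
    exact (neg_le_abs _).trans h1
  obtain ⟨D', hD'⟩ := hK.exists_bound_of_continuousOn hρ.continuous.continuousOn
  set D : ℝ := |D'| with hD
  have hDb : ∀ z ∈ closure Ω, -ρ z ≤ D := fun z hz =>
    (neg_le_abs _).trans ((hD' z hz).trans (le_abs_self _))
  have hB0 : 0 ≤ B := (abs_nonneg _).trans (hB x₀ (by rw [hcl]; exact hx₀.le))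
  set α : ℝ := (m - 2) / (m - 1) with hα
  have hm1 : 0 < m - 1 := by linarith
  have hα0 : 0 < α := div_pos (by linarith) hm1
  have hα1 : (α - 1) * (m - 1) = -1 := by
    rw [hα]; field_simp; ring
  set C₄ : ℝ := L * (2 * L + 2 * κ) with hC₄
  have hC₄0 : 0 < C₄ := by positivity
  set C₂ : ℝ := 3 * L + κ with hC₂
  set C₃ : ℝ := C + N * C₄ with hC₃
  set Λ : ℝ := |lam| * B + |H| + 1 with hΛ
  set C₁ : ℝ := 1 + Λ + (C₂ ^ 2 + C₃ + 1) / κ ^ m with hC₁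
  have hΛ0 : 0 ≤ Λ := by positivity
  have hquot : 0 ≤ (C₂ ^ 2 + C₃ + 1) / κ ^ m := by positivity
  have hC₁1 : 1 ≤ C₁ := by linarith
  have hC₁0 : 0 < C₁ := by linarith
  have hQ : C₂ ^ 2 + C₃ + 1 ≤ C₁ ^ (m - 1) * κ ^ m := by
    rw [← div_le_iff₀ (by positivity)]
    have h1 : C₁ ^ (1 : ℝ) ≤ C₁ ^ (m - 1) :=
      Real.rpow_le_rpow_of_exponent_le hC₁1 (by linarith)
    rw [Real.rpow_one] at h1
    linarith
  have ht : ∀ {F : ℝ → ℝ} {b : ℝ}, Continuous F → F 0 < b → ∀ᶠ τ in 𝓝[>] (0 : ℝ), F τ < b :=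
    fun hF hb => (hF.continuousAt.eventually (gt_mem_nhds hb)).filter_mono nhdsWithin_le_nhds
  have hrp : Continuous fun τ : ℝ => C₁ / α * (C₄ * τ) ^ α + τ :=
    (continuous_const.mul ((continuous_const.mul continuous_id).rpow_const
      fun x => Or.inr hα0.le)).add continuous_id
  filter_upwards [ht (F := fun τ => 2 * τ * D) (b := (r₁ / 2) ^ 2) (by fun_prop)
      (by simp only [mul_zero, zero_mul]; positivity),
    ht (F := fun τ => κ * τ) (b := r₁ / 4) (by fun_prop) (by simp only [mul_zero]; positivity),
    ht (F := fun τ => C₄ * τ) (b := 1) (by fun_prop) (by simp),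
    ht hrp (b := e) (by simp [Real.zero_rpow hα0.ne', he]), self_mem_nhdsWithin]
    with τ hτD hτr hτ1 hτe hτ0
  replace hτ0 : 0 < τ := hτ0
  intro x hxΩ hxx₀
  have hxK : x ∈ closure Ω := subset_closure hxΩ
  have hρx : ρ x < 0 := by rw [hΩ] at hxΩ; exact hxΩ
  let q : Euc N → ℝ := fun z => -ρ z - 1 / (2 * τ) * ‖z - x‖ ^ 2
  have hqle : ∀ z, q z ≤ -ρ z := fun z => by
    have : 0 ≤ 1 / (2 * τ) * ‖z - x‖ ^ 2 := by positivity
    simp only [q]; linarith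
  have hqx : q x = -ρ x := by simp [q]
  have hqc : ContDiff ℝ 2 q := hρ.neg.sub (contDiff_const.mul (contDiff_norm_sub_sq x))
  have hsq : ∀ z, 0 ≤ q z → ‖z - x‖ ^ 2 ≤ 2 * τ * -ρ z := by
    intro z hz
    have h1 : 1 / (2 * τ) * ‖z - x‖ ^ 2 ≤ -ρ z := by simp only [q] at hz; linarith
    rw [div_mul_eq_mul_div, one_mul, div_le_iff₀ (by positivity)] at h1
    linarith
  have hinball : ∀ z ∈ closure Ω, 0 ≤ q z → z ∈ ball x₀ r₁ := by
    intro z hz hqz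
    have h1 : ‖z - x‖ ^ 2 < (r₁ / 2) ^ 2 := by
      have h2 := hsq z hqz
      have h3 : 2 * τ * -ρ z ≤ 2 * τ * D := by
        have := hDb z hz
        gcongr
      linarith
    have h2 := lt_of_pow_lt_pow_left₀ 2 (by positivity) h1
    have h3 := norm_sub_le_norm_sub_add_norm_sub z x x₀
    rw [mem_ball, dist_eq_norm]
    linarith
  have hdist : ∀ z ∈ closure Ω, 0 ≤ q z → ‖z - x‖ ≤ (2 * L + κ) * τ := by
    intro z hz hqz
    by_contra! hlt
    have h1 := hsq z hqz
    have h2 := hLip z (hinball z hz hqz)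
    have h3 := norm_sub_le_norm_sub_add_norm_sub z x x₀
    have h4 : -ρ z ≤ L * (‖z - x‖ + κ * τ) := h2.trans (by gcongr; linarith)
    have h5 : 2 * τ * -ρ z ≤ 2 * τ * (L * (‖z - x‖ + κ * τ)) := by gcongr
    have hpos : 0 < ‖z - x‖ := lt_of_le_of_lt (by positivity) hlt
    have h6 : (2 * L + κ) * τ * ‖z - x‖ < ‖z - x‖ * ‖z - x‖ := by gcongr
    have h7 : κ * τ * ((2 * L + κ) * τ) ≤ κ * τ * ‖z - x‖ := by gcongr
    have h8 : 0 ≤ κ * τ * (κ * τ) := by positivity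
    linarith
  have hqC : ∀ z ∈ closure Ω, 0 ≤ q z → q z ≤ C₄ * τ := by
    intro z hz hqz
    have h2 := hLip z (hinball z hz hqz)
    have h3 := norm_sub_le_norm_sub_add_norm_sub z x x₀
    have h4 := hdist z hz hqz
    have h5 : L * ‖z - x₀‖ ≤ L * ((2 * L + κ) * τ + κ * τ) := by gcongr; linarith
    have h6 := hqle z
    have h7 : L * ((2 * L + κ) * τ + κ * τ) = C₄ * τ := by rw [hC₄]; ring
    linarith
  have hqgrad : ∀ z, HasGradientAt q (-gradient ρ z - (1 / (2 * τ)) • (2 : ℝ) • (z - x)) z :=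
    fun z => hρ.contDiffAt.hasGradientAt'.neg'.sub'
      ((hasGradientAt_norm_sub_sq x z).const_mul' _)
  have hqgrad' : ∀ z, gradient q z = -gradient ρ z - τ⁻¹ • (z - x) := fun z => by
    rw [(hqgrad z).gradient, smul_smul]
    congr 2
    field_simp
  have hqlap : ∀ z, lapl q z = -lapl ρ z - N / τ := fun z => by
    have h1 := lapl_sub (x := z) hρ.neg.contDiffAt
      (contDiff_const.mul (contDiff_norm_sub_sq x)).contDiffAt (φ := fun z => -ρ z)
      (ψ := fun z => 1 / (2 * τ) * ‖z - x‖ ^ 2)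
    rw [lapl_neg, lapl_const_mul _ (contDiff_norm_sub_sq x).contDiffAt, lapl_norm_sub_sq] at h1
    rw [show lapl q z = _ from h1]
    field_simp
  have hlogx : 0 ≤ |Real.log (q x)| := abs_nonneg _
  set δ : ℝ := τ / (|Real.log (q x)| + 1) with hδ
  have hδ0 : 0 < δ := by positivity
  have hδlog : -(δ * Real.log (q x)) ≤ τ := by
    have h1 : δ * (|Real.log (q x)| + 1) = τ := by rw [hδ]; field_simp
    have h2 := neg_abs_le (Real.log (q x))
    nlinarith
  let F : ℝ → ℝ := fun t => -(C₁ / α * t ^ α) - δ * Real.log t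
  have hFder : ∀ t, 0 < t → HasDerivAt F (-(C₁ * t ^ (α - 1) + δ * t⁻¹)) t := by
    intro t ht
    have h1 := ((Real.hasDerivAt_rpow_const (p := α) (Or.inl ht.ne')).const_mul (C₁ / α)).neg.sub
      ((Real.hasDerivAt_log ht.ne').const_mul δ)
    refine h1.congr_deriv ?_
    field_simp
    ring
  have hFder2 : ∀ t, 0 < t → HasDerivAt (fun t => -(C₁ * t ^ (α - 1) + δ * t⁻¹))
      (C₁ * (1 - α) * t ^ (α - 2) + δ * (t ^ 2)⁻¹) t := by
    intro t ht
    have h1 := (((Real.hasDerivAt_rpow_const (p := α - 1) (Or.inl ht.ne')).const_mul C₁).add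
      ((hasDerivAt_inv ht.ne').const_mul δ)).neg
    refine h1.congr_deriv ?_
    rw [show α - 1 - 1 = α - 2 by ring]
    ring
  have hFcd : ∀ t, 0 < t → ContDiffAt ℝ 2 F t := fun t ht =>
    (contDiffAt_const.mul (Real.contDiffAt_rpow_const_of_ne ht.ne')).neg.sub
      (contDiffAt_const.mul (Real.contDiffAt_log.2 ht.ne'))
  have hφcd : ∀ z, 0 < q z → ContDiffAt ℝ 2 (fun z => F (q z)) z := fun z hz =>
    (hFcd (q z) hz).comp z hqc.contDiffAt
  obtain ⟨t, ht0, htx, htF⟩ : ∃ t, 0 < t ∧ t < q x ∧ 2 * B + F (q x) < F t := by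
    have hlim : Tendsto F (𝓝[>] 0) atTop := by
      have h1 : Tendsto (fun t : ℝ => -(C₁ / α * t ^ α)) (𝓝[>] 0)
          (𝓝 (-(C₁ / α * (0 : ℝ) ^ α))) := by
        have h2 : Continuous fun t : ℝ => -(C₁ / α * t ^ α) :=
          (continuous_const.mul (continuous_id.rpow_const fun x => Or.inr hα0.le)).neg
        exact (h2.tendsto 0).mono_left nhdsWithin_le_nhds
      have h3 : Tendsto (fun t : ℝ => -(δ * Real.log t)) (𝓝[>] 0) atTop :=
        tendsto_neg_atBot_atTop.comp (Real.tendsto_log_nhdsGT_zero.const_mul_atBot hδ0)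
      exact h1.add_atTop h3
    have hx0 : 0 < q x := by rw [hqx]; linarith
    obtain ⟨t, h3, h1, h2⟩ := ((hlim.eventually_gt_atTop (2 * B + F (q x))).and
      (eventually_mem_set.2 (Ioo_mem_nhdsGT hx0))).exists
    exact ⟨t, h1, h2, h3⟩
  have hScomp : IsCompact (closure Ω ∩ {z | t ≤ q z}) :=
    hK.inter_right (isClosed_le continuous_const hqc.continuous)
  have hφS : ContinuousOn (fun z => F (q z)) (closure Ω ∩ {z | t ≤ q z}) := fun z hz =>
    (hφcd z (ht0.trans_le hz.2)).continuousAt.continuousWithinAt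
  have hSne : (closure Ω ∩ {z | t ≤ q z}).Nonempty := ⟨x, hxK, htx.le⟩
  obtain ⟨z, ⟨hzK, hzt⟩, hzmax⟩ := UpperSemicontinuousOn.exists_isMaxOn hSne hScomp
    ((hu.1.mono inter_subset_left).add hφS.neg.upperSemicontinuousOn)
  have hzx : u x + -F (q x) ≤ u z + -F (q z) := hzmax ⟨hxK, htx.le⟩
  have hzt' : t < q z := by
    refine lt_of_le_of_ne hzt fun heq => ?_
    rw [← heq] at hzx
    have h1 := abs_le.1 (hB x hxK)
    have h2 := abs_le.1 (hB z hzK)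
    linarith
  have hqz : 0 < q z := ht0.trans hzt'
  have hzΩ : z ∈ Ω := by
    have := hqle z
    rw [hΩ]
    show ρ z < 0
    linarith
  have hzloc : IsLocalMaxOn (fun y => u y - F (q y)) (closure Ω) z := by
    filter_upwards [self_mem_nhdsWithin,
      (hqc.continuous.continuousAt.eventually (lt_mem_nhds hzt')).filter_mono nhdsWithin_le_nhds]
      with y hy hty
    have : u y + -F (q y) ≤ u z + -F (q z) := hzmax ⟨hy, hty.le⟩
    show u y - F (q y) ≤ u z - F (q z)
    linarith
  have hop := (hu.test_contDiffAt (hφcd z hqz) hzK hzloc).1 hzΩ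
  have hzball := hinball z hzK hqz.le
  have hq1 : q z ≤ 1 := (hqC z hzK hqz.le).trans hτ1.le
  have hcore : ‖gradient q z‖ < κ := by
    by_contra! hge
    have hgq : ‖gradient q z‖ ≤ C₂ := by
      rw [hqgrad']
      refine (norm_sub_le _ _).trans ?_
      rw [norm_neg, norm_smul, Real.norm_of_nonneg (by positivity)]
      have h1 : τ⁻¹ * ‖z - x‖ ≤ 2 * L + κ := by
        rw [inv_mul_le_iff₀ hτ0, mul_comm]
        exact hdist z hzK hqz.le
      have h2 := hgL z hzball
      linarith
    have hlq : -(C₃ / q z) ≤ lapl q z := by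
      rw [hqlap, hC₃, add_div]
      have h1 := (abs_lt.1 (hball z hzball).2).2
      have h2 : C ≤ C / q z := by
        rw [le_div_iff₀ hqz]
        nlinarith [abs_nonneg (lapl ρ x₀)]
      have h3 : N / τ ≤ N * C₄ / q z := by
        rw [div_le_div_iff₀ hτ0 hqz]
        have := hqC z hzK hqz.le
        have h4 : (N : ℝ) * q z ≤ N * (C₄ * τ) := by gcongr
        linarith
      linarith
    have hineq := superquadratic_barrier_ineq (Λ := Λ) hm hα0 hα1 hδ0 hqz hq1 hκ hge hgq hlq hC₁1
      (by linarith) hQ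
    have hlφ := lapl_comp_real (F := F) (q := q) (x := z)
      (Filter.eventually_of_mem (Ioi_mem_nhds hqz) (fun t ht => hFder t ht))
      (hFder2 (q z) hqz) hqc.contDiffAt
    have hgφ := (HasGradientAt.comp_real (hFder (q z) hqz) hqc.contDiffAt.hasGradientAt').gradient
    rw [statOp, hlφ, hgφ, norm_smul, Real.norm_eq_abs, abs_neg,
      abs_of_pos (by positivity)] at hop
    have h4 : -(|lam| * B) ≤ lam * u z := by
      have h5 : |lam * u z| ≤ |lam| * B := by
        rw [abs_mul]
        exact mul_le_mul_of_nonneg_left (hB z hzK) (abs_nonneg _)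
      exact (abs_le.1 h5).1
    have h6 := (abs_le.1 (hH z hzK)).2
    have h7 := le_abs_self H
    linarith
  refine ⟨z, hzΩ, ?_, ?_⟩
  · have h1 : z - x + τ • G = -(τ • (gradient q z + (gradient ρ z - G))) := by
      have h2 : τ • τ⁻¹ • (z - x) = z - x := by
        rw [smul_smul, mul_inv_cancel₀ hτ0.ne', one_smul]
      rw [hqgrad', smul_add, smul_sub τ (-gradient ρ z) (τ⁻¹ • (z - x)), h2, smul_neg, smul_sub]
      abel
    rw [h1, norm_neg, norm_smul, Real.norm_of_nonneg hτ0.le]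
    have h2 := norm_add_le (gradient q z) (gradient ρ z - G)
    have h3 := (hball z hzball).1
    have h4 : ‖gradient q z + (gradient ρ z - G)‖ ≤ 2 * κ := by linarith
    calc τ * ‖gradient q z + (gradient ρ z - G)‖ ≤ τ * (2 * κ) := by gcongr
      _ = 2 * κ * τ := by ring
  · have h1 : F (q x) ≤ τ := by
      have : 0 ≤ C₁ / α * q x ^ α := by
        have : 0 < q x := ht0.trans htx
        positivity
      simp only [F]
      linarith
    have h2 : -F (q z) ≤ C₁ / α * (C₄ * τ) ^ α := by
      have h3 : q z ^ α ≤ (C₄ * τ) ^ α :=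
        Real.rpow_le_rpow hqz.le (hqC z hzK hqz.le) hα0.le
      have h4 : C₁ / α * q z ^ α ≤ C₁ / α * (C₄ * τ) ^ α := by gcongr
      have h5 : δ * Real.log (q z) ≤ 0 :=
        mul_nonpos_of_nonneg_of_nonpos hδ0.le (Real.log_nonpos hqz.le hq1)
      simp only [F]
      linarith
    linarith

end InnerShift

section Comparison

variable {N : ℕ}

theorem uscExtStat_of_mem {Ω : Set (Euc N)} (u : Euc N → ℝ) {x : Euc N} (hx : x ∈ Ω) :
    uscExtStat Ω u x = u x := if_pos hx

theorem eventually_lt_of_uscExtStat_lt {Ω : Set (Euc N)} {u : Euc N → ℝ}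
    (hu : UpperSemicontinuousOn u (closure Ω)) {B : ℝ} (hB : ∀ x ∈ closure Ω, |u x| ≤ B)
    {x : Euc N} {c : ℝ} (hc : uscExtStat Ω u x < c) : ∀ᶠ y in 𝓝[Ω] x, u y < c := by
  by_cases hx : x ∈ Ω
  · rw [uscExtStat_of_mem u hx] at hc
    exact (hu x (subset_closure hx) c hc).filter_mono (nhdsWithin_mono _ subset_closure)
  · rw [uscExtStat, if_neg hx] at hc
    refine eventually_lt_of_limsup_lt hc (isBoundedUnder_of_eventually_le (a := B) ?_)
    filter_upwards [self_mem_nhdsWithin] with y hy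
    exact (abs_le.1 (hB y (subset_closure hy))).2

theorem frequently_lt_of_lt_uscExtStat {Ω : Set (Euc N)} {u : Euc N → ℝ} {B : ℝ}
    (hB : ∀ x ∈ closure Ω, |u x| ≤ B) {x : Euc N} (hx : x ∈ closure Ω) {c : ℝ}
    (hc : c < uscExtStat Ω u x) : ∃ᶠ y in 𝓝[Ω] x, c < u y := by
  by_cases hxΩ : x ∈ Ω
  · rw [uscExtStat_of_mem u hxΩ] at hc
    exact fun h => (h.self_of_nhdsWithin hxΩ) hc
  · rw [uscExtStat, if_neg hxΩ] at hc
    have : (𝓝[Ω] x).NeBot := mem_closure_iff_nhdsWithin_neBot.1 hx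
    refine frequently_lt_of_lt_limsup (IsBoundedUnder.isCoboundedUnder_le
      (isBoundedUnder_of_eventually_ge (a := -B) ?_)) hc
    filter_upwards [self_mem_nhdsWithin] with y hy
    exact (abs_le.1 (hB y (subset_closure hy))).1

theorem upperSemicontinuousOn_uscExtStat {Ω : Set (Euc N)} {u : Euc N → ℝ}
    (hu : UpperSemicontinuousOn u (closure Ω)) {B : ℝ} (hB : ∀ x ∈ closure Ω, |u x| ≤ B) :
    UpperSemicontinuousOn (uscExtStat Ω u) (closure Ω) := by
  intro x hx c hc
  obtain ⟨c', hc', hc'c⟩ := exists_between hc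
  have h1 := _root_.eventually_nhds_iff.1
    (eventually_nhdsWithin_iff.1 (eventually_lt_of_uscExtStat_lt hu hB hc'))
  obtain ⟨O, hO, hOo, hxO⟩ := h1
  filter_upwards [self_mem_nhdsWithin, mem_nhdsWithin_of_mem_nhds (hOo.mem_nhds hxO)] with y hy hyO
  by_contra! hcy
  have h2 := frequently_lt_of_lt_uscExtStat hB hy (hc'c.trans_le hcy)
  obtain ⟨z, hz, hzΩ, hzO⟩ := (h2.and_eventually
    ((eventually_mem_set.2 self_mem_nhdsWithin).and
      (eventually_mem_set.2 (mem_nhdsWithin_of_mem_nhds (hOo.mem_nhds hyO))))).exists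
  exact (hO z hzO hzΩ).not_gt hz

theorem abs_uscExtStat_le {Ω : Set (Euc N)} {u : Euc N → ℝ}
    (hu : UpperSemicontinuousOn u (closure Ω)) {B : ℝ} (hB : ∀ x ∈ closure Ω, |u x| ≤ B)
    {x : Euc N} (hx : x ∈ closure Ω) : |uscExtStat Ω u x| ≤ B := by
  have : (𝓝[Ω] x).NeBot := mem_closure_iff_nhdsWithin_neBot.1 hx
  refine abs_le.2 ⟨?_, ?_⟩ <;> by_contra! hlt
  · obtain ⟨y, hy, hyΩ⟩ := ((eventually_lt_of_uscExtStat_lt hu hB hlt).and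
      (eventually_mem_set.2 self_mem_nhdsWithin)).exists
    exact hy.not_ge (abs_le.1 (hB y (subset_closure hyΩ))).1
  · obtain ⟨y, hy, hyΩ⟩ := ((frequently_lt_of_lt_uscExtStat hB hx hlt).and_eventually
      (eventually_mem_set.2 self_mem_nhdsWithin)).exists
    exact hy.not_ge (abs_le.1 (hB y (subset_closure hyΩ))).2

theorem uscExtStat_le {Ω : Set (Euc N)} {u : Euc N → ℝ}
    (hu : UpperSemicontinuousOn u (closure Ω)) {B : ℝ} (hB : ∀ x ∈ closure Ω, |u x| ≤ B)
    {x : Euc N} (hx : x ∈ closure Ω) : uscExtStat Ω u x ≤ u x := by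
  by_contra! hlt
  obtain ⟨c, hc, hc'⟩ := exists_between hlt
  obtain ⟨y, hy, hy'⟩ := ((frequently_lt_of_lt_uscExtStat hB hx hc').and_eventually
    ((hu x hx c hc).filter_mono (nhdsWithin_mono _ subset_closure))).exists
  exact hy.not_gt hy'

theorem IsStatSub.uscExtStat {Ω : Set (Euc N)} (hΩo : IsOpen Ω) {h k : Euc N → ℝ} {lam m : ℝ}
    {u : Euc N → ℝ} (hu : IsStatSub Ω h k lam m u) {B : ℝ} (hB : ∀ x ∈ closure Ω, |u x| ≤ B)
    (hbd : ∀ x ∈ frontier Ω, u x ≤ k x) : IsStatSub Ω h k lam m (uscExtStat Ω u) := by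
  refine ⟨upperSemicontinuousOn_uscExtStat hu.1 hB, fun φ hφ x hx hmax => ⟨fun hxΩ => ?_,
    fun hxf => ?_⟩⟩
  · rw [uscExtStat_of_mem u hxΩ]
    refine (hu.2 φ hφ x hx ?_).1 hxΩ
    filter_upwards [hmax, mem_nhdsWithin_of_mem_nhds (hΩo.mem_nhds hxΩ)] with y hy hyΩ
    simpa only [Pi.sub_apply, uscExtStat_of_mem u hxΩ, uscExtStat_of_mem u hyΩ] using hy
  · exact (min_le_right _ _).trans
      (sub_nonpos.2 ((uscExtStat_le hu.1 hB hx).trans (hbd x hxf)))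

theorem exists_norm_rpow_near {m : ℝ} (hm : 0 < m) (p : Euc N) {γ : ℝ} (hγ : 0 < γ) :
    ∃ r > 0, ∀ q : Euc N, ‖q - p‖ < r → |‖q‖ ^ m - ‖p‖ ^ m| < γ := by
  have h1 : Continuous fun q : Euc N => ‖q‖ ^ m :=
    continuous_norm.rpow_const fun _ => Or.inr hm.le
  obtain ⟨r, hr, h2⟩ := Metric.continuous_iff.1 h1 p γ hγ
  exact ⟨r, hr, fun q hq => h2 q (by rwa [dist_eq_norm])⟩

/-- Near `x₀`, subsolutions satisfy the equation frozen at `x₀` up to an error `γ`. -/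
theorem IsStatSub.exists_localSub {Ω : Set (Euc N)} (hΩo : IsOpen Ω) {h k : Euc N → ℝ}
    {lam m : ℝ} (hm : 0 < m) (hh : ContinuousOn h (closure Ω)) {u : Euc N → ℝ}
    (hu : IsStatSub Ω h k lam m u) {x₀ : Euc N} (hx₀ : x₀ ∈ closure Ω) {γ : ℝ} (hγ : 0 < γ) :
    ∃ κ > 0, ∀ y ∈ Ω, ‖y - x₀‖ ≤ κ → |u y - u x₀| ≤ κ → ∀ p : Euc N,
      LocalSub (closure Ω) u y p (h x₀ - lam * u x₀ - ‖p‖ ^ m + γ) := by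
  obtain ⟨d, hd, hhd⟩ := Metric.continuousOn_iff.1 hh x₀ hx₀ (γ / 3) (by positivity)
  have hlam : 0 < |lam| + 1 := by positivity
  refine ⟨min (d / 2) (γ / (6 * (|lam| + 1))), by positivity, fun y hy hyx huy p => ?_⟩
  set κ := min (d / 2) (γ / (6 * (|lam| + 1))) with hκ
  have hκ0 : 0 < κ := by positivity
  have hκd : κ ≤ d / 2 := min_le_left _ _
  have hκl : (|lam| + 1) * κ ≤ γ / 6 := by
    have : κ * (6 * (|lam| + 1)) ≤ γ := by
      rw [← le_div_iff₀ (by positivity)]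
      exact min_le_right _ _
    linarith
  obtain ⟨r₁, hr₁, hr₁'⟩ := exists_norm_rpow_near hm p (γ := γ / 3) (by positivity)
  obtain ⟨r₂, hr₂, hr₂'⟩ := Metric.isOpen_iff.1 hΩo y hy
  refine ⟨min κ (min r₁ r₂), by positivity, fun ψ hψ z hz hzy huz hg hmax => ?_⟩
  obtain ⟨hzκ, hz1⟩ := lt_min_iff.1 hzy
  have hz2 := (lt_min_iff.1 hz1).2
  have huκ := (lt_min_iff.1 huz).1
  have hg1 := (lt_min_iff.1 (lt_min_iff.1 hg).2).1
  have hzΩ : z ∈ Ω := hr₂' (by rwa [mem_ball, dist_eq_norm])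
  have hop := (hu.2 ψ hψ z hz hmax).1 hzΩ
  rw [statOp] at hop
  have h1 := (abs_lt.1 (hr₁' _ hg1)).1
  have h2 : dist (h z) (h x₀) < γ / 3 := hhd z hz (by
    rw [dist_eq_norm]
    have := norm_sub_le_norm_sub_add_norm_sub z y x₀
    linarith)
  rw [Real.dist_eq] at h2
  have h3 : |lam * (u z - u x₀)| ≤ γ / 3 := by
    rw [abs_mul]
    have h4 : |u z - u x₀| ≤ 2 * κ := by
      have := abs_sub_le (u z) (u y) (u x₀)
      linarith
    nlinarith [mul_le_mul_of_nonneg_left h4 (abs_nonneg lam)]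
  have h5 := (abs_lt.1 h2).2
  have h6 := (abs_le.1 h3).1
  linarith

/-- Near a point where the boundary condition is not attained from above, supersolutions satisfy
the equation frozen at `x₀` up to an error `γ`. -/
theorem IsStatSuper.exists_localSub {Ω : Set (Euc N)} (hΩo : IsOpen Ω) {h k : Euc N → ℝ}
    {lam m : ℝ} (hm : 0 < m) (hh : ContinuousOn h (closure Ω))
    (hk : ContinuousOn k (frontier Ω)) {v : Euc N → ℝ}
    (hv : IsStatSuper Ω h k lam m v) {x₀ : Euc N} (hx₀ : x₀ ∈ closure Ω)
    (hvk : x₀ ∈ frontier Ω → v x₀ < k x₀) {γ : ℝ} (hγ : 0 < γ) :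
    ∃ κ > 0, ∀ y ∈ closure Ω, ‖y - x₀‖ ≤ κ → |-v y - -v x₀| ≤ κ → ∀ p : Euc N,
      LocalSub (closure Ω) (fun x => -v x) y p (-h x₀ + lam * v x₀ + ‖p‖ ^ m + γ) := by
  obtain ⟨b, hb, hbk⟩ : ∃ b > 0, ∀ z ∈ frontier Ω, ‖z - x₀‖ < b → |v z - v x₀| < b →
      v z < k z := by
    by_cases hxf : x₀ ∈ frontier Ω
    · have hgap := sub_pos.2 (hvk hxf)
      obtain ⟨b, hb, hb'⟩ := Metric.continuousOn_iff.1 hk x₀ hxf ((k x₀ - v x₀) / 2)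
        (by linarith)
      refine ⟨min b ((k x₀ - v x₀) / 2), lt_min hb (by linarith), fun z hz hzx hvz => ?_⟩
      have h1 := hb' z hz (by rw [dist_eq_norm]; exact (lt_min_iff.1 hzx).1)
      rw [Real.dist_eq] at h1
      have h2 := (abs_lt.1 h1).1
      have h3 := (abs_lt.1 (lt_min_iff.1 hvz).2).2
      linarith
    · have hxΩ : x₀ ∈ Ω := by
        by_contra hn
        exact hxf (by rw [hΩo.frontier_eq]; exact ⟨hx₀, hn⟩)
      obtain ⟨b, hb, hb'⟩ := Metric.isOpen_iff.1 hΩo x₀ hxΩ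
      refine ⟨b, hb, fun z hz hzx _ => ?_⟩
      rw [hΩo.frontier_eq] at hz
      exact absurd (hb' (by rwa [mem_ball, dist_eq_norm])) hz.2
  obtain ⟨d, hd, hhd⟩ := Metric.continuousOn_iff.1 hh x₀ hx₀ (γ / 3) (by positivity)
  have hlam : 0 < |lam| + 1 := by positivity
  refine ⟨min (b / 2) (min (d / 2) (γ / (6 * (|lam| + 1)))), by positivity,
    fun y hy hyx hvy p => ?_⟩
  set κ := min (b / 2) (min (d / 2) (γ / (6 * (|lam| + 1)))) with hκ
  have hκ0 : 0 < κ := by positivity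
  have hκb : κ ≤ b / 2 := min_le_left _ _
  have hκd : κ ≤ d / 2 := (min_le_right _ _).trans (min_le_left _ _)
  have hκl : (|lam| + 1) * κ ≤ γ / 6 := by
    have : κ * (6 * (|lam| + 1)) ≤ γ := by
      rw [← le_div_iff₀ (by positivity)]
      exact (min_le_right _ _).trans (min_le_right _ _)
    linarith
  obtain ⟨r, hr, hr'⟩ := exists_norm_rpow_near hm p (γ := γ / 3) (by positivity)
  refine ⟨min κ r, by positivity, fun ψ hψ z hz hzy hvz hg hmax => ?_⟩
  have hzκ := (lt_min_iff.1 hzy).1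
  have hvκ := (lt_min_iff.1 hvz).1
  have hg1 := (lt_min_iff.1 hg).2
  have hzx : ‖z - x₀‖ < 2 * κ := by
    have := norm_sub_le_norm_sub_add_norm_sub z y x₀
    linarith
  have hvzx : |v z - v x₀| < 2 * κ := by
    have h1 := abs_sub_le (-v z) (-v y) (-v x₀)
    have h2 : |v z - v x₀| = |-v z - -v x₀| := by rw [← abs_neg]; congr 1; ring
    linarith
  have htest := hv.2 (fun x => -ψ x) hψ.neg z hz (by
    filter_upwards [hmax] with y hy
    simp only [Pi.sub_apply]
    linarith)
  have hop : 0 ≤ statOp h lam m (fun x => -ψ x) (v z) z := by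
    by_cases hzΩ : z ∈ Ω
    · exact htest.1 hzΩ
    · have hzf : z ∈ frontier Ω := by rw [hΩo.frontier_eq]; exact ⟨hz, hzΩ⟩
      have hlt := hbk z hzf (by linarith) (by linarith)
      rcases le_max_iff.1 (htest.2 hzf) with h1 | h1
      · exact h1
      · linarith
  rw [statOp, lapl_neg, hψ.contDiffAt.hasGradientAt'.neg'.gradient, norm_neg] at hop
  have h1 := (abs_lt.1 (hr' _ hg1)).2
  have h2 : dist (h z) (h x₀) < γ / 3 := hhd z hz (by rw [dist_eq_norm]; linarith)
  rw [Real.dist_eq] at h2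
  have h3 : |lam * (v z - v x₀)| ≤ γ / 3 := by
    rw [abs_mul]
    nlinarith [mul_le_mul_of_nonneg_left hvzx.le (abs_nonneg lam)]
  have h5 := (abs_lt.1 h2).1
  have h6 := (abs_le.1 h3).2
  linarith

/-- Ishii's lemma at a maximum point of a weighted sum, for shifted doublings: the sets `S i` are
those where the `i`-th function can be tested. -/
theorem exists_slopes_of_isMax (hN : 1 ≤ N) {ι : Type*} [Fintype ι] [Nonempty ι]
    {K : Set (Euc N)} (hK : IsCompact K) {f : ι → Euc N → ℝ}
    (hf : ∀ i, UpperSemicontinuousOn (f i) K) {B : ℝ} (hB : ∀ i, ∀ x ∈ K, |f i x| ≤ B)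
    {c : ι → ℝ} (hc : ∀ i, 0 < c i) {x₀ : Euc N} (hx₀ : x₀ ∈ K)
    (hmax : ∀ x ∈ K, ∑ i, c i * f i x ≤ ∑ i, c i * f i x₀) {θ : ℝ} (hθ : 0 < θ)
    {A : ι → Euc N → ℝ} {S : ι → Set (Euc N)}
    (hloc : ∀ i, ∃ κ > 0, ∀ y ∈ S i, ‖y - x₀‖ ≤ κ → |f i y - f i x₀| ≤ κ → ∀ p,
      LocalSub K (f i) y p (A i p))
    {κ₀ : ℝ} (hκ₀ : 0 < κ₀)
    (hshift : ∀ κ > 0, ∃ s : ι → Euc N, (∀ i, ‖s i‖ ≤ κ) ∧ (∀ i, x₀ + s i ∈ K) ∧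
      (∀ i, f i x₀ - κ ≤ f i (x₀ + s i)) ∧ ∃ ν > 0, ∀ (x : Euc N) (y : ι → Euc N),
        ‖x - x₀‖ ≤ κ₀ → (∀ i, y i ∈ K) → (∀ i, ‖y i - x - s i‖ ≤ ν) → ∀ i, y i ∈ S i)
    {κ : ℝ} (hκ : 0 < κ) :
    ∃ (p : ι → Euc N) (d : Euc N), ‖d‖ ≤ κ ∧ ∑ i, c i • p i = (2 * θ) • d ∧
      -(2 * N * θ) ≤ ∑ i, c i * A i (p i) := by
  choose κl hκl hκl' using hloc
  obtain ⟨κm, hκm, hκm'⟩ : ∃ κm > 0, ∀ i, κm ≤ κl i := by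
    obtain ⟨i, -, hi⟩ := Finset.exists_min_image Finset.univ κl Finset.univ_nonempty
    exact ⟨κl i, hκl i, fun j => hi j (Finset.mem_univ j)⟩
  set κ₁ := min κ (min κ₀ (κm / 3)) with hκ₁
  have hκ₁0 : 0 < κ₁ := by positivity
  have hκ₁a : κ₁ ≤ κ := min_le_left _ _
  have hκ₁b : κ₁ ≤ κ₀ := (min_le_right _ _).trans (min_le_left _ _)
  have hκ₁c : κ₁ ≤ κm / 3 := (min_le_right _ _).trans (min_le_right _ _)
  obtain ⟨κ', hκ', hdouble⟩ := exists_doubling_points hK hf hB hc hx₀ hmax hθ hκ₁0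
  obtain ⟨s, hs1, hs2, hs3, ν, hν, hsν⟩ := hshift (min κ' κ₁) (by positivity)
  obtain ⟨a, ha, x₁, y₁, hyK, hymax, hyν, hx₁, hfy⟩ := hdouble s
    (fun i => (hs1 i).trans (min_le_left _ _)) hs2
    (fun i => by have := hs3 i; have := min_le_left κ' κ₁; linarith) (min ν κ₁) (by positivity)
  have hyS := hsν x₁ y₁ (hx₁.trans hκ₁b) hyK fun i => (hyν i).trans (min_le_left _ _)
  have hyx : ∀ i, ‖y₁ i - x₀‖ ≤ κl i := fun i => by
    have h1 : y₁ i - x₀ = (y₁ i - x₁ - s i) + (x₁ - x₀) + s i := by abel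
    have h2 := norm_add₃_le (a := y₁ i - x₁ - s i) (b := x₁ - x₀) (c := s i)
    rw [← h1] at h2
    have h3 := (hyν i).trans (min_le_right _ _)
    have h4 := (hs1 i).trans (min_le_right _ _)
    have h5 := hκm' i
    linarith
  have hφ : ContDiff ℝ 2 fun x => -(θ * ‖x - x₀‖ ^ 2) :=
    (contDiff_const.mul (contDiff_norm_sub_sq x₀)).neg
  obtain ⟨hg, hl⟩ := lapl_le_of_isMax_sum_penal hN hK hf hc ha hφ hyK hymax
    (A := fun i => A i ((2 * a) • (y₁ i - x₁ - s i)))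
  refine ⟨fun i => (2 * a) • (y₁ i - x₁ - s i), x₁ - x₀, hx₁.trans hκ₁a, ?_, ?_⟩
  · rw [((hasGradientAt_norm_sub_sq x₀ x₁).const_mul' θ).neg'.gradient] at hg
    rw [eq_neg_of_add_eq_zero_left hg, neg_neg, smul_smul, mul_comm]
  · have h1 := hl fun i => hκl' i (y₁ i) (hyS i) (hyx i)
      ((hfy i).trans (by have := hκm' i; linarith)) _
    rw [lapl_neg, lapl_const_mul θ (contDiff_norm_sub_sq x₀).contDiffAt,
      lapl_norm_sub_sq] at h1
    linarith

theorem exists_inner_cone {ρ : Euc N → ℝ} (hρ : ContDiff ℝ 2 ρ) {x₀ : Euc N}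
    (hG : gradient ρ x₀ ≠ 0) :
    ∃ κ > 0, ∀ y w : Euc N, ∀ τ > 0, ‖y - x₀‖ ≤ κ → ‖w‖ ≤ κ → ρ y ≤ 0 →
      ‖w + τ • gradient ρ x₀‖ ≤ ‖gradient ρ x₀‖ / 4 * τ → ρ (y + w) < 0 := by
  set G := gradient ρ x₀ with hGdef
  have hG0 : 0 < ‖G‖ := norm_pos_iff.2 hG
  have hstrict := hρ.contDiffAt.hasStrictFDerivAt (x := x₀) (by norm_num)
  have hlo := hstrict.isLittleO.def (c := ‖G‖ / 8) (by positivity)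
  obtain ⟨κ, hκ, hball⟩ := Metric.eventually_nhds_iff.1 hlo
  refine ⟨κ / 3, by positivity, fun y w τ hτ hy hw hρy hwG => ?_⟩
  have h1 := @hball (y + w, y) (by
    rw [Prod.dist_eq, dist_eq_norm, dist_eq_norm]
    refine max_lt ?_ (by linarith)
    have : y + w - x₀ = (y - x₀) + w := by abel
    show ‖y + w - x₀‖ < κ
    rw [this]
    have := norm_add_le (y - x₀) w
    linarith)
  simp only [add_sub_cancel_left, Real.norm_eq_abs] at h1
  have h2 : fderiv ℝ ρ x₀ w = inner ℝ G w := by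
    rw [hGdef, gradient, InnerProductSpace.toDual_symm_apply]
  rw [h2] at h1
  have h3 : inner ℝ G w = -(τ * ‖G‖ ^ 2) + inner ℝ G (w + τ • G) := by
    rw [inner_add_right, inner_smul_right, real_inner_self_eq_norm_sq]
    ring
  have h4 : inner ℝ G (w + τ • G) ≤ ‖G‖ * (‖G‖ / 4 * τ) :=
    (real_inner_le_norm _ _).trans (by gcongr)
  have h5 : ‖w‖ ≤ 5 / 4 * (‖G‖ * τ) := by
    have h6 : w = (w + τ • G) - τ • G := by abel
    have h7 := norm_sub_le (w + τ • G) (τ • G)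
    rw [← h6, norm_smul, Real.norm_of_nonneg hτ.le] at h7
    linarith
  have h8 : ‖G‖ / 8 * ‖w‖ ≤ ‖G‖ / 8 * (5 / 4 * (‖G‖ * τ)) := by gcongr
  have h9 := (abs_le.1 h1).2
  have h10 : 0 < τ * ‖G‖ ^ 2 := by positivity
  nlinarith

theorem IsStatSub.eventually_exists_inner_shift_of_frequently {Ω : Set (Euc N)} {ρ : Euc N → ℝ}
    (hρ : ContDiff ℝ 2 ρ) (hΩ : Ω = {x | ρ x < 0}) (hcl : closure Ω = {x | ρ x ≤ 0})
    (hK : IsCompact (closure Ω)) {h k : Euc N → ℝ} {lam m : ℝ} (hm : 2 < m) {H : ℝ}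
    (hH : ∀ x ∈ closure Ω, |h x| ≤ H) {u : Euc N → ℝ} (hu : IsStatSub Ω h k lam m u) {B : ℝ}
    (hB : ∀ x ∈ closure Ω, |u x| ≤ B) {x₀ : Euc N} (hx₀ : ρ x₀ = 0)
    (hfreq : ∀ c < u x₀, ∃ᶠ y in 𝓝[Ω] x₀, c < u y) {κ e : ℝ} (hκ : 0 < κ) (he : 0 < e) :
    ∀ᶠ τ in 𝓝[>] (0 : ℝ), ∃ z ∈ Ω, ‖z - x₀ + τ • gradient ρ x₀‖ ≤ 3 * κ * τ ∧
      u x₀ - 2 * e ≤ u z := by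
  filter_upwards [hu.eventually_exists_inner_shift hρ hΩ hcl hK hm hH hB hx₀ hκ he,
    self_mem_nhdsWithin] with τ hτ hτ0
  have hτ0' : 0 < τ := hτ0
  have hκτ : 0 < κ * τ := by positivity
  obtain ⟨x, hx, hxb, hxΩ⟩ := ((hfreq (u x₀ - e) (by linarith)).and_eventually
    ((eventually_mem_set.2 (mem_nhdsWithin_of_mem_nhds (ball_mem_nhds x₀ hκτ))).and
      (eventually_mem_set.2 self_mem_nhdsWithin))).exists
  rw [mem_ball, dist_eq_norm] at hxb
  obtain ⟨z, hz, hzx, huz⟩ := hτ x hxΩ hxb.le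
  refine ⟨z, hz, ?_, by linarith⟩
  have h1 : z - x₀ + τ • gradient ρ x₀ = (z - x + τ • gradient ρ x₀) + (x - x₀) := by abel
  rw [h1]
  have := norm_add_le (z - x + τ • gradient ρ x₀) (x - x₀)
  linarith

theorem exists_shifts_of_mem {Ω : Set (Euc N)} (hΩo : IsOpen Ω) {ι : Type*}
    (f : ι → Euc N → ℝ) {x₀ : Euc N} (hx₀ : x₀ ∈ Ω) :
    ∃ κ₀ > 0, ∀ κ > 0, ∃ s : ι → Euc N, (∀ i, ‖s i‖ ≤ κ) ∧ (∀ i, x₀ + s i ∈ closure Ω) ∧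
      (∀ i, f i x₀ - κ ≤ f i (x₀ + s i)) ∧ ∃ ν > 0, ∀ (x : Euc N) (y : ι → Euc N),
        ‖x - x₀‖ ≤ κ₀ → (∀ i, y i ∈ closure Ω) → (∀ i, ‖y i - x - s i‖ ≤ ν) → ∀ i, y i ∈ Ω := by
  obtain ⟨r, hr, hball⟩ := Metric.isOpen_iff.1 hΩo x₀ hx₀
  refine ⟨r / 3, by positivity, fun κ hκ => ⟨fun _ => 0, fun _ => by simpa using hκ.le,
    fun _ => by simpa using subset_closure hx₀, fun _ => by simpa using hκ.le, r / 3,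
    by positivity, fun x y hx _ hy i => hball ?_⟩⟩
  have h1 := hy i
  rw [sub_zero] at h1
  rw [mem_ball, dist_eq_norm]
  have := norm_sub_le_norm_sub_add_norm_sub (y i) x x₀
  linarith

theorem exists_shifts_of_boundary {Ω : Set (Euc N)} {ρ : Euc N → ℝ}
    (hρ : ContDiff ℝ 2 ρ) (hΩ : Ω = {x | ρ x < 0}) (hcl : closure Ω = {x | ρ x ≤ 0})
    {x₀ : Euc N} (hx₀ : ρ x₀ = 0) (hG : gradient ρ x₀ ≠ 0) {u w g : Euc N → ℝ}
    (hu : ∀ κ > 0, ∀ e > 0, ∀ᶠ τ in 𝓝[>] (0 : ℝ), ∃ z ∈ Ω,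
      ‖z - x₀ + τ • gradient ρ x₀‖ ≤ 3 * κ * τ ∧ u x₀ - 2 * e ≤ u z)
    (hw : ∀ κ > 0, ∀ e > 0, ∀ᶠ τ in 𝓝[>] (0 : ℝ), ∃ z ∈ Ω,
      ‖z - x₀ + τ • gradient ρ x₀‖ ≤ 3 * κ * τ ∧ w x₀ - 2 * e ≤ w z) :
    ∃ κ₀ > 0, ∀ κ > 0, ∃ s : Fin 3 → Euc N, (∀ i, ‖s i‖ ≤ κ) ∧
      (∀ i, x₀ + s i ∈ closure Ω) ∧
      (∀ i, (![u, w, g] : Fin 3 → Euc N → ℝ) i x₀ - κ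
        ≤ (![u, w, g] : Fin 3 → Euc N → ℝ) i (x₀ + s i)) ∧
      ∃ ν > 0, ∀ (x : Euc N) (y : Fin 3 → Euc N), ‖x - x₀‖ ≤ κ₀ →
        (∀ i, y i ∈ closure Ω) → (∀ i, ‖y i - x - s i‖ ≤ ν) →
        ∀ i, y i ∈ (![Ω, Ω, closure Ω] : Fin 3 → Set (Euc N)) i := by
  obtain ⟨κc, hκc, hcone⟩ := exists_inner_cone hρ hG
  set G := gradient ρ x₀ with hGdef
  have hG0 : 0 < ‖G‖ := norm_pos_iff.2 hG
  refine ⟨κc / 4, by positivity, fun κ hκ => ?_⟩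
  have hsmall : ∀ᶠ τ in 𝓝[>] (0 : ℝ), 2 * ‖G‖ * τ < min κ (κc / 4) := by
    have h1 : Tendsto (fun τ : ℝ => 2 * ‖G‖ * τ) (𝓝 0) (𝓝 (2 * ‖G‖ * 0)) :=
      (continuous_const.mul continuous_id).tendsto 0
    rw [mul_zero] at h1
    exact (h1.eventually (gt_mem_nhds (by positivity))).filter_mono nhdsWithin_le_nhds
  obtain ⟨τ, ⟨⟨⟨z₁, hz₁, hzG₁, hu₁⟩, z₂, hz₂, hzG₂, hw₂⟩, hτs⟩, hτ⟩ :=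
    (((hu (‖G‖ / 24) (by positivity) (κ / 2) (by positivity)).and
      (hw (‖G‖ / 24) (by positivity) (κ / 2) (by positivity))).and hsmall |>.and
      (eventually_mem_set.2 self_mem_nhdsWithin)).exists
  have hτ0 : 0 < τ := hτ
  obtain ⟨hτκ, hτc⟩ := lt_min_iff.1 hτs
  have hGτ : 0 < ‖G‖ * τ := by positivity
  have hnorm : ∀ z : Euc N, ‖z - x₀ + τ • G‖ ≤ 3 * (‖G‖ / 24) * τ →
      ‖z - x₀‖ ≤ 2 * ‖G‖ * τ := fun z hz => by
    have h1 : z - x₀ = (z - x₀ + τ • G) - τ • G := by abel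
    have h2 := norm_sub_le (z - x₀ + τ • G) (τ • G)
    rw [← h1, norm_smul, Real.norm_of_nonneg hτ0.le] at h2
    linarith
  have hx₀K : x₀ ∈ closure Ω := by rw [hcl]; exact hx₀.le
  refine ⟨![z₁ - x₀, z₂ - x₀, 0], ?_, ?_, ?_, min (κc / 4) (‖G‖ * τ / 16), by positivity, ?_⟩
  · intro i
    fin_cases i
    · exact (hnorm z₁ hzG₁).trans hτκ.le
    · exact (hnorm z₂ hzG₂).trans hτκ.le
    · show ‖(0 : Euc N)‖ ≤ κ
      simpa using hκ.le
  · intro i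
    fin_cases i
    · show x₀ + (z₁ - x₀) ∈ closure Ω
      rw [add_sub_cancel]
      exact subset_closure hz₁
    · show x₀ + (z₂ - x₀) ∈ closure Ω
      rw [add_sub_cancel]
      exact subset_closure hz₂
    · show x₀ + 0 ∈ closure Ω
      rwa [add_zero]
  · intro i
    fin_cases i
    · show u x₀ - κ ≤ u (x₀ + (z₁ - x₀))
      rw [add_sub_cancel]
      linarith
    · show w x₀ - κ ≤ w (x₀ + (z₂ - x₀))
      rw [add_sub_cancel]
      linarith
    · show g x₀ - κ ≤ g (x₀ + 0)
      rw [add_zero]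
      linarith
  · intro x y hx hyK hy
    have hy3 : ‖y 2 - x - 0‖ ≤ min (κc / 4) (‖G‖ * τ / 16) := hy 2
    have hkey : ∀ (z q : Euc N), ‖z - x₀ + τ • G‖ ≤ 3 * (‖G‖ / 24) * τ →
        ‖q - x - (z - x₀)‖ ≤ min (κc / 4) (‖G‖ * τ / 16) → q ∈ Ω := by
      intro z q hz hq
      obtain ⟨hq1, hq2⟩ := le_min_iff.1 hq
      obtain ⟨hy1, hy2⟩ := le_min_iff.1 hy3
      have e1 : q - y 2 = (z - x₀) + ((q - x - (z - x₀)) - (y 2 - x - 0)) := by abel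
      have e2 : q - y 2 + τ • G
          = (z - x₀ + τ • G) + ((q - x - (z - x₀)) - (y 2 - x - 0)) := by abel
      have n1 := norm_sub_le (q - x - (z - x₀)) (y 2 - x - 0)
      have n2 := norm_add_le (z - x₀) ((q - x - (z - x₀)) - (y 2 - x - 0))
      have n3 := norm_add_le (z - x₀ + τ • G) ((q - x - (z - x₀)) - (y 2 - x - 0))
      rw [← e1] at n2
      rw [← e2] at n3
      have n4 := hnorm z hz
      have n5 : ‖y 2 - x₀‖ ≤ κc := by
        have e3 : y 2 - x₀ = (y 2 - x - 0) + (x - x₀) := by abel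
        rw [e3]
        have := norm_add_le (y 2 - x - 0) (x - x₀)
        linarith
      have hρ2 : ρ (y 2) ≤ 0 := by
        have := hyK 2
        rw [hcl] at this
        exact this
      have := hcone (y 2) (q - y 2) τ hτ0 n5 (by linarith) hρ2 (by linarith)
      rw [add_sub_cancel] at this
      rw [hΩ]
      exact this
    intro i
    fin_cases i
    · exact hkey z₁ (y 0) hzG₁ (hy 0)
    · exact hkey z₂ (y 1) hzG₂ (hy 1)
    · exact hyK 2

theorem norm_rpow_le_of_eq_sub {m : ℝ} (hm : 0 < m) (hm1 : m ≤ 1) {p q d : Euc N}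
    (hpq : p + q = d) : ‖q‖ ^ m ≤ ‖p‖ ^ m + ‖d‖ ^ m := by
  have h1 : ‖q‖ ≤ ‖p‖ + ‖d‖ := by
    rw [eq_sub_of_add_eq' hpq, add_comm]
    exact norm_sub_le _ _
  exact (Real.rpow_le_rpow (norm_nonneg _) h1 hm.le).trans
    (Real.rpow_add_le_add_rpow (norm_nonneg _) (norm_nonneg _) hm.le hm1)

theorem norm_rpow_le_of_convex {m : ℝ} (hm : 1 ≤ m) {c₀ c₁ c₂ : ℝ} (h₀ : 0 ≤ c₀) (h₁ : 0 ≤ c₁)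
    (h₂ : 0 ≤ c₂) (hsum : c₁ + c₂ + c₀ = 1) {p₁ p₂ p₃ d : Euc N}
    (hp : c₁ • p₁ + c₂ • p₂ + p₃ = c₀ • d) :
    ‖p₃‖ ^ m ≤ c₁ * ‖p₁‖ ^ m + c₂ * ‖p₂‖ ^ m + c₀ * ‖d‖ ^ m := by
  have h3 : ‖p₃‖ ≤ c₁ * ‖p₁‖ + c₂ * ‖p₂‖ + c₀ * ‖d‖ := by
    have h4 : p₃ = c₀ • d - (c₁ • p₁ + c₂ • p₂) := eq_sub_of_add_eq' hp
    rw [h4]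
    refine (norm_sub_le _ _).trans ?_
    have h5 := norm_add_le (c₁ • p₁) (c₂ • p₂)
    simp only [norm_smul, Real.norm_of_nonneg h₀, Real.norm_of_nonneg h₁,
      Real.norm_of_nonneg h₂] at h5 ⊢
    linarith
  refine (Real.rpow_le_rpow (norm_nonneg _) h3 (by linarith)).trans ?_
  have h6 := Real.rpow_arith_mean_le_arith_mean_rpow Finset.univ ![c₁, c₂, c₀]
    ![‖p₁‖, ‖p₂‖, ‖d‖] (by intro i _; fin_cases i <;> assumption)
    (by simpa [Fin.sum_univ_three] using hsum)
    (by intro i _; fin_cases i <;> exact norm_nonneg _) hm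
  simpa [Fin.sum_univ_three] using h6

theorem IsStatSub.le_of_le_one (hN : 1 ≤ N) {Ω : Set (Euc N)} (hΩo : IsOpen Ω)
    (hK : IsCompact (closure Ω)) {h k : Euc N → ℝ} (hh : ContinuousOn h (closure Ω))
    (hk : ContinuousOn k (frontier Ω)) {lam m : ℝ} (hm : 0 < m) (hm1 : m ≤ 1) (hlam : 0 < lam)
    {u v : Euc N → ℝ} (hu : IsStatSub Ω h k lam m u) (hv : IsStatSuper Ω h k lam m v) {B : ℝ}
    (huB : ∀ x ∈ closure Ω, |u x| ≤ B) (hvB : ∀ x ∈ closure Ω, |v x| ≤ B)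
    (hbd : ∀ x ∈ frontier Ω, u x ≤ v x) : ∀ x ∈ closure Ω, u x ≤ v x := by
  intro xa hxa
  by_contra! hlt
  set f : Fin 2 → Euc N → ℝ := ![u, fun x => -v x] with hf
  have hfu : ∀ i, UpperSemicontinuousOn (f i) (closure Ω) := by
    intro i
    fin_cases i
    · exact hu.1
    · exact hv.1.neg
  have hfB : ∀ i, ∀ x ∈ closure Ω, |f i x| ≤ B := by
    intro i x hx
    fin_cases i
    · exact huB x hx
    · show |-v x| ≤ B
      rw [abs_neg]
      exact hvB x hx
  have hsum : ∀ x, ∑ i, (fun _ : Fin 2 => (1 : ℝ)) i * f i x = u x - v x := fun x => by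
    simp [hf, Fin.sum_univ_two, sub_eq_add_neg]
  obtain ⟨x₀, hx₀, hmax⟩ := UpperSemicontinuousOn.exists_isMaxOn ⟨xa, hxa⟩ hK
    (hu.1.add hv.1.neg)
  have hmax' : ∀ x ∈ closure Ω, u x - v x ≤ u x₀ - v x₀ := fun x hx => by
    have : u x + -v x ≤ u x₀ + -v x₀ := hmax hx
    linarith
  set M := u x₀ - v x₀ with hM
  have hM0 : 0 < M := by
    have := hmax' xa hxa
    linarith
  have hx₀Ω : x₀ ∈ Ω := by
    by_contra hn
    have := hbd x₀ (by rw [hΩo.frontier_eq]; exact ⟨hx₀, hn⟩)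
    linarith
  have hxf : x₀ ∈ frontier Ω → v x₀ < k x₀ := fun hf => by
    rw [hΩo.frontier_eq] at hf
    exact absurd hx₀Ω hf.2
  have hN0 : (0 : ℝ) < N := by exact_mod_cast hN
  have hlM : 0 < lam * M := by positivity
  obtain ⟨κ₀, hκ₀, hshift⟩ := exists_shifts_of_mem hΩo f hx₀Ω
  set θ := lam * M / (8 * N) with hθ
  have hθ0 : 0 < θ := by positivity
  obtain ⟨r, hr, hrm⟩ := exists_norm_rpow_near (N := N) hm 0 (γ := lam * M / 8) (by positivity)
  have hsub := hu.exists_localSub hΩo hm hh hx₀ (γ := lam * M / 8) (by positivity)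
  have hsup := hv.exists_localSub hΩo hm hh hk hx₀ hxf (γ := lam * M / 8) (by positivity)
  obtain ⟨p, d, hd, hpd, hle⟩ := exists_slopes_of_isMax hN hK hfu hfB
    (c := fun _ => 1) (fun _ => one_pos) hx₀ (fun x hx => by rw [hsum, hsum]; exact hmax' x hx)
    hθ0 (A := ![fun p => h x₀ - lam * u x₀ - ‖p‖ ^ m + lam * M / 8,
      fun p => -h x₀ + lam * v x₀ + ‖p‖ ^ m + lam * M / 8]) (S := fun _ => Ω)
    (by
      intro i
      fin_cases i
      · exact hsub
      · obtain ⟨κ, hκ, hκ'⟩ := hsup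
        exact ⟨κ, hκ, fun y hy => hκ' y (subset_closure hy)⟩)
    hκ₀ hshift (κ := r / (4 * θ)) (by positivity)
  simp only [Fin.sum_univ_two, Matrix.cons_val_zero, Matrix.cons_val_one, one_smul,
    one_mul] at hpd hle
  have h1 := norm_rpow_le_of_eq_sub hm hm1 hpd
  have h2 := hrm ((2 * θ) • d) (by
    rw [sub_zero, norm_smul, Real.norm_of_nonneg (by positivity)]
    have : ‖d‖ * (4 * θ) ≤ r := by rwa [← le_div_iff₀ (by positivity)]
    nlinarith)
  rw [norm_zero, Real.zero_rpow hm.ne', sub_zero] at h2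
  have h3 := (abs_lt.1 h2).2
  have h4 : 2 * N * θ = lam * M / 4 := by
    rw [hθ]
    field_simp
    norm_num
  have h5 : lam * M = lam * u x₀ - lam * v x₀ := by rw [hM]; ring
  linarith

theorem IsStatSub.le_of_strict_sub (hN : 1 ≤ N) {Ω : Set (Euc N)} (hΩo : IsOpen Ω)
    (hK : IsCompact (closure Ω)) {ρ : Euc N → ℝ} (hρ : ContDiff ℝ 2 ρ) (hΩ : Ω = {x | ρ x < 0})
    (hcl : closure Ω = {x | ρ x ≤ 0}) (hfr : frontier Ω = {x | ρ x = 0})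
    (hg : ∀ x ∈ frontier Ω, gradient ρ x ≠ 0) {h k : Euc N → ℝ}
    (hh : ContinuousOn h (closure Ω)) (hk : ContinuousOn k (frontier Ω)) {lam m η : ℝ}
    (hm : 1 < m) (hlam : 0 ≤ lam) (hη : 0 < η) {u v w : Euc N → ℝ}
    (hu : IsStatSub Ω h k lam m u) (hw : IsStatSub Ω (fun x => h x - η) k lam m w)
    (hv : IsStatSuper Ω h k lam m v) {B : ℝ}
    (huB : ∀ x ∈ closure Ω, |u x| ≤ B) (hwB : ∀ x ∈ closure Ω, |w x| ≤ B)
    (hvB : ∀ x ∈ closure Ω, |v x| ≤ B) (hhB : ∀ x ∈ closure Ω, |h x| ≤ B)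
    (hkB : ∀ x ∈ frontier Ω, |k x| ≤ B)
    (hufreq : ∀ x ∈ frontier Ω, ∀ c < u x, ∃ᶠ y in 𝓝[Ω] x, c < u y)
    (hwfreq : ∀ x ∈ frontier Ω, ∀ c < w x, ∃ᶠ y in 𝓝[Ω] x, c < w y) :
    ∀ x ∈ closure Ω, u x ≤ v x := by
  intro xa hxa
  by_contra! hlt
  have hm0 : 0 < m := by linarith
  have hhη : ∀ x ∈ closure Ω, |h x - η| ≤ B + η := fun x hx => by
    have := abs_le.1 (hhB x hx)
    exact abs_le.2 ⟨by linarith, by linarith⟩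
  have hhηc : ContinuousOn (fun x => h x - η) (closure Ω) := hh.sub continuousOn_const
  have huk := hu.le_boundary hρ hcl hfr hΩo hK hg hhB hk huB
  have hwk := hw.le_boundary hρ hcl hfr hΩo hK hg hhη hk hwB
  have hB0 : 0 ≤ B := (abs_nonneg _).trans (huB xa hxa)
  set a := u xa - v xa with ha
  have ha0 : 0 < a := by linarith
  set D : ℝ := 2 * N + 1 + B with hD
  have hD0 : 0 < D := by positivity
  set ε := min (1 / 4) (a / (8 * (B + 1))) with hε
  have hε0 : 0 < ε := by positivity
  have hε4 : ε ≤ 1 / 4 := min_le_left _ _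
  have hεB : ε * (8 * (B + 1)) ≤ a := by
    rw [← le_div_iff₀ (by positivity)]
    exact min_le_right _ _
  set δ := min 1 (η / (2 * D)) with hδ
  have hδ0 : 0 < δ := by positivity
  have hδ1 : δ ≤ 1 := min_le_left _ _
  have hδD : δ * (2 * D) ≤ η := by
    rw [← le_div_iff₀ (by positivity)]
    exact min_le_right _ _
  set c₀ := ε * δ with hc₀
  have hc₀0 : 0 < c₀ := by positivity
  have hc₀ε : c₀ ≤ ε := mul_le_of_le_one_right hε0.le hδ1
  set c₁ := 1 - ε - c₀ with hc₁
  have hc₁0 : 0 < c₁ := by linarith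
  set f : Fin 3 → Euc N → ℝ := ![u, w, fun x => -v x] with hf
  set c : Fin 3 → ℝ := ![c₁, ε, 1] with hc
  have hc0 : ∀ i, 0 < c i := by
    intro i
    fin_cases i
    exacts [hc₁0, hε0, one_pos]
  have hfu : ∀ i, UpperSemicontinuousOn (f i) (closure Ω) := by
    intro i
    fin_cases i
    exacts [hu.1, hw.1, hv.1.neg]
  have hfB : ∀ i, ∀ x ∈ closure Ω, |f i x| ≤ B := by
    intro i x hx
    fin_cases i
    · exact huB x hx
    · exact hwB x hx
    · show |-v x| ≤ B
      rw [abs_neg]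
      exact hvB x hx
  have hsum : ∀ x, ∑ i, c i * f i x = c₁ * u x + ε * w x - v x := fun x => by
    simp [hf, hc, Fin.sum_univ_three, sub_eq_add_neg]
  obtain ⟨x₀, hx₀, hmax⟩ : ∃ x₀ ∈ closure Ω, ∀ x ∈ closure Ω,
      ∑ i, c i * f i x ≤ ∑ i, c i * f i x₀ := by
    have husc : UpperSemicontinuousOn (fun x => ∑ i, c i * f i x) (closure Ω) :=
      upperSemicontinuousOn_sum fun i _ => by
        intro x hx y hy
        have h1 : f i x < y / c i := by
          rw [lt_div_iff₀ (hc0 i), mul_comm]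
          exact hy
        filter_upwards [hfu i x hx _ h1] with z hz
        rw [lt_div_iff₀ (hc0 i), mul_comm] at hz
        exact hz
    obtain ⟨x₀, hx₀, h1⟩ := UpperSemicontinuousOn.exists_isMaxOn ⟨xa, hxa⟩ hK husc
    exact ⟨x₀, hx₀, fun x hx => h1 hx⟩
  set M := c₁ * u x₀ + ε * w x₀ - v x₀ with hM
  have hMa : a / 2 ≤ M := by
    have h1 := hmax xa hxa
    rw [hsum, hsum] at h1
    have h2 := abs_le.1 (huB xa hxa)
    have h3 := abs_le.1 (hwB xa hxa)
    have h4 : ε * -B ≤ ε * w xa := by gcongr; exact h3.1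
    have h5 : (ε + c₀) * u xa ≤ (ε + c₀) * B := by gcongr; exact h2.2
    have h6 : (ε + c₀) * B ≤ 2 * ε * B := by gcongr; linarith
    have h7 : c₁ * u xa = u xa - (ε + c₀) * u xa := by rw [hc₁]; ring
    linarith
  have hvk : x₀ ∈ frontier Ω → v x₀ < k x₀ := by
    intro hx₀f
    by_contra! hkv
    have h1 : c₁ * u x₀ ≤ c₁ * k x₀ := by gcongr; exact huk x₀ hx₀f
    have h2 : ε * w x₀ ≤ ε * k x₀ := by gcongr; exact hwk x₀ hx₀f
    have h3 : c₀ * -B ≤ c₀ * k x₀ := by gcongr; exact (abs_le.1 (hkB x₀ hx₀f)).1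
    have h4 : c₀ * B ≤ ε * B := by gcongr
    have h5 : c₁ * k x₀ + ε * k x₀ = k x₀ - c₀ * k x₀ := by rw [hc₁]; ring
    linarith
  obtain ⟨κ₀, hκ₀, hshift⟩ : ∃ κ₀ > 0, ∀ κ > 0, ∃ s : Fin 3 → Euc N, (∀ i, ‖s i‖ ≤ κ) ∧
      (∀ i, x₀ + s i ∈ closure Ω) ∧ (∀ i, f i x₀ - κ ≤ f i (x₀ + s i)) ∧
      ∃ ν > 0, ∀ (x : Euc N) (y : Fin 3 → Euc N), ‖x - x₀‖ ≤ κ₀ →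
        (∀ i, y i ∈ closure Ω) → (∀ i, ‖y i - x - s i‖ ≤ ν) →
        ∀ i, y i ∈ (![Ω, Ω, closure Ω] : Fin 3 → Set (Euc N)) i := by
    by_cases hx₀Ω : x₀ ∈ Ω
    · obtain ⟨κ₀, hκ₀, h1⟩ := exists_shifts_of_mem hΩo f hx₀Ω
      refine ⟨κ₀, hκ₀, fun κ hκ => ?_⟩
      obtain ⟨s, hs1, hs2, hs3, ν, hν, hs4⟩ := h1 κ hκ
      refine ⟨s, hs1, hs2, hs3, ν, hν, fun x y hx hyK hy i => ?_⟩
      have hyi := hs4 x y hx hyK hy i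
      fin_cases i
      exacts [hyi, hyi, subset_closure hyi]
    · have hx₀f : x₀ ∈ frontier Ω := by rw [hΩo.frontier_eq]; exact ⟨hx₀, hx₀Ω⟩
      have hm2 : 2 < m := by
        by_contra! hm2
        have := hv.boundary_le hρ hcl hfr hΩo hK hg hm0 hm2 hhB hk hvB x₀ hx₀f
        exact this.not_gt (hvk hx₀f)
      have hρ0 : ρ x₀ = 0 := by
        have := hx₀f
        rw [hfr] at this
        exact this
      exact exists_shifts_of_boundary hρ hΩ hcl hρ0 (hg x₀ hx₀f)
        (fun κ hκ e he => hu.eventually_exists_inner_shift_of_frequently hρ hΩ hcl hK hm2 hhB huB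
          hρ0 (hufreq x₀ hx₀f) hκ he)
        (fun κ hκ e he => hw.eventually_exists_inner_shift_of_frequently hρ hΩ hcl hK hm2 hhη hwB
          hρ0 (hwfreq x₀ hx₀f) hκ he)
  have hγ : 0 < ε * η / 12 := by positivity
  obtain ⟨p, d, hd, hpd, hle⟩ := exists_slopes_of_isMax hN hK hfu hfB hc0 hx₀ hmax hc₀0
    (A := ![fun p => h x₀ - lam * u x₀ - ‖p‖ ^ m + ε * η / 12,
      fun p => h x₀ - η - lam * w x₀ - ‖p‖ ^ m + ε * η / 12,
      fun p => -h x₀ + lam * v x₀ + ‖p‖ ^ m + ε * η / 12])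
    (by
      intro i
      fin_cases i
      · exact hu.exists_localSub hΩo hm0 hh hx₀ hγ
      · exact hw.exists_localSub hΩo hm0 hhηc hx₀ hγ
      · exact hv.exists_localSub hΩo hm0 hh hk hx₀ hvk hγ)
    hκ₀ hshift (κ := 1 / 2) (by norm_num)
  have hpd' : c₁ • p 0 + ε • p 1 + p 2 = c₀ • (2 : ℝ) • d := by
    rw [smul_smul, mul_comm c₀, ← hpd, Fin.sum_univ_three]
    simp [hc]
  have hle' : -(2 * N * c₀) ≤ c₁ * (h x₀ - lam * u x₀ - ‖p 0‖ ^ m + ε * η / 12)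
      + ε * (h x₀ - η - lam * w x₀ - ‖p 1‖ ^ m + ε * η / 12)
      + (-h x₀ + lam * v x₀ + ‖p 2‖ ^ m + ε * η / 12) := by
    simpa [hc, Fin.sum_univ_three] using hle
  have hconv := norm_rpow_le_of_convex hm.le hc₀0.le hc₁0.le hε0.le (by rw [hc₁]; ring) hpd'
  have hd1 : ‖(2 : ℝ) • d‖ ^ m ≤ 1 := by
    refine Real.rpow_le_one (norm_nonneg _) ?_ hm0.le
    rw [norm_smul, Real.norm_of_nonneg (by norm_num)]
    linarith
  have h1 : c₀ * ‖(2 : ℝ) • d‖ ^ m ≤ c₀ * 1 := by gcongr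
  have h2 : c₀ * -B ≤ c₀ * h x₀ := by gcongr; exact (abs_le.1 (hhB x₀ hx₀)).1
  have h3 : 0 ≤ lam * M := mul_nonneg hlam (by linarith)
  have h4 : c₁ * (ε * η / 12) ≤ 1 * (ε * η / 12) := by gcongr; linarith
  have h5 : ε * (ε * η / 12) ≤ 1 * (ε * η / 12) := by gcongr; linarith
  have h6 : c₀ * (2 * D) ≤ ε * η := by
    rw [hc₀, mul_assoc]
    gcongr
  have h7 : 0 < ε * η := by positivity
  have h8 : c₁ * h x₀ + ε * h x₀ - h x₀ = -(c₀ * h x₀) := by rw [hc₁]; ring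
  have h9 : lam * M = c₁ * (lam * u x₀) + ε * (lam * w x₀) - lam * v x₀ := by rw [hM]; ring
  have h10 : c₀ * (2 * D) = 2 * (2 * N * c₀ + c₀ + c₀ * B) := by rw [hD]; ring
  linarith

theorem IsStatSub.mono_boundary {Ω : Set (Euc N)} {h k k' : Euc N → ℝ} {lam m : ℝ}
    {u : Euc N → ℝ} (hu : IsStatSub Ω h k lam m u) (hk : ∀ x ∈ frontier Ω, k x ≤ k' x) :
    IsStatSub Ω h k' lam m u := by
  refine ⟨hu.1, fun φ hφ x hx hmax => ⟨(hu.2 φ hφ x hx hmax).1, fun hxf => ?_⟩⟩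
  refine le_trans ?_ ((hu.2 φ hφ x hx hmax).2 hxf)
  exact min_le_min le_rfl (sub_le_sub_left (hk x hxf) _)

theorem IsStatSub.of_const {Ω : Set (Euc N)} (hΩo : IsOpen Ω) {h k : Euc N → ℝ}
    {lam m C : ℝ} (hm : 0 < m) (hC : ∀ x ∈ Ω, lam * C ≤ h x) (hk : ∀ x ∈ frontier Ω, C ≤ k x) :
    IsStatSub Ω h k lam m fun _ => C := by
  refine ⟨continuousOn_const.upperSemicontinuousOn, fun φ hφ x hx hmax => ⟨fun hxΩ => ?_,
    fun hxf => (min_le_right _ _).trans (sub_nonpos.2 (hk x hxf))⟩⟩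
  have hloc : IsLocalMax (fun y => C - φ y) x :=
    hmax.isLocalMax (mem_of_superset (hΩo.mem_nhds hxΩ) subset_closure)
  have hcd : ContDiffAt ℝ 2 (fun y => C - φ y) x := contDiffAt_const.sub hφ.contDiffAt
  have h1 := hloc.lapl_nonpos hcd
  rw [lapl_sub contDiffAt_const hφ.contDiffAt, lapl_const] at h1
  have h2 : gradient φ x = 0 := by
    have h3 : IsLocalMax (fun y => -φ y) x := by
      filter_upwards [hloc] with y hy
      linarith
    simpa using h3.hasGradientAt_eq_zero hφ.contDiffAt.hasGradientAt'.neg'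
  rw [statOp, h2, norm_zero, Real.zero_rpow hm.ne']
  have := hC x hxΩ
  linarith

end Comparison

/-- Comparison principle for the stationary generalized
Dirichlet problem, Theorem 2.8 of the paper. -/
theorem stmt3 {N : ℕ} (hN : 1 ≤ N) (Ω : Set (Euc N))
    (hΩo : IsOpen Ω) (hΩb : Bornology.IsBounded Ω) (hΩc : IsConnected Ω)
    (hΩ2 : HasC2Boundary Ω)
    (m lam : ℝ) (h k : Euc N → ℝ)
    (hh : ContinuousOn h (closure Ω)) (hk : ContinuousOn k (frontier Ω))
    (hAlt : (0 < m ∧ 0 < lam) ∨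
      (1 < m ∧ lam = 0 ∧ ∃ w : Euc N → ℝ,
        (∃ C : ℝ, ∀ x ∈ closure Ω, |w x| ≤ C) ∧
        ∃ η > (0 : ℝ), ∃ δ' > (0 : ℝ),
          IsStatSub Ω (fun x => h x - η) (fun x => k x - δ') 0 m w))
    (u v : Euc N → ℝ)
    (hu : IsStatSub Ω h k lam m u)
    (hub : ∃ C : ℝ, ∀ x ∈ closure Ω, |u x| ≤ C)
    (hv : IsStatSuper Ω h k lam m v)
    (hvb : ∃ C : ℝ, ∀ x ∈ closure Ω, |v x| ≤ C) :
    (∀ x ∈ Ω, u x ≤ v x) ∧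
    IsStatSub Ω h k lam m (uscExtStat Ω u) ∧
    (∃ C : ℝ, ∀ x ∈ closure Ω, |uscExtStat Ω u x| ≤ C) ∧
    (∀ x ∈ closure Ω, uscExtStat Ω u x ≤ v x) := by
  obtain ⟨ρ, hρ, hΩ, hfr, hg⟩ := hΩ2
  obtain ⟨Bu, hBu⟩ := hub
  obtain ⟨Bv, hBv⟩ := hvb
  have hK : IsCompact (closure Ω) := hΩb.isCompact_closure
  have hcl : closure Ω = {x | ρ x ≤ 0} := by
    rw [closure_eq_self_union_frontier, hfr]
    ext x
    rw [hΩ]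
    exact (le_iff_lt_or_eq (a := ρ x) (b := 0)).symm
  obtain ⟨H, hH⟩ := hK.exists_bound_of_continuousOn hh
  obtain ⟨Bk, hBk⟩ := (hK.of_isClosed_subset isClosed_frontier
    frontier_subset_closure).exists_bound_of_continuousOn hk
  simp only [Real.norm_eq_abs] at hH hBk
  have huk := hu.le_boundary hρ hcl hfr hΩo hK hg hH hk hBu
  have hut := hu.uscExtStat hΩo hBu huk
  have hutB : ∀ x ∈ closure Ω, |uscExtStat Ω u x| ≤ Bu := fun x hx =>
    abs_uscExtStat_le hu.1 hBu hx
  have hfreq : ∀ {w : Euc N → ℝ} {C : ℝ}, (∀ x ∈ closure Ω, |w x| ≤ C) → ∀ x ∈ frontier Ω,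
      ∀ c < uscExtStat Ω w x, ∃ᶠ y in 𝓝[Ω] x, c < uscExtStat Ω w y := by
    intro w C hwC x hx c hc
    refine ((frequently_lt_of_lt_uscExtStat hwC (frontier_subset_closure hx) hc).and_eventually
      (eventually_mem_set.2 self_mem_nhdsWithin)).mono fun y hy => ?_
    rw [uscExtStat_of_mem w hy.2]
    exact hy.1
  have hstrict : 1 < m → 0 ≤ lam → (∃ w : Euc N → ℝ, (∃ C : ℝ, ∀ x ∈ closure Ω, |w x| ≤ C) ∧
      ∃ η > (0 : ℝ), IsStatSub Ω (fun x => h x - η) k lam m w) →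
      ∀ x ∈ closure Ω, uscExtStat Ω u x ≤ v x := by
    rintro hm hlam ⟨w, ⟨C, hC⟩, η, hη, hw⟩
    have hHη : ∀ x ∈ closure Ω, |h x - η| ≤ H + η := fun x hx => by
      have := abs_le.1 (hH x hx)
      exact abs_le.2 ⟨by linarith, by linarith⟩
    have hwk := hw.le_boundary hρ hcl hfr hΩo hK hg hHη hk hC
    obtain ⟨B, hB1, hB2, hB3, hB4, hB5⟩ : ∃ B, Bu ≤ B ∧ C ≤ B ∧ Bv ≤ B ∧ H ≤ B ∧ Bk ≤ B :=
      ⟨max Bu (max C (max Bv (max H Bk))), by simp, by simp, by simp, by simp, by simp⟩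
    exact hut.le_of_strict_sub hN hΩo hK hρ hΩ hcl hfr hg hh hk hm hlam hη
      (hw.uscExtStat hΩo hC hwk) hv
      (fun x hx => (hutB x hx).trans hB1)
      (fun x hx => (abs_uscExtStat_le hw.1 hC hx).trans hB2)
      (fun x hx => (hBv x hx).trans hB3) (fun x hx => (hH x hx).trans hB4)
      (fun x hx => (hBk x hx).trans hB5) (hfreq hBu) (hfreq hC)
  have hcomp : ∀ x ∈ closure Ω, uscExtStat Ω u x ≤ v x := by
    rcases hAlt with ⟨hm, hlam⟩ | ⟨hm, hlam, w, hwb, η, hη, δ', hδ', hw⟩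
    · rcases le_or_gt m 1 with hm1 | hm1
      · have hvk := hv.boundary_le hρ hcl hfr hΩo hK hg hm (by linarith) hH hk hBv
        have hutk := hut.le_boundary hρ hcl hfr hΩo hK hg hH hk hutB
        exact hut.le_of_le_one hN hΩo hK hh hk hm hm1 hlam hv
          (fun x hx => (hutB x hx).trans (le_max_left Bu Bv))
          (fun x hx => (hBv x hx).trans (le_max_right Bu Bv))
          fun x hx => (hutk x hx).trans (hvk x hx)
      · refine hstrict hm1 hlam.le ⟨fun _ => min (-Bk) (-(H + 1) / lam), ⟨_, fun _ _ => le_rfl⟩,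
          1, one_pos, IsStatSub.of_const hΩo hm (fun x hx => ?_) fun x hx => ?_⟩
        · have h1 : lam * min (-Bk) (-(H + 1) / lam) ≤ lam * (-(H + 1) / lam) := by
            gcongr
            exact min_le_right _ _
          rw [mul_div_cancel₀ _ hlam.ne'] at h1
          have := (abs_le.1 (hH x (subset_closure hx))).1
          linarith
        · exact (min_le_left _ _).trans (abs_le.1 (hBk x hx)).1
    · subst hlam
      exact hstrict hm le_rfl ⟨w, hwb, η, hη, hw.mono_boundary fun x _ => by linarith⟩
  refine ⟨fun x hx => ?_, hut, ⟨Bu, hutB⟩, hcomp⟩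
  rw [← uscExtStat_of_mem u hx]
  exact hcomp x (subset_closure hx)
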